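/- Let (X₁,μ₁), (X₂,μ₂), (Y₁,ν₁), (Y₂,ν₂) be standard measure spaces. For i = 1, …, r, let κ_i ⊆ X₁×X₂ be a set of finite width and λ_i ⊆ Y₁×Y₂ be an ω-closed set. Suppose that for every choice of indices 1 ≤ m₁ < m₂ < ⋯ < m_p ≤ r, the union ∪_{k=1}^p λ_{m_k} is operator synthetic. Then the set ρ(∪_{i=1}^r κ_i × λ_i) is operator synthetic. -/

import Mathlib

open scoped ComplexInnerProductSpace Pointwise
open Set MeasureTheory

noncomputable section

namespace OpSynth

/-! ### The σ-weak (weak*) topology on `B(H,K)` -/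

/-- The σ-weak (weak*) topology on the space of bounded operators between Hilbert
spaces: the initial topology with respect to the functionals
`T ↦ ∑' n, ⟪η n, T (ξ n)⟫` associated to square-summable sequences `ξ`, `η`.
This is the weak* topology arising from the identification of `B(H,K)` with the
dual of the trace class operators. -/
def sigmaWeak (H K : Type*) [NormedAddCommGroup H] [InnerProductSpace ℂ H]
    [NormedAddCommGroup K] [InnerProductSpace ℂ K] :
    TopologicalSpace (H →L[ℂ] K) :=
  ⨅ (ξ : ℕ → H) (η : ℕ → K) (_ : Summable fun n => ‖ξ n‖ ^ 2)
    (_ : Summable fun n => ‖η n‖ ^ 2),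
    TopologicalSpace.induced
      (fun T : H →L[ℂ] K => ∑' n, ⟪η n, T (ξ n)⟫) inferInstance

section Basic

variable {H K H₁ H₂ H₃ K₁ K₂ T₁ T₂ : Type*}
  [NormedAddCommGroup H] [InnerProductSpace ℂ H]
  [NormedAddCommGroup K] [InnerProductSpace ℂ K]
  [NormedAddCommGroup H₁] [InnerProductSpace ℂ H₁]
  [NormedAddCommGroup H₂] [InnerProductSpace ℂ H₂]
  [NormedAddCommGroup H₃] [InnerProductSpace ℂ H₃]
  [NormedAddCommGroup K₁] [InnerProductSpace ℂ K₁]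
  [NormedAddCommGroup K₂] [InnerProductSpace ℂ K₂]
  [NormedAddCommGroup T₁] [InnerProductSpace ℂ T₁]
  [NormedAddCommGroup T₂] [InnerProductSpace ℂ T₂]

/-- A set of operators is weak* closed if it is closed in the σ-weak topology. -/
def WkClosed (S : Set (H →L[ℂ] K)) : Prop :=
  @IsClosed _ (sigmaWeak H K) S

/-- The weak* closure of a set of operators. -/
def wkClosure (S : Set (H →L[ℂ] K)) : Set (H →L[ℂ] K) :=
  @closure _ (sigmaWeak H K) S

/-- A weak* closed (linear) subspace of `B(H,K)`. -/
def IsWkClosedSubspace (S : Set (H →L[ℂ] K)) : Prop :=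
  (∃ M : Submodule ℂ (H →L[ℂ] K), (M : Set (H →L[ℂ] K)) = S) ∧ WkClosed S

/-- A map between operator spaces is weak* continuous if it is continuous with
respect to the σ-weak topologies. -/
def WkContinuous (φ : (H₁ →L[ℂ] H₂) → (K₁ →L[ℂ] K₂)) : Prop :=
  @Continuous _ _ (sigmaWeak H₁ H₂) (sigmaWeak K₁ K₂) φ

/-- The norm of an `n × n` matrix of operators, viewed as an operator on the
column Hilbert space `ℓ²(Fin n, H)`: the supremum over the unit ball of the
ℓ²-norm of the image. -/
def blockNorm {n : ℕ} (M : Matrix (Fin n) (Fin n) (H →L[ℂ] K)) : ℝ :=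
  sSup { r | ∃ v : Fin n → H, (∑ j, ‖v j‖ ^ 2) ≤ 1 ∧
    r = Real.sqrt (∑ i, ‖∑ j, M i j (v j)‖ ^ 2) }

/-- A map `φ : B(H₁,H₂) → B(K₁,K₂)` is completely bounded if its matrix
amplifications are uniformly bounded. -/
def CompletelyBounded (φ : (H₁ →L[ℂ] H₂) → (K₁ →L[ℂ] K₂)) : Prop :=
  ∃ C : ℝ, 0 ≤ C ∧ ∀ (n : ℕ) (M : Matrix (Fin n) (Fin n) (H₁ →L[ℂ] H₂)),
    blockNorm (M.map φ) ≤ C * blockNorm M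

/-- `t : H → K → T₁` realizes `T₁` as the Hilbertian tensor product `H ⊗ K`:
`t` is bilinear, multiplicative for inner products, and has total range. -/
def IsTensorEmbedding (t : H → K → T₁) : Prop :=
  (∀ x x' y, t (x + x') y = t x y + t x' y) ∧
  (∀ x y y', t x (y + y') = t x y + t x y') ∧
  (∀ (c : ℂ) x y, t (c • x) y = c • t x y) ∧
  (∀ (c : ℂ) x y, t x (c • y) = c • t x y) ∧
  (∀ x x' y y', ⟪t x y, t x' y'⟫ = ⟪x, x'⟫ * ⟪y, y'⟫) ∧
  (Submodule.span ℂ { z | ∃ x y, z = t x y }).topologicalClosure = ⊤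

/-- `W` is the elementary tensor `S ⊗ R` of the operators `S` and `R`, relative
to the tensor product realizations `t₁`, `t₂`. -/
def IsElemTensor (t₁ : H₁ → K₁ → T₁) (t₂ : H₂ → K₂ → T₂)
    (W : T₁ →L[ℂ] T₂) (S : H₁ →L[ℂ] H₂) (R : K₁ →L[ℂ] K₂) : Prop :=
  ∀ x y, W (t₁ x y) = t₂ (S x) (R y)

/-- The weak* closed tensor product `V ⊗̄ U`: the weak* closed subspace generated
by the elementary tensors `S ⊗ R` with `S ∈ V`, `R ∈ U`. -/
def wTensor (t₁ : H₁ → K₁ → T₁) (t₂ : H₂ → K₂ → T₂)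
    (V : Set (H₁ →L[ℂ] H₂)) (U : Set (K₁ →L[ℂ] K₂)) : Set (T₁ →L[ℂ] T₂) :=
  wkClosure ↑(Submodule.span ℂ
    { W : T₁ →L[ℂ] T₂ | ∃ S ∈ V, ∃ R ∈ U, IsElemTensor t₁ t₂ W S R })

/-- The Fubini product `F(V,U) = (V ⊗̄ B(K₁,K₂)) ∩ (B(H₁,H₂) ⊗̄ U)`. -/
def Fubini (t₁ : H₁ → K₁ → T₁) (t₂ : H₂ → K₂ → T₂)
    (V : Set (H₁ →L[ℂ] H₂)) (U : Set (K₁ →L[ℂ] K₂)) : Set (T₁ →L[ℂ] T₂) :=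
  wTensor t₁ t₂ V univ ∩ wTensor t₁ t₂ univ U

/-- Sum of finitely many subsets of an additive monoid. -/
def setSum {α : Type*} [AddCommMonoid α] {n : ℕ} (S : Fin n → Set α) : Set α :=
  { x | ∃ f : Fin n → α, (∀ i, f i ∈ S i) ∧ x = ∑ i, f i }

/-- The reflexive hull `Ref W = {T : Tx ∈ closure (W x) for all x}`. -/
def RefHull (W : Set (H →L[ℂ] K)) : Set (H →L[ℂ] K) :=
  { T | ∀ x : H, T x ∈ closure ((fun S : H →L[ℂ] K => S x) '' W) }

end Basic

/-- Property `S_σ`: `F(V,U) = V ⊗̄ U` for every weak* closed subspace `U` of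
`B(K₁,K₂)`, all Hilbert spaces `K₁`, `K₂`, and all realizations of the
corresponding Hilbertian tensor products. -/
def HasSsigma {H₁ H₂ : Type*}
    [NormedAddCommGroup H₁] [InnerProductSpace ℂ H₁]
    [NormedAddCommGroup H₂] [InnerProductSpace ℂ H₂]
    (V : Set (H₁ →L[ℂ] H₂)) : Prop :=
  ∀ (K₁ K₂ T₁ T₂ : Type)
    [NormedAddCommGroup K₁] [InnerProductSpace ℂ K₁] [CompleteSpace K₁]
    [NormedAddCommGroup K₂] [InnerProductSpace ℂ K₂] [CompleteSpace K₂]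
    [NormedAddCommGroup T₁] [InnerProductSpace ℂ T₁] [CompleteSpace T₁]
    [NormedAddCommGroup T₂] [InnerProductSpace ℂ T₂] [CompleteSpace T₂]
    (t₁ : H₁ → K₁ → T₁) (t₂ : H₂ → K₂ → T₂),
    IsTensorEmbedding t₁ → IsTensorEmbedding t₂ →
    ∀ U : Set (K₁ →L[ℂ] K₂), IsWkClosedSubspace U →
      Fubini t₁ t₂ V U = wTensor t₁ t₂ V U

section Masa

variable {H H₁ H₂ H₃ : Type*}
  [NormedAddCommGroup H] [InnerProductSpace ℂ H] [CompleteSpace H]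
  [NormedAddCommGroup H₁] [InnerProductSpace ℂ H₁] [CompleteSpace H₁]
  [NormedAddCommGroup H₂] [InnerProductSpace ℂ H₂] [CompleteSpace H₂]
  [NormedAddCommGroup H₃] [InnerProductSpace ℂ H₃] [CompleteSpace H₃]

/-- A masa: a maximal abelian selfadjoint subalgebra of `B(H)`. -/
def IsMasa (D : StarSubalgebra ℂ (H →L[ℂ] H)) : Prop :=
  (∀ a ∈ D, ∀ b ∈ D, a * b = b * a) ∧
  ∀ E : StarSubalgebra ℂ (H →L[ℂ] H),
    (∀ a ∈ E, ∀ b ∈ E, a * b = b * a) → D ≤ E → E = D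

/-- A (weak* closed) `D₂,D₁`-masa-bimodule. -/
def IsMasaBimodule (D₁ : StarSubalgebra ℂ (H₁ →L[ℂ] H₁))
    (D₂ : StarSubalgebra ℂ (H₂ →L[ℂ] H₂)) (V : Set (H₁ →L[ℂ] H₂)) : Prop :=
  IsWkClosedSubspace V ∧
  ∀ X ∈ V, ∀ A ∈ D₁, ∀ B ∈ D₂, B ∘L X ∘L A ∈ V

/-- A ternary set of operators: closed under the triple product `T S* R`. -/
def IsTernary (M : Set (H₁ →L[ℂ] H₂)) : Prop :=
  ∀ T ∈ M, ∀ S ∈ M, ∀ R ∈ M, T ∘L (ContinuousLinearMap.adjoint S) ∘L R ∈ M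

/-- An orthogonal projection. -/
def IsProj (p : H →L[ℂ] H) : Prop := p ∘L p = p ∧ IsSelfAdjoint p

/-- A minimal non-zero projection of a masa. -/
def IsMinimalProjOf (D : StarSubalgebra ℂ (H →L[ℂ] H)) (p : H →L[ℂ] H) : Prop :=
  p ∈ D ∧ IsProj p ∧ p ≠ 0 ∧
    ∀ q ∈ D, IsProj q → p ∘L q = q → q = 0 ∨ q = p

/-- A projection in a masa is non-atomic if it dominates no minimal non-zero
projection of the masa. -/
def IsNonAtomicProj (D : StarSubalgebra ℂ (H →L[ℂ] H)) (E : H →L[ℂ] H) : Prop :=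
  ∀ p, IsMinimalProjOf D p → ¬ (E ∘L p = p)

/-- A `D₂,D₁`-masa-bimodule map. -/
def IsMasaBimoduleMap (D₁ : StarSubalgebra ℂ (H₁ →L[ℂ] H₁))
    (D₂ : StarSubalgebra ℂ (H₂ →L[ℂ] H₂))
    (φ : (H₁ →L[ℂ] H₂) → (H₁ →L[ℂ] H₂)) : Prop :=
  ∀ (X : H₁ →L[ℂ] H₂), ∀ A ∈ D₁, ∀ B ∈ D₂,
    φ (B ∘L X ∘L A) = B ∘L (φ X) ∘L A

/-- A Schur idempotent: a weak* continuous completely bounded idempotent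
masa-bimodule map. -/
def IsSchurIdempotent (D₁ : StarSubalgebra ℂ (H₁ →L[ℂ] H₁))
    (D₂ : StarSubalgebra ℂ (H₂ →L[ℂ] H₂))
    (φ : (H₁ →L[ℂ] H₂) → (H₁ →L[ℂ] H₂)) : Prop :=
  IsLinearMap ℂ φ ∧ WkContinuous φ ∧ CompletelyBounded φ ∧ φ ∘ φ = φ ∧
    IsMasaBimoduleMap D₁ D₂ φ

/-- A nest: a totally ordered family of closed subspaces containing the
intersection and the closed linear span of any of its subsets. -/
def IsNest (N : Set (Submodule ℂ H)) : Prop :=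
  (∀ p ∈ N, IsClosed (p : Set H)) ∧ IsChain (· ≤ ·) N ∧
  ∀ S : Set (Submodule ℂ H), S ⊆ N →
    sInf S ∈ N ∧ (sSup S).topologicalClosure ∈ N

/-- The nest algebra of a nest: all operators leaving each subspace invariant. -/
def nestAlg (N : Set (Submodule ℂ H)) : Set (H →L[ℂ] H) :=
  { T | ∀ p ∈ N, ∀ x ∈ p, T x ∈ p }

/-- A (weak* closed) nest algebra bimodule. -/
def IsNestBimodule (V : Set (H₁ →L[ℂ] H₂)) : Prop :=
  IsWkClosedSubspace V ∧
  ∃ (N₁ : Set (Submodule ℂ H₁)) (N₂ : Set (Submodule ℂ H₂)),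
    IsNest N₁ ∧ IsNest N₂ ∧
    ∀ X ∈ V, ∀ A ∈ nestAlg N₁, ∀ B ∈ nestAlg N₂, B ∘L X ∘L A ∈ V

/-- A masa-bimodule of finite width: a finite intersection of masa-bimodules
each of which is a nest algebra bimodule. -/
def HasFiniteWidth (D₁ : StarSubalgebra ℂ (H₁ →L[ℂ] H₁))
    (D₂ : StarSubalgebra ℂ (H₂ →L[ℂ] H₂)) (V : Set (H₁ →L[ℂ] H₂)) : Prop :=
  ∃ (k : ℕ) (Vs : Fin k → Set (H₁ →L[ℂ] H₂)),
    (∀ j, IsMasaBimodule D₁ D₂ (Vs j) ∧ IsNestBimodule (Vs j)) ∧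
    V = ⋂ j, Vs j

end Masa

section Algebras

variable {H H₁ H₂ H₃ K : Type*}
  [NormedAddCommGroup H] [InnerProductSpace ℂ H] [CompleteSpace H]
  [NormedAddCommGroup H₁] [InnerProductSpace ℂ H₁] [CompleteSpace H₁]
  [NormedAddCommGroup H₂] [InnerProductSpace ℂ H₂] [CompleteSpace H₂]
  [NormedAddCommGroup H₃] [InnerProductSpace ℂ H₃] [CompleteSpace H₃]

/-- A weak* closed unital operator algebra in `B(H)`. -/
def IsWkClosedUnitalAlg (A : Set (H →L[ℂ] H)) : Prop :=
  IsWkClosedSubspace A ∧ (1 : H →L[ℂ] H) ∈ A ∧ ∀ a ∈ A, ∀ b ∈ A, a ∘L b ∈ A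

/-- `[X Y]`: the weak* closed linear span of the products `x ∘ y`. -/
def mulSpan (X : Set (H₂ →L[ℂ] H₃)) (Y : Set (H₁ →L[ℂ] H₂)) :
    Set (H₁ →L[ℂ] H₃) :=
  wkClosure ↑(Submodule.span ℂ { T : H₁ →L[ℂ] H₃ | ∃ x ∈ X, ∃ y ∈ Y, T = x ∘L y })

/-- The data witnessing a spatial embedding of `A` into `B`. -/
def SpatialPair (A : Set (H₁ →L[ℂ] H₁)) (B : Set (H₂ →L[ℂ] H₂))
    (X : Set (H₁ →L[ℂ] H₂)) (Y : Set (H₂ →L[ℂ] H₁)) : Prop :=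
  IsWkClosedSubspace X ∧ IsWkClosedSubspace Y ∧
  (∀ x ∈ X, ∀ b ∈ B, ∀ a ∈ A, b ∘L x ∘L a ∈ X) ∧
  (∀ y ∈ Y, ∀ a ∈ A, ∀ b ∈ B, a ∘L y ∘L b ∈ Y) ∧
  mulSpan X Y ⊆ B ∧ mulSpan Y X = A

/-- `A` is spatially embedded in `B`. -/
def SpatiallyEmbedded (A : Set (H₁ →L[ℂ] H₁)) (B : Set (H₂ →L[ℂ] H₂)) : Prop :=
  ∃ X Y, SpatialPair A B X Y

/-- `A` and `B` are spatially Morita equivalent. -/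
def SpatiallyMorita (A : Set (H₁ →L[ℂ] H₁)) (B : Set (H₂ →L[ℂ] H₂)) : Prop :=
  ∃ X Y, SpatialPair A B X Y ∧ mulSpan X Y = B

/-- The strong operator topology on `B(H,K)`. -/
def sot (H K : Type*) [NormedAddCommGroup H] [InnerProductSpace ℂ H]
    [NormedAddCommGroup K] [InnerProductSpace ℂ K] :
    TopologicalSpace (H →L[ℂ] K) :=
  TopologicalSpace.induced (fun T : H →L[ℂ] K => (T : H → K)) Pi.topologicalSpace

/-- A commutative subspace lattice (CSL): a strongly closed lattice of mutually
commuting orthogonal projections containing `0` and `1`. -/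
def IsCSL (L : Set (H →L[ℂ] H)) : Prop :=
  (∀ P ∈ L, IsProj P) ∧
  (∀ P ∈ L, ∀ Q ∈ L, P ∘L Q = Q ∘L P) ∧
  (0 : H →L[ℂ] H) ∈ L ∧ (1 : H →L[ℂ] H) ∈ L ∧
  (∀ P ∈ L, ∀ Q ∈ L, P ∘L Q ∈ L ∧ P + Q - P ∘L Q ∈ L) ∧
  @IsClosed _ (sot H H) L

/-- The CSL algebra `Alg L = {T : (1 - P) T P = 0 for all P ∈ L}`. -/
def cslAlg (L : Set (H →L[ℂ] H)) : Set (H →L[ℂ] H) :=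
  { T | ∀ P ∈ L, (1 - P) ∘L T ∘L P = 0 }

/-- A lattice homomorphism between CSLs (preserving meets and joins). -/
def IsLatticeHom (L₁ : Set (H₁ →L[ℂ] H₁)) (L₂ : Set (H₂ →L[ℂ] H₂))
    (φ : (H₁ →L[ℂ] H₁) → (H₂ →L[ℂ] H₂)) : Prop :=
  MapsTo φ L₁ L₂ ∧
  (∀ P ∈ L₁, ∀ Q ∈ L₁, φ (P ∘L Q) = φ P ∘L φ Q) ∧
  (∀ P ∈ L₁, ∀ Q ∈ L₁, φ (P + Q - P ∘L Q) = φ P + φ Q - φ P ∘L φ Q)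

end Algebras

section MeasurePart

variable {X X₁ X₂ : Type*} [MeasurableSpace X] [MeasurableSpace X₁] [MeasurableSpace X₂]

/-- A subset of a product of measure spaces is marginally null if it is
contained in `(M₁ × X₂) ∪ (X₁ × M₂)` with `μ₁ M₁ = μ₂ M₂ = 0`. -/
def MargNull (μ₁ : Measure X₁) (μ₂ : Measure X₂) (E : Set (X₁ × X₂)) : Prop :=
  ∃ (M₁ : Set X₁) (M₂ : Set X₂), MeasurableSet M₁ ∧ MeasurableSet M₂ ∧
    μ₁ M₁ = 0 ∧ μ₂ M₂ = 0 ∧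
    E ⊆ (M₁ ×ˢ (univ : Set X₂)) ∪ ((univ : Set X₁) ×ˢ M₂)

/-- Marginal equivalence: the symmetric difference is marginally null. -/
def MargEquiv (μ₁ : Measure X₁) (μ₂ : Measure X₂) (E F : Set (X₁ × X₂)) : Prop :=
  MargNull μ₁ μ₂ ((E \ F) ∪ (F \ E))

/-- ω-open sets: marginally equivalent to a countable union of measurable
rectangles. -/
def OmegaOpen (μ₁ : Measure X₁) (μ₂ : Measure X₂) (E : Set (X₁ × X₂)) : Prop :=
  ∃ (α : ℕ → Set X₁) (β : ℕ → Set X₂),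
    (∀ n, MeasurableSet (α n)) ∧ (∀ n, MeasurableSet (β n)) ∧
    MargEquiv μ₁ μ₂ E (⋃ n, (α n) ×ˢ (β n))

/-- ω-closed sets: complements of ω-open sets. -/
def OmegaClosed (μ₁ : Measure X₁) (μ₂ : Measure X₂) (E : Set (X₁ × X₂)) : Prop :=
  OmegaOpen μ₁ μ₂ Eᶜ

/-- `A` is a multiplication operator on `L²(X,μ)`: `A f = φ · f` for some
essentially bounded function `φ`.  The collection `{A | IsMultOp μ A}` is the
multiplication masa of `L^∞(X,μ)`. -/
def IsMultOp (μ : Measure X) (A : Lp ℂ 2 μ →L[ℂ] Lp ℂ 2 μ) : Prop :=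
  ∃ φ : X → ℂ, AEStronglyMeasurable φ μ ∧ (∃ C, ∀ᵐ x ∂μ, ‖φ x‖ ≤ C) ∧
    ∀ f : Lp ℂ 2 μ, ⇑(A f) =ᵐ[μ] fun x => φ x * f x

/-- A (weak* closed) masa-bimodule over the multiplication masas. -/
def IsMultBimodule (μ₁ : Measure X₁) (μ₂ : Measure X₂)
    (V : Set (Lp ℂ 2 μ₁ →L[ℂ] Lp ℂ 2 μ₂)) : Prop :=
  IsWkClosedSubspace V ∧
  ∀ X ∈ V, ∀ (A : Lp ℂ 2 μ₁ →L[ℂ] Lp ℂ 2 μ₁) (B : Lp ℂ 2 μ₂ →L[ℂ] Lp ℂ 2 μ₂),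
    IsMultOp μ₁ A → IsMultOp μ₂ B → B ∘L X ∘L A ∈ V

/-- `T` is supported on `κ`: `M_{χ_β} T M_{χ_α} = 0` (equivalently,
`⟪T f, g⟫ = 0` whenever `f` vanishes off `α` and `g` vanishes off `β`)
whenever the rectangle `α × β` intersects `κ` marginally nullly. -/
def SupportedOn (μ₁ : Measure X₁) (μ₂ : Measure X₂) (κ : Set (X₁ × X₂))
    (T : Lp ℂ 2 μ₁ →L[ℂ] Lp ℂ 2 μ₂) : Prop :=
  ∀ (α : Set X₁) (β : Set X₂), MeasurableSet α → MeasurableSet β →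
    MargNull μ₁ μ₂ ((α ×ˢ β) ∩ κ) →
    ∀ (f : Lp ℂ 2 μ₁) (g : Lp ℂ 2 μ₂),
      (∀ᵐ x ∂μ₁, x ∉ α → f x = 0) → (∀ᵐ y ∂μ₂, y ∉ β → g y = 0) →
      ⟪T f, g⟫ = (0 : ℂ)

/-- `M_max κ`: the space of all operators supported on `κ` — the largest
masa-bimodule with support `κ`. -/
def Mmax (μ₁ : Measure X₁) (μ₂ : Measure X₂) (κ : Set (X₁ × X₂)) :
    Set (Lp ℂ 2 μ₁ →L[ℂ] Lp ℂ 2 μ₂) :=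
  { T | SupportedOn μ₁ μ₂ κ T }

/-- `U` has support `κ`: `κ` is ω-closed and `Ref U = M_max κ`. -/
def HasSupport (μ₁ : Measure X₁) (μ₂ : Measure X₂)
    (U : Set (Lp ℂ 2 μ₁ →L[ℂ] Lp ℂ 2 μ₂)) (κ : Set (X₁ × X₂)) : Prop :=
  OmegaClosed μ₁ μ₂ κ ∧ RefHull U = Mmax μ₁ μ₂ κ

/-- `M_min κ`: the smallest weak* closed masa-bimodule with support `κ`,
realized as the intersection of all weak* closed masa-bimodules with support `κ`. -/
def Mmin (μ₁ : Measure X₁) (μ₂ : Measure X₂) (κ : Set (X₁ × X₂)) :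
    Set (Lp ℂ 2 μ₁ →L[ℂ] Lp ℂ 2 μ₂) :=
  ⋂₀ { U | IsMultBimodule μ₁ μ₂ U ∧ HasSupport μ₁ μ₂ U κ }

/-- `κ` is operator synthetic if it is ω-closed and `M_min κ = M_max κ`. -/
def OperatorSynthetic (μ₁ : Measure X₁) (μ₂ : Measure X₂)
    (κ : Set (X₁ × X₂)) : Prop :=
  OmegaClosed μ₁ μ₂ κ ∧ Mmin μ₁ μ₂ κ = Mmax μ₁ μ₂ κ

/-- A masa-bimodule of finite width over the multiplication masas. -/
def MultFiniteWidth (μ₁ : Measure X₁) (μ₂ : Measure X₂)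
    (V : Set (Lp ℂ 2 μ₁ →L[ℂ] Lp ℂ 2 μ₂)) : Prop :=
  ∃ (k : ℕ) (Vs : Fin k → Set (Lp ℂ 2 μ₁ →L[ℂ] Lp ℂ 2 μ₂)),
    (∀ j, IsMultBimodule μ₁ μ₂ (Vs j) ∧ IsNestBimodule (Vs j)) ∧
    V = ⋂ j, Vs j

/-- A set of finite width: the support of a masa-bimodule of finite width. -/
def FiniteWidthSet (μ₁ : Measure X₁) (μ₂ : Measure X₂)
    (κ : Set (X₁ × X₂)) : Prop :=
  ∃ V, MultFiniteWidth μ₁ μ₂ V ∧ HasSupport μ₁ μ₂ V κ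

end MeasurePart

/-- The flip `ρ : (X₁ × X₂) × (Y₁ × Y₂) → (X₁ × Y₁) × (X₂ × Y₂)`. -/
def flipProd {X₁ X₂ Y₁ Y₂ : Type*} :
    (X₁ × X₂) × (Y₁ × Y₂) → (X₁ × Y₁) × (X₂ × Y₂) :=
  fun q => ((q.1.1, q.2.1), (q.1.2, q.2.2))

end OpSynth



open scoped ComplexInnerProductSpace Pointwise
open Set MeasureTheory OpSynth


abbrev HH (H : Type*) [NormedAddCommGroup H] : Type _ := lp (fun _ : ℕ => H) 2

section HS
variable {H K L : Type*} [NormedAddCommGroup H] [InnerProductSpace ℂ H]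
  [NormedAddCommGroup K] [InnerProductSpace ℂ K]
  [NormedAddCommGroup L] [InnerProductSpace ℂ L]

def mkH (f : ℕ → H) (hf : Summable fun n => ‖f n‖ ^ 2) : HH H :=
  ⟨f, by
    apply memℓp_gen
    simpa using hf⟩

@[simp] lemma mkH_apply (f : ℕ → H) (hf) (n : ℕ) : mkH f hf n = f n := rfl

lemma HH_hasSum (ξ : HH H) : HasSum (fun n => ‖ξ n‖ ^ 2) (‖ξ‖ ^ 2) := by
  have := lp.hasSum_norm (p := 2) (by norm_num) ξ
  simpa using this

lemma HH_summable (ξ : HH H) : Summable (fun n => ‖ξ n‖ ^ 2) := (HH_hasSum ξ).summable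

lemma HH_norm_sq (ξ : HH H) : ‖ξ‖ ^ 2 = ∑' n, ‖ξ n‖ ^ 2 := (HH_hasSum ξ).tsum_eq.symm

lemma HH_norm_apply (ξ : HH H) (n : ℕ) : ‖ξ n‖ ≤ ‖ξ‖ :=
  lp.norm_apply_le_norm (by norm_num) ξ n

def amp (T : H →L[ℂ] K) : HH H →L[ℂ] HH K :=
  lp.mapCLM 2 (fun _ => T) (norm_nonneg T) (fun _ => le_rfl)

@[simp] lemma amp_apply (T : H →L[ℂ] K) (ξ : HH H) (n : ℕ) : amp T ξ n = T (ξ n) := rfl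

lemma amp_norm (T : H →L[ℂ] K) : ‖amp T‖ ≤ ‖T‖ := lp.norm_mapCLM_le _ _ _ _

lemma amp_le (T : H →L[ℂ] K) (ξ : HH H) : ‖amp T ξ‖ ≤ ‖T‖ * ‖ξ‖ :=
  (amp T).le_of_opNorm_le (amp_norm T) ξ

def pr (T : H →L[ℂ] K) (ξ : HH H) (η : HH K) : ℂ := ⟪η, amp T ξ⟫

lemma pr_eq (T : H →L[ℂ] K) (ξ : HH H) (η : HH K) : pr T ξ η = ∑' n, ⟪η n, T (ξ n)⟫ :=
  lp.inner_eq_tsum _ _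

lemma pr_hasSum (T : H →L[ℂ] K) (ξ : HH H) (η : HH K) :
    HasSum (fun n => ⟪η n, T (ξ n)⟫) (pr T ξ η) :=
  lp.hasSum_inner η (amp T ξ)

lemma pr_le (T : H →L[ℂ] K) (ξ : HH H) (η : HH K) : ‖pr T ξ η‖ ≤ ‖T‖ * ‖ξ‖ * ‖η‖ := by
  have h1 := norm_inner_le_norm (𝕜 := ℂ) η (amp T ξ)
  have h2 := amp_le T ξ
  unfold pr
  nlinarith [norm_nonneg η]

lemma pr_add_left (S T : H →L[ℂ] K) (ξ : HH H) (η : HH K) :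
    pr (S + T) ξ η = pr S ξ η + pr T ξ η := by
  have : amp (S + T) ξ = amp S ξ + amp T ξ := by ext n; simp
  simp [pr, this, inner_add_right]

lemma pr_smul_left (c : ℂ) (T : H →L[ℂ] K) (ξ : HH H) (η : HH K) :
    pr (c • T) ξ η = c * pr T ξ η := by
  have : amp (c • T) ξ = c • amp T ξ := by ext n; simp
  simp [pr, this, inner_smul_right]

def prL (ξ : HH H) (η : HH K) : (H →L[ℂ] K) →ₗ[ℂ] ℂ where
  toFun T := pr T ξ η
  map_add' S T := pr_add_left S T ξ η
  map_smul' c T := pr_smul_left c T ξ η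

@[simp] lemma prL_apply (ξ : HH H) (η : HH K) (T : H →L[ℂ] K) : prL ξ η T = pr T ξ η := rfl

lemma pr_sum {ι : Type*} (s : Finset ι) (T : ι → H →L[ℂ] K) (ξ : HH H) (η : HH K) :
    pr (∑ i ∈ s, T i) ξ η = ∑ i ∈ s, pr (T i) ξ η := map_sum (prL ξ η) T s

lemma pr_add_mid (T : H →L[ℂ] K) (ξ ξ' : HH H) (η : HH K) :
    pr T (ξ + ξ') η = pr T ξ η + pr T ξ' η := by simp [pr, inner_add_right]
lemma pr_add_right (T : H →L[ℂ] K) (ξ : HH H) (η η' : HH K) :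
    pr T ξ (η + η') = pr T ξ η + pr T ξ η' := by simp [pr, inner_add_left]
lemma pr_sub_mid (T : H →L[ℂ] K) (ξ ξ' : HH H) (η : HH K) :
    pr T (ξ - ξ') η = pr T ξ η - pr T ξ' η := by simp [pr, inner_sub_right]
lemma pr_sub_right (T : H →L[ℂ] K) (ξ : HH H) (η η' : HH K) :
    pr T ξ (η - η') = pr T ξ η - pr T ξ η' := by simp [pr, inner_sub_left]
lemma pr_smul_mid (T : H →L[ℂ] K) (c : ℂ) (ξ : HH H) (η : HH K) :
    pr T (c • ξ) η = c * pr T ξ η := by simp [pr, inner_smul_right]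

lemma pr_comp {H' K' : Type*} [NormedAddCommGroup H'] [InnerProductSpace ℂ H']
    [NormedAddCommGroup K'] [InnerProductSpace ℂ K']
    (T : H →L[ℂ] K) (A : H' →L[ℂ] H) (B : K →L[ℂ] K') (B' : K' →L[ℂ] K)
    (hB : ∀ x y, ⟪x, B y⟫ = ⟪B' x, y⟫) (ξ : HH H') (η : HH K') :
    pr (B ∘L T ∘L A) ξ η = pr T (amp A ξ) (amp B' η) := by
  simp [pr_eq, hB]

def ilf (ξ ξ' : ℕ → H) (n : ℕ) : H := if n % 2 = 0 then ξ (n / 2) else ξ' (n / 2)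
lemma ilf_even (ξ ξ' : ℕ → H) (k : ℕ) : ilf ξ ξ' (2 * k) = ξ k := by simp [ilf]
lemma ilf_odd (ξ ξ' : ℕ → H) (k : ℕ) : ilf ξ ξ' (2 * k + 1) = ξ' k := by
  have h1 : (2 * k + 1) % 2 = 1 := by omega
  have h2 : (2 * k + 1) / 2 = k := by omega
  simp [ilf, h1, h2]

lemma il_hasSum (ξ ξ' : HH H) :
    HasSum (fun n => ‖ilf ξ ξ' n‖ ^ 2) (‖ξ‖ ^ 2 + ‖ξ'‖ ^ 2) := by
  apply HasSum.even_add_odd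
  · simpa [ilf_even] using HH_hasSum ξ
  · simpa [ilf_odd] using HH_hasSum ξ'

def il (ξ ξ' : HH H) : HH H := mkH (ilf ξ ξ') (il_hasSum ξ ξ').summable

lemma il_norm_sq (ξ ξ' : HH H) : ‖il ξ ξ'‖ ^ 2 = ‖ξ‖ ^ 2 + ‖ξ'‖ ^ 2 := by
  rw [HH_norm_sq]; exact (il_hasSum ξ ξ').tsum_eq

@[simp] lemma il_even (ξ ξ' : HH H) (k : ℕ) : il ξ ξ' (2 * k) = ξ k := ilf_even _ _ k
@[simp] lemma il_odd (ξ ξ' : HH H) (k : ℕ) : il ξ ξ' (2 * k + 1) = ξ' k := ilf_odd _ _ k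

lemma pr_il (T : H →L[ℂ] K) (ξ ξ' : HH H) (η η' : HH K) :
    pr T (il ξ ξ') (il η η') = pr T ξ η + pr T ξ' η' := by
  rw [pr_eq]
  apply HasSum.tsum_eq
  apply HasSum.even_add_odd
  · simpa using pr_hasSum T ξ η
  · simpa using pr_hasSum T ξ' η'

/-- single vector -/
def sg (x : H) : HH H := lp.single 2 0 x

lemma sg_norm (x : H) : ‖sg x‖ = ‖x‖ := lp.norm_single (by norm_num) _ _

@[simp] lemma sg_zero_apply (x : H) : sg x 0 = x := by simp [sg]
lemma sg_succ_apply (x : H) {n : ℕ} (hn : n ≠ 0) : sg x n = 0 := by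
  simp [sg, Pi.single_eq_of_ne hn]

lemma pr_sg (T : H →L[ℂ] K) (x : H) (y : K) : pr T (sg x) (sg y) = ⟪y, T x⟫ := by
  rw [pr_eq, tsum_eq_single 0]
  · simp
  · intro n hn; simp [sg_succ_apply _ hn]

lemma sigmaWeak_eq : sigmaWeak H K = ⨅ p : HH H × HH K,
    TopologicalSpace.induced (fun T : H →L[ℂ] K => pr T p.1 p.2) inferInstance := by
  unfold sigmaWeak
  apply le_antisymm
  · refine le_iInf fun p => ?_
    refine (iInf_le_of_le (p.1 : ℕ → H) <| iInf_le_of_le (p.2 : ℕ → K) <|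
      iInf_le_of_le (HH_summable p.1) <| iInf_le_of_le (HH_summable p.2) ?_)
    apply le_of_eq; simp_rw [pr_eq]
  · refine le_iInf fun ξ => le_iInf fun η => le_iInf fun h1 => le_iInf fun h2 => ?_
    refine iInf_le_of_le (mkH ξ h1, mkH η h2) ?_
    apply le_of_eq; simp_rw [pr_eq]; rfl

lemma sigmaWeak_eq' : sigmaWeak H K = TopologicalSpace.induced
    (fun (T : H →L[ℂ] K) (p : HH H × HH K) => pr T p.1 p.2) inferInstance := by
  rw [sigmaWeak_eq]
  rw [Pi.topologicalSpace.eq_1, induced_iInf]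
  simp_rw [induced_compose]
  rfl

lemma wk_annih (S : Set (HH H × HH K)) :
    IsWkClosedSubspace {T : H →L[ℂ] K | ∀ p ∈ S, pr T p.1 p.2 = 0} := by
  refine ⟨⟨⨅ p ∈ S, LinearMap.ker (prL p.1 p.2), ?_⟩, ?_⟩
  · ext T; simp
  · unfold WkClosed
    rw [sigmaWeak_eq']
    rw [isClosed_induced_iff]
    refine ⟨⋂ p ∈ S, {φ | φ p = 0}, ?_, ?_⟩
    · exact isClosed_biInter fun p _ => isClosed_eq (continuous_apply p) continuous_const
    · ext T; simp

lemma fin_comb {ι : Type*} (s : Finset ι) (c : ι → ℂ) (p : ι → HH H × HH K) :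
    ∃ ξ η, ∀ T : H →L[ℂ] K, pr T ξ η = ∑ i ∈ s, c i * pr T (p i).1 (p i).2 := by
  classical
  induction s using Finset.induction_on with
  | empty => exact ⟨0, 0, fun T => by simp [pr]⟩
  | insert a s ha ih =>
    obtain ⟨ξ, η, h⟩ := ih
    refine ⟨il (c a • (p a).1) ξ, il (p a).2 η, fun T => ?_⟩
    rw [pr_il, h, Finset.sum_insert ha, pr_smul_mid]

lemma wk_sep {M : Set (H →L[ℂ] K)} (hM : IsWkClosedSubspace M) {T : H →L[ℂ] K} (hT : T ∉ M) :
    ∃ ξ η, (∀ S ∈ M, pr S ξ η = 0) ∧ pr T ξ η ≠ 0 := by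
  classical
  obtain ⟨⟨M, rfl⟩, hc⟩ := hM
  unfold WkClosed at hc
  rw [sigmaWeak_eq', isClosed_induced_iff] at hc
  obtain ⟨C, hC, hCM⟩ := hc
  have hT' : (fun p : HH H × HH K => pr T p.1 p.2) ∈ Cᶜ := by
    intro h; apply hT; rw [← hCM]; exact h
  obtain ⟨I, u, hu, hsub⟩ := isOpen_pi_iff.1 hC.isOpen_compl _ hT'
  let L : (H →L[ℂ] K) →ₗ[ℂ] (I → ℂ) := LinearMap.pi fun p => prL p.1.1 p.1.2
  have hL : L T ∉ M.map L := by
    rintro ⟨S, hS, hST⟩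
    have : (fun p : HH H × HH K => pr S p.1 p.2) ∈ Cᶜ := by
      apply hsub
      intro a ha
      have := congrFun hST ⟨a, ha⟩
      simp only [L, LinearMap.pi_apply, prL_apply] at this
      simp only [this]
      exact (hu a ha).2
    apply this
    have : S ∈ (fun (T : H →L[ℂ] K) (p : HH H × HH K) => pr T p.1 p.2) ⁻¹' C := by
      rw [hCM]; exact hS
    exact this
  obtain ⟨f, hf1, hf2⟩ := Submodule.exists_le_ker_of_notMem hL
  obtain ⟨ξ, η, h⟩ := fin_comb (H := H) (K := K) Finset.univ (fun i : I => f (Pi.single i 1)) (fun i => i.1)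
  have key : ∀ S, pr S ξ η = f (L S) := by
    intro S
    rw [h, LinearMap.pi_apply_eq_sum_univ f (L S)]
    refine Finset.sum_congr rfl fun i _ => ?_
    have e : (fun j => if i = j then (1:ℂ) else 0) = Pi.single i 1 := by
      ext j; by_cases hj : i = j
      · subst hj; simp
      · simp [hj, Pi.single_eq_of_ne (Ne.symm hj)]
    simp [L, e, mul_comm]
  refine ⟨ξ, η, fun S hS => ?_, ?_⟩
  · rw [key]; exact hf2 ⟨S, hS, rfl⟩
  · rw [key]; exact hf1
end HS


lemma eLp_sq {X E : Type*} [MeasurableSpace X] [NormedAddCommGroup E] (μ : Measure X) (f : X → E) :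
    eLpNorm f 2 μ ^ 2 = ∫⁻ x, ‖f x‖ₑ ^ 2 ∂μ := by
  have := eLpNorm_nnreal_pow_eq_lintegral (μ := μ) (f := f) (p := 2) (by norm_num)
  simpa using this

section sep
variable {H : Type*} [NormedAddCommGroup H] [InnerProductSpace ℂ H]

lemma HH_tendsto (ξ : HH H) :
    Filter.Tendsto (fun N => ∑ n ∈ Finset.range N, lp.single 2 n (ξ n) : ℕ → HH H)
      Filter.atTop (nhds ξ) := by
  have := lp.hasSum_single (p := 2) (by norm_num) ξ
  exact this.tendsto_sum_nat

instance HH_sep [TopologicalSpace.SeparableSpace H] : TopologicalSpace.SeparableSpace (HH H) := by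
  let φ (N : ℕ) (v : Fin N → H) : HH H := ∑ n : Fin N, lp.single 2 (n : ℕ) (v n)
  have hφ : ∀ N, Continuous (φ N) := by
    intro N
    refine continuous_finset_sum _ fun n _ => ?_
    have : Continuous (fun x : H => (lp.single 2 (n : ℕ) x : HH H)) :=
      (lp.singleContinuousLinearMap ℂ (fun _ : ℕ => H) 2 (n : ℕ)).continuous
    exact this.comp (continuous_apply n)
  have h1 : TopologicalSpace.IsSeparable (closure (⋃ N, range (φ N))) :=
    (TopologicalSpace.IsSeparable.iUnion fun N =>
      TopologicalSpace.isSeparable_range (hφ N)).closure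
  rw [← TopologicalSpace.isSeparable_univ_iff]
  refine h1.mono fun ξ _ => ?_
  refine mem_closure_of_tendsto (HH_tendsto ξ) (Filter.Eventually.of_forall fun N => ?_)
  refine mem_iUnion.2 ⟨N, fun i => ξ i, ?_⟩
  simp only [φ]
  rw [Finset.sum_range]

instance HH_sc [SecondCountableTopology H] : SecondCountableTopology (HH H) :=
  UniformSpace.secondCountable_of_separable _

lemma HH_smeas {X : Type*} [MeasurableSpace X] (F : X → HH H)
    (hF : ∀ n, StronglyMeasurable fun x => F x n) : StronglyMeasurable F := by
  refine stronglyMeasurable_of_tendsto (f := fun N x => ∑ n ∈ Finset.range N, lp.single 2 n (F x n))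
    Filter.atTop (fun N => ?_) (tendsto_pi_nhds.2 fun x => HH_tendsto (F x))
  refine Finset.stronglyMeasurable_fun_sum _ fun n _ => ?_
  have : Continuous (fun x : H => (lp.single 2 (n : ℕ) x : HH H)) :=
      (lp.singleContinuousLinearMap ℂ (fun _ : ℕ => H) 2 (n : ℕ)).continuous
  exact this.comp_stronglyMeasurable (hF n)

lemma HH_enorm_sq (ξ : HH H) : ‖ξ‖ₑ ^ 2 = ∑' n, ‖ξ n‖ₑ ^ 2 := by
  have h := HH_hasSum ξ
  have : ∀ {E : Type _} [NormedAddCommGroup E] (x : E), ‖x‖ₑ ^ 2 = ENNReal.ofReal (‖x‖ ^ 2) := by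
    intro E _ x
    rw [ENNReal.ofReal_pow (norm_nonneg x), ofReal_norm_eq_enorm]
  rw [this, ← h.tsum_eq, ENNReal.ofReal_tsum_of_nonneg (fun n => by positivity) h.summable]
  refine tsum_congr fun n => ?_
  rw [ENNReal.ofReal_pow (norm_nonneg _), ofReal_norm_eq_enorm]

lemma summable_of_enorm (f : ℕ → H) (hf : ∑' n, ‖f n‖ₑ ^ 2 ≠ ⊤) : Summable fun n => ‖f n‖ ^ 2 := by
  have := ENNReal.summable_toReal hf
  refine this.congr fun n => ?_
  simp

lemma inner_il (a b c d : HH H) : ⟪il a b, il c d⟫ = ⟪a, c⟫ + ⟪b, d⟫ := by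
  have := pr_il (ContinuousLinearMap.id ℂ H) c d a b
  have e : ∀ x : HH H, amp (ContinuousLinearMap.id ℂ H) x = x := by intro x; ext n; simp
  simpa [pr, e] using this
end sep

section mae
variable {X₁ X₂ : Type*} [MeasurableSpace X₁] [MeasurableSpace X₂]

abbrev mae (μ₁ : Measure X₁) (μ₂ : Measure X₂) : Filter (X₁ × X₂) := ae μ₁ ×ˢ ae μ₂

instance (μ₁ : Measure X₁) (μ₂ : Measure X₂) : CountableInterFilter (mae μ₁ μ₂) := by
  unfold mae; rw [Filter.prod_eq_inf]; infer_instance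

lemma margNull_iff {μ₁ : Measure X₁} {μ₂ : Measure X₂} {E : Set (X₁ × X₂)} :
    MargNull μ₁ μ₂ E ↔ ∀ᶠ p in mae μ₁ μ₂, p ∉ E := by
  constructor
  · rintro ⟨M₁, M₂, -, -, h1, h2, hE⟩
    have a1 : ∀ᵐ x ∂μ₁, x ∉ M₁ := measure_eq_zero_iff_ae_notMem.1 h1
    have a2 : ∀ᵐ x ∂μ₂, x ∉ M₂ := measure_eq_zero_iff_ae_notMem.1 h2
    filter_upwards [a1.prod_inl (ae μ₂), a2.prod_inr (ae μ₁)] with p h1 h2 hp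
    have := hE hp
    simp [h1, h2] at this
  · intro h
    rw [Filter.eventually_prod_iff] at h
    obtain ⟨p1, h1, p2, h2, h⟩ := h
    rw [ae_iff] at h1 h2
    refine ⟨_, _, measurableSet_toMeasurable μ₁ _, measurableSet_toMeasurable μ₂ _,
      (measure_toMeasurable _).trans h1, (measure_toMeasurable _).trans h2, fun p hp => ?_⟩
    by_contra hc
    simp only [mem_union, mem_prod, mem_univ, and_true, true_and, not_or] at hc
    have b1 : p1 p.1 := by
      by_contra hh; exact hc.1 (subset_toMeasurable _ _ hh)
    have b2 : p2 p.2 := by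
      by_contra hh; exact hc.2 (subset_toMeasurable _ _ hh)
    exact h b1 b2 hp

lemma mae_intro {μ₁ : Measure X₁} {μ₂ : Measure X₂} {P : X₁ → Prop} {Q : X₂ → Prop}
    (hP : ∀ᵐ x ∂μ₁, P x) (hQ : ∀ᵐ x ∂μ₂, Q x) :
    ∀ᶠ p in mae μ₁ μ₂, P p.1 ∧ Q p.2 := by
  filter_upwards [hP.prod_inl (ae μ₂), hQ.prod_inr (ae μ₁)] with p h1 h2 using ⟨h1, h2⟩
end mae

section mo
variable {X : Type*} [MeasurableSpace X]

def BM (φ : X → ℂ) : Prop := StronglyMeasurable φ ∧ ∃ C, ∀ x, ‖φ x‖ ≤ C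

variable {μ : Measure X}

lemma BM.memLp {φ : X → ℂ} (h : BM φ) (f : Lp ℂ 2 μ) : MemLp (fun x => φ x * f x) 2 μ := by
  obtain ⟨h1, C, h2⟩ := h
  refine (Lp.memLp f).of_le_mul (c := C) (h1.aestronglyMeasurable.mul (Lp.aestronglyMeasurable f))
    (Filter.Eventually.of_forall fun x => ?_)
  rw [norm_mul]; gcongr; exact h2 x

open Classical in
def mo (μ : Measure X) (φ : X → ℂ) : Lp ℂ 2 μ →L[ℂ] Lp ℂ 2 μ :=
  if h : BM φ then
    LinearMap.mkContinuous
      { toFun := fun f => (h.memLp f).toLp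
        map_add' := fun f g => by
          rw [← MemLp.toLp_add]
          apply MemLp.toLp_congr
          filter_upwards [Lp.coeFn_add f g] with x hx
          simp only [hx, Pi.add_apply, mul_add]
        map_smul' := fun c f => by
          rw [RingHom.id_apply, ← MemLp.toLp_const_smul]
          apply MemLp.toLp_congr
          filter_upwards [Lp.coeFn_smul c f] with x hx
          simp [hx]; ring }
      h.2.choose
      (fun f => by
        refine Lp.norm_le_mul_norm_of_ae_le_mul ?_
        filter_upwards [(h.memLp f).coeFn_toLp] with x hx
        simp only [LinearMap.coe_mk, AddHom.coe_mk]
        rw [hx, norm_mul]; gcongr; exact h.2.choose_spec x)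
  else 0

lemma mo_ae {φ : X → ℂ} (h : BM φ) (f : Lp ℂ 2 μ) : mo μ φ f =ᵐ[μ] fun x => φ x * f x := by
  simp only [mo, h, dite_true]
  exact (h.memLp f).coeFn_toLp

lemma mo_isMultOp {φ : X → ℂ} (h : BM φ) : IsMultOp μ (mo μ φ) := by
  refine ⟨φ, h.1.aestronglyMeasurable, ⟨h.2.choose, Filter.Eventually.of_forall h.2.choose_spec⟩,
    fun f => mo_ae h f⟩

lemma BM.conj {φ : X → ℂ} (h : BM φ) : BM (fun x => (starRingEnd ℂ) (φ x)) := by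
  obtain ⟨h1, C, h2⟩ := h
  refine ⟨Complex.continuous_conj.comp_stronglyMeasurable h1, C, fun x => by simpa using h2 x⟩

lemma L2_inner (f g : Lp ℂ 2 μ) : ⟪f, g⟫ = ∫ x, (starRingEnd ℂ) (f x) * g x ∂μ := by
  rw [L2.inner_def]
  simp [mul_comm]

lemma mo_inner {φ : X → ℂ} (h : BM φ) (f g : Lp ℂ 2 μ) :
    ⟪f, mo μ φ g⟫ = ⟪mo μ (fun x => (starRingEnd ℂ) (φ x)) f, g⟫ := by
  rw [L2_inner, L2_inner]
  apply integral_congr_ae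
  filter_upwards [mo_ae h g, mo_ae h.conj f] with x h1 h2
  rw [h1, h2]; simp; ring

lemma BM_ind {A : Set X} (hA : MeasurableSet A) : BM (A.indicator (fun _ => (1:ℂ))) := by
  refine ⟨stronglyMeasurable_const.indicator hA, 1, fun x => ?_⟩
  by_cases hx : x ∈ A <;> simp [hx]

def pj (μ : Measure X) (A : Set X) : Lp ℂ 2 μ →L[ℂ] Lp ℂ 2 μ := mo μ (A.indicator (fun _ => (1:ℂ)))

lemma pj_ae {A : Set X} (hA : MeasurableSet A) (f : Lp ℂ 2 μ) :
    pj μ A f =ᵐ[μ] A.indicator f := by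
  filter_upwards [mo_ae (BM_ind hA) f] with x hx
  rw [pj, hx]
  by_cases h : x ∈ A <;> simp [h]

lemma pj_inner {A : Set X} (hA : MeasurableSet A) (f g : Lp ℂ 2 μ) :
    ⟪f, pj μ A g⟫ = ⟪pj μ A f, g⟫ := by
  rw [L2_inner, L2_inner]
  apply integral_congr_ae
  filter_upwards [pj_ae hA g, pj_ae hA f] with x h1 h2
  rw [h1, h2]
  by_cases h : x ∈ A <;> simp [h]

lemma pj_norm {A : Set X} (hA : MeasurableSet A) (f : Lp ℂ 2 μ) : ‖pj μ A f‖ ≤ ‖f‖ := by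
  refine Lp.norm_le_norm_of_ae_le ?_
  filter_upwards [pj_ae hA f] with x hx
  rw [hx]; by_cases h : x ∈ A <;> simp [h]

/-- supported in A -/
def SupIn (μ : Measure X) (A : Set X) (f : Lp ℂ 2 μ) : Prop := ∀ᵐ x ∂μ, x ∉ A → f x = 0

lemma pj_supIn {A : Set X} (hA : MeasurableSet A) (f : Lp ℂ 2 μ) : SupIn μ A (pj μ A f) := by
  filter_upwards [pj_ae hA f] with x hx h
  rw [hx]; simp [h]

lemma pj_eq {A : Set X} (hA : MeasurableSet A) {f : Lp ℂ 2 μ} (hf : SupIn μ A f) :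
    pj μ A f = f := by
  apply Lp.ext
  filter_upwards [pj_ae hA f, hf] with x hx h
  rw [hx]; by_cases h' : x ∈ A <;> simp [h', h]

lemma SupIn.mono {A B : Set X} {f : Lp ℂ 2 μ} (hf : SupIn μ A f) (h : A ⊆ B) : SupIn μ B f := by
  filter_upwards [hf] with x hx h'
  exact hx fun h'' => h' (h h'')

lemma SupIn.pj {A B : Set X} {f : Lp ℂ 2 μ} (hA : MeasurableSet A) (hf : SupIn μ B f) :
    SupIn μ B (pj μ A f) := by
  filter_upwards [hf, pj_ae hA f] with x hx h h'
  rw [h]; by_cases h'' : x ∈ A <;> simp [h'', hx h']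
end mo

section KL
variable {X₁ X₂ : Type*} [MeasurableSpace X₁] [MeasurableSpace X₂]

def KL (μ₁ : Measure X₁) (μ₂ : Measure X₂) (T : Lp ℂ 2 μ₁ →L[ℂ] Lp ℂ 2 μ₂)
    (α : Set X₁) (β : Set X₂) : Prop :=
  ∀ (f : Lp ℂ 2 μ₁) (g : Lp ℂ 2 μ₂), SupIn μ₁ α f → SupIn μ₂ β g → ⟪g, T f⟫ = (0 : ℂ)

variable {μ₁ : Measure X₁} {μ₂ : Measure X₂} {T : Lp ℂ 2 μ₁ →L[ℂ] Lp ℂ 2 μ₂}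
  {κ : Set (X₁ × X₂)}

lemma mem_Mmax : T ∈ Mmax μ₁ μ₂ κ ↔ ∀ (α : Set X₁) (β : Set X₂), MeasurableSet α →
    MeasurableSet β → (∀ᶠ p in mae μ₁ μ₂, p.1 ∈ α → p.2 ∈ β → p ∉ κ) → KL μ₁ μ₂ T α β := by
  have e : ∀ (α : Set X₁) (β : Set X₂), MargNull μ₁ μ₂ ((α ×ˢ β) ∩ κ) ↔
      ∀ᶠ p in mae μ₁ μ₂, p.1 ∈ α → p.2 ∈ β → p ∉ κ := by
    intro α β
    rw [margNull_iff]
    simp only [mem_inter_iff, mem_prod, not_and, and_imp]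
  constructor
  · intro h α β hα hβ hk f g hf hg
    rw [← inner_eq_zero_symm]
    exact h α β hα hβ ((e α β).2 hk) f g hf hg
  · intro h α β hα hβ hk f g hf hg
    rw [inner_eq_zero_symm]
    exact h α β hα hβ ((e α β).1 hk) f g hf hg

lemma KL_iff {α : Set X₁} {β : Set X₂} (hα : MeasurableSet α) (hβ : MeasurableSet β) :
    KL μ₁ μ₂ T α β ↔ pj μ₂ β ∘L T ∘L pj μ₁ α = 0 := by
  constructor
  · intro h
    ext1 f
    simp only [ContinuousLinearMap.comp_apply, ContinuousLinearMap.zero_apply]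
    refine ext_inner_left ℂ fun g => ?_
    rw [pj_inner hβ, inner_zero_right]
    exact h _ _ (pj_supIn hα f) (pj_supIn hβ g)
  · intro h f g hf hg
    have := congrArg (fun S => ⟪g, S f⟫) h
    simp only [ContinuousLinearMap.comp_apply, ContinuousLinearMap.zero_apply, inner_zero_right] at this
    rwa [pj_inner hβ, pj_eq hβ hg, pj_eq hα hf] at this

lemma KL.mono {α α' : Set X₁} {β β' : Set X₂} (h : KL μ₁ μ₂ T α β) (h1 : α' ⊆ α) (h2 : β' ⊆ β) :
    KL μ₁ μ₂ T α' β' := fun f g hf hg => h f g (hf.mono h1) (hg.mono h2)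

lemma Mmax_mono {κ κ' : Set (X₁ × X₂)} (h : ∀ᶠ p in mae μ₁ μ₂, p ∈ κ → p ∈ κ') :
    Mmax μ₁ μ₂ κ ⊆ Mmax μ₁ μ₂ κ' := by
  intro T hT
  rw [mem_Mmax] at hT ⊢
  intro α β hα hβ hk
  refine hT α β hα hβ ?_
  filter_upwards [h, hk] with p h1 h2 h3 h4 h5 using h2 h3 h4 (h1 h5)

/-- All operators in `U` are killed on `α × β` -/
def KU (μ₁ : Measure X₁) (μ₂ : Measure X₂) (U : Set (Lp ℂ 2 μ₁ →L[ℂ] Lp ℂ 2 μ₂))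
    (α : Set X₁) (β : Set X₂) : Prop := ∀ S ∈ U, KL μ₁ μ₂ S α β

lemma RefHull_KL {U : Set (Lp ℂ 2 μ₁ →L[ℂ] Lp ℂ 2 μ₂)} {α : Set X₁} {β : Set X₂}
    (hU : KU μ₁ μ₂ U α β) (hT : T ∈ RefHull U) : KL μ₁ μ₂ T α β := by
  intro f g hf hg
  have hc : IsClosed {v : Lp ℂ 2 μ₂ | ⟪g, v⟫ = 0} :=
    isClosed_eq (by fun_prop) continuous_const
  refine hc.closure_subset_iff.2 ?_ (hT f)
  rintro _ ⟨S, hS, rfl⟩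
  exact hU S hS f g hf hg

lemma sub_RefHull {U : Set (Lp ℂ 2 μ₁ →L[ℂ] Lp ℂ 2 μ₂)} : U ⊆ RefHull U :=
  fun T hT x => subset_closure ⟨T, hT, rfl⟩

lemma RefHull_Mmax : RefHull (Mmax μ₁ μ₂ κ) = Mmax μ₁ μ₂ κ := by
  refine Subset.antisymm (fun T hT => ?_) sub_RefHull
  rw [mem_Mmax]
  intro α β hα hβ hk
  exact RefHull_KL (fun S hS => mem_Mmax.1 hS α β hα hβ hk) hT

end KL


section row
variable {X : Type*} [MeasurableSpace X] {μ : Measure X}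

lemma Lp_enorm_sq (f : Lp ℂ 2 μ) : ∫⁻ x, ‖f x‖ₑ ^ 2 ∂μ = ‖f‖ₑ ^ 2 := by
  rw [← eLp_sq, Lp.enorm_def]

open Classical in
def row (ξ : HH (Lp ℂ 2 μ)) (x : X) : HH ℂ :=
  if h : Summable fun n => ‖ξ n x‖ ^ 2 then mkH (fun n => ξ n x) h else 0

lemma row_meas_aux (ξ : HH (Lp ℂ 2 μ)) : Measurable fun x => ∑' n, ‖ξ n x‖ₑ ^ 2 :=
  Measurable.tsum fun n => (Lp.stronglyMeasurable (ξ n)).enorm.pow_const 2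

lemma HH_lint (ξ : HH (Lp ℂ 2 μ)) : ∫⁻ x, ∑' n, ‖ξ n x‖ₑ ^ 2 ∂μ = ‖ξ‖ₑ ^ 2 := by
  rw [lintegral_tsum, HH_enorm_sq]
  · exact tsum_congr fun n => Lp_enorm_sq (ξ n)
  · exact fun n => ((Lp.stronglyMeasurable (ξ n)).enorm.pow_const 2).aemeasurable

lemma summable_iff_enorm {H : Type*} [NormedAddCommGroup H] [InnerProductSpace ℂ H] (f : ℕ → H) :
    (Summable fun n => ‖f n‖ ^ 2) ↔ ∑' n, ‖f n‖ₑ ^ 2 ≠ ⊤ := by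
  refine ⟨fun h => ?_, summable_of_enorm f⟩
  have := HH_enorm_sq (mkH f h)
  simp only [mkH_apply] at this
  rw [← this]
  exact ENNReal.pow_ne_top enorm_ne_top

lemma row_summable (ξ : HH (Lp ℂ 2 μ)) : ∀ᵐ x ∂μ, Summable fun n => ‖ξ n x‖ ^ 2 := by
  have := ae_lt_top (row_meas_aux ξ) (by rw [HH_lint]; exact ENNReal.pow_ne_top enorm_ne_top)
  filter_upwards [this] with x hx
  exact summable_of_enorm _ hx.ne

lemma row_ae (ξ : HH (Lp ℂ 2 μ)) : ∀ᵐ x ∂μ, ∀ n, row ξ x n = ξ n x := by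
  filter_upwards [row_summable ξ] with x hx n
  simp [row, hx]

lemma row_smeas (ξ : HH (Lp ℂ 2 μ)) : StronglyMeasurable (row ξ) := by
  apply HH_smeas
  intro n
  have hs : MeasurableSet {x | Summable fun n => ‖ξ n x‖ ^ 2} := by
    simp_rw [summable_iff_enorm]
    exact (row_meas_aux ξ) (measurableSet_singleton _).compl
  have : (fun x => row ξ x n) = {x | Summable fun n => ‖ξ n x‖ ^ 2}.indicator (ξ n) := by
    ext x
    by_cases h : Summable fun n => ‖ξ n x‖ ^ 2
    · simp [row, indicator, h]
    · simp [row, indicator, h]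
  rw [this]
  exact (Lp.stronglyMeasurable (ξ n)).indicator hs

lemma row_lint (ξ : HH (Lp ℂ 2 μ)) : ∫⁻ x, ‖row ξ x‖ₑ ^ 2 ∂μ = ‖ξ‖ₑ ^ 2 := by
  rw [← HH_lint]
  apply lintegral_congr_ae
  filter_upwards [row_ae ξ] with x hx
  rw [HH_enorm_sq]; simp_rw [hx]

lemma row_add (ξ ξ' : HH (Lp ℂ 2 μ)) : ∀ᵐ x ∂μ, row (ξ + ξ') x = row ξ x + row ξ' x := by
  have := ae_all_iff.2 fun n => Lp.coeFn_add (ξ n) (ξ' n)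
  filter_upwards [row_ae ξ, row_ae ξ', row_ae (ξ + ξ'), this] with x h1 h2 h3 h4
  ext n
  rw [h3, lp.coeFn_add, lp.coeFn_add, Pi.add_apply, Pi.add_apply, h4, h1, h2, Pi.add_apply]

lemma row_smul (c : ℂ) (ξ : HH (Lp ℂ 2 μ)) : ∀ᵐ x ∂μ, row (c • ξ) x = c • row ξ x := by
  have := ae_all_iff.2 fun n => Lp.coeFn_smul c (ξ n)
  filter_upwards [row_ae ξ, row_ae (c • ξ), this] with x h1 h3 h4
  ext n
  rw [h3, lp.coeFn_smul, lp.coeFn_smul, Pi.smul_apply, Pi.smul_apply, h4, h1, Pi.smul_apply]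

lemma row_mo {φ : X → ℂ} (h : BM φ) (ξ : HH (Lp ℂ 2 μ)) :
    ∀ᵐ x ∂μ, row (amp (mo μ φ) ξ) x = φ x • row ξ x := by
  have := ae_all_iff.2 fun n => mo_ae h (ξ n)
  filter_upwards [row_ae ξ, row_ae (amp (mo μ φ) ξ), this] with x h1 h3 h4
  ext n
  rw [h3, amp_apply, lp.coeFn_smul, Pi.smul_apply, h4, h1, smul_eq_mul]

lemma row_il (ξ ξ' : HH (Lp ℂ 2 μ)) : ∀ᵐ x ∂μ, row (il ξ ξ') x = il (row ξ x) (row ξ' x) := by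
  filter_upwards [row_ae ξ, row_ae ξ', row_ae (il ξ ξ')] with x h1 h2 h3
  ext n
  rw [h3]
  obtain ⟨k, rfl | rfl⟩ := n.even_or_odd'
  · rw [il_even, il_even, h1]
  · rw [il_odd, il_odd, h2]

lemma row_sg (f : Lp ℂ 2 μ) : ∀ᵐ x ∂μ, row (sg f) x = sg (f x) := by
  filter_upwards [row_ae (sg f), Lp.coeFn_zero ℂ 2 μ] with x h1 h2
  ext n
  rw [h1]
  by_cases hn : n = 0
  · subst hn; simp
  · rw [sg_succ_apply _ hn, sg_succ_apply _ hn, h2]; rfl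
end row

section ker
variable {X₁ X₂ : Type*} [MeasurableSpace X₁] [MeasurableSpace X₂]
  {μ₁ : Measure X₁} {μ₂ : Measure X₂}

def ker (ξ : HH (Lp ℂ 2 μ₁)) (η : HH (Lp ℂ 2 μ₂)) (p : X₁ × X₂) : ℂ := ⟪row η p.2, row ξ p.1⟫

def Van (ξ : HH (Lp ℂ 2 μ₁)) (η : HH (Lp ℂ 2 μ₂)) (κ : Set (X₁ × X₂)) : Prop :=
  ∀ᶠ p in mae μ₁ μ₂, p ∈ κ → ker ξ η p = 0

lemma ker_il (ξ ξ' : HH (Lp ℂ 2 μ₁)) (η η' : HH (Lp ℂ 2 μ₂)) :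
    ∀ᶠ p in mae μ₁ μ₂, ker (il ξ ξ') (il η η') p = ker ξ η p + ker ξ' η' p := by
  filter_upwards [mae_intro (row_il ξ ξ') (row_il η η')] with p hp
  rw [ker, hp.1, hp.2, inner_il]; rfl

lemma ker_smul (c : ℂ) (ξ : HH (Lp ℂ 2 μ₁)) (η : HH (Lp ℂ 2 μ₂)) :
    ∀ᶠ p in mae μ₁ μ₂, ker (c • ξ) η p = c * ker ξ η p := by
  filter_upwards [(row_smul c ξ).prod_inl (ae μ₂)] with p hp
  rw [ker, hp, inner_smul_right]; rfl

lemma ker_sg (f : Lp ℂ 2 μ₁) (g : Lp ℂ 2 μ₂) :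
    ∀ᶠ p in mae μ₁ μ₂, ker (sg f) (sg g) p = f p.1 * (starRingEnd ℂ) (g p.2) := by
  filter_upwards [mae_intro (row_sg f) (row_sg g)] with p hp
  have := pr_sg (ContinuousLinearMap.id ℂ ℂ) (f p.1) (g p.2)
  have e : ∀ x : HH ℂ, amp (ContinuousLinearMap.id ℂ ℂ) x = x := by intro x; ext n; simp
  rw [ker, hp.1, hp.2]
  simpa [pr, e] using this

lemma ker_mo {φ : X₁ → ℂ} (hφ : BM φ) {ψ : X₂ → ℂ} (hψ : BM ψ)
    (ξ : HH (Lp ℂ 2 μ₁)) (η : HH (Lp ℂ 2 μ₂)) :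
    ∀ᶠ p in mae μ₁ μ₂, ker (amp (mo μ₁ φ) ξ) (amp (mo μ₂ ψ) η) p
      = φ p.1 * (starRingEnd ℂ) (ψ p.2) * ker ξ η p := by
  filter_upwards [mae_intro (row_mo hφ ξ) (row_mo hψ η)] with p hp
  rw [ker, hp.1, hp.2, inner_smul_right, inner_smul_left, ker]; ring

lemma ker_pj {A : Set X₁} {B : Set X₂} (hA : MeasurableSet A) (hB : MeasurableSet B)
    (ξ : HH (Lp ℂ 2 μ₁)) (η : HH (Lp ℂ 2 μ₂)) :
    ∀ᶠ p in mae μ₁ μ₂, ker (amp (pj μ₁ A) ξ) (amp (pj μ₂ B) η) p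
      = (A ×ˢ B).indicator (ker ξ η) p := by
  filter_upwards [ker_mo (BM_ind hA) (BM_ind hB) ξ η] with p hp
  rw [pj, pj, hp]
  by_cases h1 : p.1 ∈ A <;> by_cases h2 : p.2 ∈ B <;> simp [indicator, h1, h2]

lemma pr_mo {φ : X₁ → ℂ} {ψ : X₂ → ℂ} (hψ : BM ψ) (T : Lp ℂ 2 μ₁ →L[ℂ] Lp ℂ 2 μ₂)
    (ξ : HH (Lp ℂ 2 μ₁)) (η : HH (Lp ℂ 2 μ₂)) :
    pr (mo μ₂ ψ ∘L T ∘L mo μ₁ φ) ξ η =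
      pr T (amp (mo μ₁ φ) ξ) (amp (mo μ₂ (fun x => (starRingEnd ℂ) (ψ x))) η) :=
  pr_comp T _ _ _ (fun x y => mo_inner hψ x y) ξ η

lemma pr_pj {A : Set X₁} {B : Set X₂} (hB : MeasurableSet B) (T : Lp ℂ 2 μ₁ →L[ℂ] Lp ℂ 2 μ₂)
    (ξ : HH (Lp ℂ 2 μ₁)) (η : HH (Lp ℂ 2 μ₂)) :
    pr (pj μ₂ B ∘L T ∘L pj μ₁ A) ξ η = pr T (amp (pj μ₁ A) ξ) (amp (pj μ₂ B) η) :=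
  pr_comp T _ _ _ (fun x y => pj_inner hB x y) ξ η

lemma isMultOp_mo {X : Type*} [MeasurableSpace X] {μ : Measure X}
    {A : Lp ℂ 2 μ →L[ℂ] Lp ℂ 2 μ} (h : IsMultOp μ A) : ∃ φ, BM φ ∧ A = mo μ φ := by
  obtain ⟨φ, h1, ⟨C, h2⟩, h3⟩ := h
  let ψ := {x | ‖h1.mk φ x‖ ≤ C}.indicator (h1.mk φ)
  have hm : MeasurableSet {x | ‖h1.mk φ x‖ ≤ C} :=
    (h1.stronglyMeasurable_mk.norm.measurable) measurableSet_Iic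
  have hψ : BM ψ := by
    refine ⟨h1.stronglyMeasurable_mk.indicator hm, max C 0, fun x => ?_⟩
    by_cases hx : ‖h1.mk φ x‖ ≤ C
    · rw [show ψ x = h1.mk φ x from by simp [ψ, hx]]; exact hx.trans (le_max_left _ _)
    · rw [show ψ x = 0 from by simp [ψ, indicator, hx]]; simp
  refine ⟨ψ, hψ, ?_⟩
  ext1 f
  apply Lp.ext
  filter_upwards [h3 f, mo_ae hψ f, h1.ae_eq_mk, h2] with x a b c d
  rw [a, b, show ψ x = h1.mk φ x from indicator_of_mem (by simpa [← c] using d) _, c]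

lemma pj_mo_comm {X : Type*} [MeasurableSpace X] {μ : Measure X} {φ : X → ℂ} (h : BM φ)
    {A : Set X} (hA : MeasurableSet A) : pj μ A ∘L mo μ φ = mo μ φ ∘L pj μ A := by
  ext1 f
  apply Lp.ext
  simp only [ContinuousLinearMap.comp_apply]
  filter_upwards [pj_ae hA (mo μ φ f), mo_ae h f, mo_ae h (pj μ A f), pj_ae hA f] with x a b c d
  rw [a, c, d]
  by_cases hx : x ∈ A <;> simp [hx, b]

lemma KL.bimod {T : Lp ℂ 2 μ₁ →L[ℂ] Lp ℂ 2 μ₂} {α : Set X₁} {β : Set X₂}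
    (hα : MeasurableSet α) (hβ : MeasurableSet β) (h : KL μ₁ μ₂ T α β)
    {A : Lp ℂ 2 μ₁ →L[ℂ] Lp ℂ 2 μ₁} {B : Lp ℂ 2 μ₂ →L[ℂ] Lp ℂ 2 μ₂}
    (hA : IsMultOp μ₁ A) (hB : IsMultOp μ₂ B) : KL μ₁ μ₂ (B ∘L T ∘L A) α β := by
  obtain ⟨φ, hφ, rfl⟩ := isMultOp_mo hA
  obtain ⟨ψ, hψ, rfl⟩ := isMultOp_mo hB
  rw [KL_iff hα hβ] at h ⊢
  have : pj μ₂ β ∘L (mo μ₂ ψ ∘L T ∘L mo μ₁ φ) ∘L pj μ₁ α =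
      mo μ₂ ψ ∘L (pj μ₂ β ∘L T ∘L pj μ₁ α) ∘L mo μ₁ φ := by
    ext1 f
    have e1 := fun v => DFunLike.congr_fun (pj_mo_comm (μ := μ₂) hψ hβ) v
    have e2 := fun v => DFunLike.congr_fun (pj_mo_comm (μ := μ₁) hφ hα) v
    simp only [ContinuousLinearMap.comp_apply] at e1 e2 ⊢
    rw [e1, ← e2]
  rw [this, h]; simp

lemma Mmax_bimod (κ : Set (X₁ × X₂)) : IsMultBimodule μ₁ μ₂ (Mmax μ₁ μ₂ κ) := by
  constructor
  · have := wk_annih (H := Lp ℂ 2 μ₁) (K := Lp ℂ 2 μ₂) {p | ∃ α β f g, MeasurableSet α ∧ MeasurableSet β ∧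
      (∀ᶠ p in mae μ₁ μ₂, p.1 ∈ α → p.2 ∈ β → p ∉ κ) ∧ SupIn μ₁ α f ∧ SupIn μ₂ β g ∧ p = (sg f, sg g)}
    convert this using 1
    ext T
    rw [mem_Mmax]
    constructor
    · rintro h _ ⟨α, β, f, g, hα, hβ, hk, hf, hg, rfl⟩
      rw [pr_sg]; exact h α β hα hβ hk f g hf hg
    · intro h α β hα hβ hk f g hf hg
      rw [← pr_sg]; exact h _ ⟨α, β, f, g, hα, hβ, hk, hf, hg, rfl⟩
  · intro T hT A B hA hB
    rw [mem_Mmax] at hT ⊢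
    exact fun α β hα hβ hk => (hT α β hα hβ hk).bimod hα hβ hA hB

/-- annihilator of vanishing representations -/
def An (μ₁ : Measure X₁) (μ₂ : Measure X₂) (κ : Set (X₁ × X₂)) : Set (Lp ℂ 2 μ₁ →L[ℂ] Lp ℂ 2 μ₂) :=
  {T | ∀ ξ η, Van ξ η κ → pr T ξ η = 0}

lemma An_bimod (κ : Set (X₁ × X₂)) : IsMultBimodule μ₁ μ₂ (An μ₁ μ₂ κ) := by
  constructor
  · have := wk_annih (H := Lp ℂ 2 μ₁) (K := Lp ℂ 2 μ₂) {p | Van p.1 p.2 κ}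
    convert this using 1
    ext T
    exact ⟨fun h p hp => h _ _ hp, fun h ξ η hp => h (ξ, η) hp⟩
  · intro T hT A B hA hB
    obtain ⟨φ, hφ, rfl⟩ := isMultOp_mo hA
    obtain ⟨ψ, hψ, rfl⟩ := isMultOp_mo hB
    intro ξ η hv
    rw [pr_mo hψ]
    apply hT
    filter_upwards [hv, ker_mo hφ hψ.conj ξ η] with p h1 h2 h3
    rw [h2, h1 h3, mul_zero]

lemma An_sub_Mmax (κ : Set (X₁ × X₂)) : An μ₁ μ₂ κ ⊆ Mmax μ₁ μ₂ κ := by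
  intro T hT
  rw [mem_Mmax]
  intro α β hα hβ hk f g hf hg
  rw [← pr_sg]
  apply hT
  filter_upwards [ker_sg f g, hk, mae_intro hf hg] with p h1 h2 h3 h4
  rw [h1]
  by_cases a : p.1 ∈ α
  · by_cases b : p.2 ∈ β
    · exact absurd h4 (h2 a b)
    · simp [h3.2 b]
  · simp [h3.1 a]

lemma ortho_lem {X : Type*} [MeasurableSpace X] {μ : Measure X} (y x : Lp ℂ 2 μ)
    (h : ∀ A, MeasurableSet A → ⟪y, pj μ A x⟫ = 0) (f : Lp ℂ 2 μ)
    (hf : SupIn μ {t | x t ≠ 0} f) : ⟪y, f⟫ = 0 := by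
  have hi : Integrable (fun t => (starRingEnd ℂ) (y t) * x t) μ := by
    have := L2.integrable_inner (𝕜 := ℂ) y x
    simpa [mul_comm] using this
  have h0 : (fun t => (starRingEnd ℂ) (y t) * x t) =ᵐ[μ] 0 := by
    apply hi.ae_eq_zero_of_forall_setIntegral_eq_zero
    intro A hA _
    rw [← integral_indicator hA]
    have := h A hA
    rw [L2_inner] at this
    rw [← this]
    apply integral_congr_ae
    filter_upwards [pj_ae hA x] with t ht
    rw [ht]; by_cases hh : t ∈ A <;> simp [hh]
  rw [L2_inner]
  rw [integral_eq_zero_of_ae]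
  filter_upwards [h0, hf] with t h1 h2
  by_cases hx : x t = 0
  · simp [h2 (by simpa using hx)]
  · have : (starRingEnd ℂ) (y t) = 0 := by
      rcases mul_eq_zero.1 h1 with h | h
      · exact h
      · exact absurd h hx
    simp [this]

lemma pj_isMultOp {X : Type*} [MeasurableSpace X] {μ : Measure X} {A : Set X}
    (hA : MeasurableSet A) : IsMultOp μ (pj μ A) := mo_isMultOp (BM_ind hA)

lemma meas_ne {X : Type*} [MeasurableSpace X] {μ : Measure X} (f : Lp ℂ 2 μ) :
    MeasurableSet {t | f t ≠ 0} :=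
  (Lp.stronglyMeasurable f).measurable (measurableSet_singleton (0:ℂ)).compl

lemma lemD {U : Set (Lp ℂ 2 μ₁ →L[ℂ] Lp ℂ 2 μ₂)} (hU : IsMultBimodule μ₁ μ₂ U)
    {T : Lp ℂ 2 μ₁ →L[ℂ] Lp ℂ 2 μ₂}
    (hT : ∀ α β, MeasurableSet α → MeasurableSet β → KU μ₁ μ₂ U α β → KL μ₁ μ₂ T α β) :
    T ∈ RefHull U := by
  intro x
  obtain ⟨⟨M, hM⟩, -⟩ := hU.1
  let ev : (Lp ℂ 2 μ₁ →L[ℂ] Lp ℂ 2 μ₂) →ₗ[ℂ] Lp ℂ 2 μ₂ :=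
    { toFun := fun S => S x, map_add' := fun _ _ => rfl, map_smul' := fun _ _ => rfl }
  have e : (fun S : Lp ℂ 2 μ₁ →L[ℂ] Lp ℂ 2 μ₂ => S x) '' U = ((M.map ev : Submodule ℂ _) : Set _) := by
    rw [← hM]; rfl
  rw [e, ← Submodule.topologicalClosure_coe, ← Submodule.orthogonal_orthogonal_eq_closure]
  show T x ∈ (M.map ev)ᗮᗮ
  rw [Submodule.mem_orthogonal]
  intro g hg
  rw [Submodule.mem_orthogonal'] at hg
  refine hT {t | x t ≠ 0} {t | g t ≠ 0} (meas_ne x) (meas_ne g) ?_ x g ?_ ?_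
  · intro S hS f g' hf hg'
    rw [inner_eq_zero_symm]
    refine ortho_lem _ g (fun B hB => ?_) g' hg'
    rw [inner_eq_zero_symm, ← ContinuousLinearMap.adjoint_inner_left]
    refine ortho_lem _ x (fun A hA => ?_) f hf
    rw [ContinuousLinearMap.adjoint_inner_left, ← pj_inner hB]
    apply hg
    refine ⟨pj μ₂ B ∘L S ∘L pj μ₁ A, ?_, rfl⟩
    rw [hM]
    exact hU.2 S hS _ _ (pj_isMultOp hA) (pj_isMultOp hB)
  · filter_upwards with t ht; simpa using ht
  · filter_upwards with t ht; simpa using ht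
end ker


lemma seminorm_dual {E : Type*} [AddCommGroup E] [Module ℂ E] (p : Seminorm ℂ E) (x : E)
    (hx : p x ≠ 0) : ∃ g : Module.Dual ℂ E, g x = (p x : ℂ) ∧ ∀ y, ‖g y‖ ≤ p y := by
  have hx0 : x ≠ 0 := by rintro rfl; simp at hx
  let e := LinearEquiv.toSpanNonzeroSingleton ℂ E x hx0
  let f : Module.Dual ℂ (Submodule.span ℂ {x}) := (p x : ℂ) • (e.symm : _ →ₗ[ℂ] ℂ)
  obtain ⟨g, h1, h2⟩ := Module.Dual.exists_extension_of_le_seminorm (Submodule.span ℂ {x}) f (p := p) (by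
    intro y
    obtain ⟨c, rfl⟩ := e.surjective y
    simp only [f, LinearMap.smul_apply, LinearEquiv.coe_coe, LinearEquiv.symm_apply_apply]
    simp only [e, LinearEquiv.toSpanNonzeroSingleton_apply, map_smul_eq_mul, smul_eq_mul, norm_mul]
    rw [Complex.norm_real, Real.norm_of_nonneg (apply_nonneg p x), mul_comm])
  refine ⟨g, ?_, h2⟩
  have := h1 (e 1)
  simp only [f, LinearMap.smul_apply, LinearEquiv.coe_coe, LinearEquiv.symm_apply_apply] at this
  simpa [e] using this

section
variable {X₁ X₂ : Type*} [MeasurableSpace X₁] [MeasurableSpace X₂]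
  {μ₁ : Measure X₁} {μ₂ : Measure X₂}

lemma ker_smul_r (c : ℂ) (ξ : HH (Lp ℂ 2 μ₁)) (η : HH (Lp ℂ 2 μ₂)) :
    ∀ᶠ p in mae μ₁ μ₂, ker ξ (c • η) p = (starRingEnd ℂ) c * ker ξ η p := by
  filter_upwards [(row_smul c η).prod_inr (ae μ₁)] with p hp
  rw [ker, hp, inner_smul_left]; rfl

lemma ker_add_l (ξ ξ' : HH (Lp ℂ 2 μ₁)) (η : HH (Lp ℂ 2 μ₂)) :
    ∀ᶠ p in mae μ₁ μ₂, ker (ξ + ξ') η p = ker ξ η p + ker ξ' η p := by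
  filter_upwards [(row_add ξ ξ').prod_inl (ae μ₂)] with p hp
  rw [ker, hp, inner_add_right]; rfl

lemma ker_add_r (ξ : HH (Lp ℂ 2 μ₁)) (η η' : HH (Lp ℂ 2 μ₂)) :
    ∀ᶠ p in mae μ₁ μ₂, ker ξ (η + η') p = ker ξ η p + ker ξ η' p := by
  filter_upwards [(row_add η η').prod_inr (ae μ₁)] with p hp
  rw [ker, hp, inner_add_left]; rfl

lemma ker_zero_l (η : HH (Lp ℂ 2 μ₂)) :
    ∀ᶠ p in mae μ₁ μ₂, ker (0 : HH (Lp ℂ 2 μ₁)) η p = 0 := by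
  filter_upwards [ker_smul (0 : ℂ) (0 : HH (Lp ℂ 2 μ₁)) η] with p hp
  simpa using hp

lemma balance (ξ : HH (Lp ℂ 2 μ₁)) (η : HH (Lp ℂ 2 μ₂)) : ∃ (ξ' : HH (Lp ℂ 2 μ₁)) (η' : HH (Lp ℂ 2 μ₂)), ‖ξ'‖ ^ 2 ≤ ‖ξ‖ * ‖η‖ ∧
    ‖η'‖ ^ 2 ≤ ‖ξ‖ * ‖η‖ ∧ ∀ᶠ p in mae μ₁ μ₂, ker ξ' η' p = ker ξ η p := by
  by_cases h1 : ξ = 0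
  · subst h1
    refine ⟨0, 0, by simp, by simp, ?_⟩
    filter_upwards [ker_zero_l (μ₁ := μ₁) η, ker_zero_l (μ₁ := μ₁) (0 : HH (Lp ℂ 2 μ₂))] with p a b
    rw [a, b]
  by_cases h2 : η = 0
  · subst h2
    refine ⟨0, 0, by simp, by simp, ?_⟩
    filter_upwards [ker_smul_r (0:ℂ) ξ (0 : HH (Lp ℂ 2 μ₂)), ker_zero_l (μ₁ := μ₁) (0 : HH (Lp ℂ 2 μ₂))] with p a b
    rw [b]; simpa using a.symm
  have p1 : 0 < ‖ξ‖ := norm_pos_iff.2 h1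
  have p2 : 0 < ‖η‖ := norm_pos_iff.2 h2
  let t := Real.sqrt (‖η‖ / ‖ξ‖)
  have ht : 0 < t := Real.sqrt_pos.2 (by positivity)
  have ht2 : t ^ 2 = ‖η‖ / ‖ξ‖ := Real.sq_sqrt (by positivity)
  refine ⟨(t : ℂ) • ξ, ((t⁻¹ : ℝ) : ℂ) • η, ?_, ?_, ?_⟩
  · rw [norm_smul, Complex.norm_real, Real.norm_of_nonneg ht.le, mul_pow, ht2]
    apply le_of_eq; field_simp
  · rw [norm_smul, Complex.norm_real, Real.norm_of_nonneg (inv_pos.2 ht).le, mul_pow, inv_pow, ht2]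
    apply le_of_eq; field_simp
  · filter_upwards [ker_smul (t:ℂ) ξ (((t⁻¹ : ℝ) : ℂ) • η), ker_smul_r ((t⁻¹ : ℝ) : ℂ) ξ η] with p a b
    rw [a, b, Complex.conj_ofReal, ← mul_assoc, ← Complex.ofReal_mul, mul_inv_cancel₀ ht.ne']; simp

variable (μ₁ μ₂) in
def KRep (κ : Set (X₁ × X₂)) (k : X₁ × X₂ → ℂ) (C : ℝ) : Prop :=
  ∃ (ξ : HH (Lp ℂ 2 μ₁)) (η : HH (Lp ℂ 2 μ₂)), ‖ξ‖ * ‖η‖ ≤ C ∧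
    ∀ᶠ p in mae μ₁ μ₂, p ∈ κ → k p = ker ξ η p

lemma KRep.bal {κ : Set (X₁ × X₂)} {k : X₁ × X₂ → ℂ} {C : ℝ} (h : KRep μ₁ μ₂ κ k C) :
    ∃ (ξ : HH (Lp ℂ 2 μ₁)) (η : HH (Lp ℂ 2 μ₂)), ‖ξ‖ ^ 2 ≤ C ∧ ‖η‖ ^ 2 ≤ C ∧
    ∀ᶠ p in mae μ₁ μ₂, p ∈ κ → k p = ker ξ η p := by
  obtain ⟨ξ, η, h1, h2⟩ := h
  obtain ⟨ξ', η', a, b, c⟩ := balance ξ η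
  refine ⟨ξ', η', a.trans h1, b.trans h1, ?_⟩
  filter_upwards [h2, c] with p x y z
  rw [x z, y]

lemma KRep.add {κ : Set (X₁ × X₂)} {k k' : X₁ × X₂ → ℂ} {C C' : ℝ} (h : KRep μ₁ μ₂ κ k C)
    (h' : KRep μ₁ μ₂ κ k' C') : KRep μ₁ μ₂ κ (k + k') (C + C') := by
  obtain ⟨ξ, η, h1, h2, h3⟩ := h.bal
  obtain ⟨ξ', η', h1', h2', h3'⟩ := h'.bal
  refine ⟨il ξ ξ', il η η', ?_, ?_⟩
  · have a := il_norm_sq ξ ξ'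
    have b := il_norm_sq η η'
    nlinarith [sq_nonneg (‖il ξ ξ'‖ - ‖il η η'‖)]
  · filter_upwards [h3, h3', ker_il ξ ξ' η η'] with p a b c d
    rw [c, Pi.add_apply, a d, b d]

lemma KRep.smul {κ : Set (X₁ × X₂)} {k : X₁ × X₂ → ℂ} {C : ℝ} (c : ℂ) (h : KRep μ₁ μ₂ κ k C) :
    KRep μ₁ μ₂ κ (c • k) (‖c‖ * C) := by
  obtain ⟨ξ, η, h1, h2⟩ := h
  refine ⟨c • ξ, η, ?_, ?_⟩
  · rw [norm_smul, mul_assoc]; gcongr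
  · filter_upwards [h2, ker_smul c ξ η] with p a b d
    rw [b, Pi.smul_apply, a d, smul_eq_mul]

variable (μ₁ μ₂) in
def SS (κ : Set (X₁ × X₂)) : Submodule ℂ (X₁ × X₂ → ℂ) where
  carrier := {k | ∃ C, KRep μ₁ μ₂ κ k C}
  add_mem' := fun ⟨C, h⟩ ⟨C', h'⟩ => ⟨C + C', h.add h'⟩
  zero_mem' := ⟨0, 0, 0, by simp, by
    filter_upwards [ker_zero_l (μ₁ := μ₁) (0 : HH (Lp ℂ 2 μ₂))] with p a _
    rw [a]; rfl⟩
  smul_mem' := fun c k ⟨C, h⟩ => ⟨‖c‖ * C, h.smul c⟩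

def kerS (κ : Set (X₁ × X₂)) (ξ : HH (Lp ℂ 2 μ₁)) (η : HH (Lp ℂ 2 μ₂)) : SS μ₁ μ₂ κ :=
  ⟨ker ξ η, ‖ξ‖ * ‖η‖, ξ, η, le_rfl, Filter.Eventually.of_forall fun _ _ => rfl⟩

def pS (κ : Set (X₁ × X₂)) (k : SS μ₁ μ₂ κ) : ℝ := sInf {C | KRep μ₁ μ₂ κ k C}

lemma KRep_nonneg {κ : Set (X₁ × X₂)} {k : X₁ × X₂ → ℂ} {C : ℝ} (h : KRep μ₁ μ₂ κ k C) : 0 ≤ C := by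
  obtain ⟨ξ, η, h1, -⟩ := h
  exact le_trans (by positivity) h1

lemma pS_le {κ : Set (X₁ × X₂)} (k : SS μ₁ μ₂ κ) {C : ℝ} (h : KRep μ₁ μ₂ κ k C) : pS κ k ≤ C :=
  csInf_le ⟨0, fun _ h => KRep_nonneg h⟩ h

lemma pS_lt {κ : Set (X₁ × X₂)} (k : SS μ₁ μ₂ κ) {D : ℝ} (h : pS κ k < D) :
    ∃ C < D, KRep μ₁ μ₂ κ k C := by
  obtain ⟨C, h1, h2⟩ := exists_lt_of_csInf_lt (s := {C | KRep μ₁ μ₂ κ k C}) k.2 h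
  exact ⟨C, h2, h1⟩

lemma pS_nonneg {κ : Set (X₁ × X₂)} (k : SS μ₁ μ₂ κ) : 0 ≤ pS κ k :=
  le_csInf k.2 fun _ h => KRep_nonneg h

def pSem (κ : Set (X₁ × X₂)) : Seminorm ℂ (SS μ₁ μ₂ κ) :=
  Seminorm.ofSMulLE (pS κ)
    (le_antisymm (pS_le _ ⟨0, 0, by simp, by
      filter_upwards [ker_zero_l (μ₁ := μ₁) (0 : HH (Lp ℂ 2 μ₂))] with p a _
      rw [a]; rfl⟩) (pS_nonneg _))
    (fun x y => by
      apply le_of_forall_pos_le_add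
      intro ε hε
      obtain ⟨C, h1, h2⟩ := pS_lt x (show pS κ x < pS κ x + ε / 2 by linarith)
      obtain ⟨C', h1', h2'⟩ := pS_lt y (show pS κ y < pS κ y + ε / 2 by linarith)
      have := pS_le (x + y) (h2.add h2')
      linarith)
    (fun c x => by
      apply le_of_forall_pos_le_add
      intro ε hε
      have hc : 0 < ‖c‖ + 1 := by positivity
      obtain ⟨C, h1, h2⟩ := pS_lt x (show pS κ x < pS κ x + ε / (‖c‖ + 1) by
        have : 0 < ε / (‖c‖ + 1) := by positivity
        linarith)
      have h3 := pS_le (c • x) (h2.smul c)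
      have h4 : ‖c‖ * C ≤ ‖c‖ * (pS κ x + ε / (‖c‖ + 1)) := by gcongr
      have h5 : ‖c‖ * (ε / (‖c‖ + 1)) ≤ ε := by
        rw [mul_div_assoc', div_le_iff₀ hc]; nlinarith
      linarith [mul_add ‖c‖ (pS κ x) (ε / (‖c‖ + 1))])

lemma pSem_apply (κ : Set (X₁ × X₂)) (k : SS μ₁ μ₂ κ) : pSem κ k = pS κ k := rfl

lemma row_small {X : Type*} [MeasurableSpace X] {μ : Measure X} (ζ : ℕ → HH (Lp ℂ 2 μ))
    (hζ : ∀ m, ‖ζ m‖ ^ 2 ≤ (1/2 : ℝ) ^ m) : ∀ᵐ x ∂μ, Filter.Tendsto (fun m => ‖row (ζ m) x‖ ^ 2)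
        Filter.atTop (nhds 0) := by
  have hmeas : ∀ m, Measurable fun x => ‖row (ζ m) x‖ₑ ^ 2 :=
    fun m => (row_smeas (ζ m)).enorm.pow_const 2
  have : ∫⁻ x, ∑' m, ‖row (ζ m) x‖ₑ ^ 2 ∂μ ≠ ⊤ := by
    rw [lintegral_tsum fun m => (hmeas m).aemeasurable]
    simp_rw [row_lint]
    have e : ∀ m, ‖ζ m‖ₑ ^ 2 ≤ ENNReal.ofReal ((1/2 : ℝ) ^ m) := by
      intro m
      rw [← ofReal_norm_eq_enorm, ← ENNReal.ofReal_pow (norm_nonneg _)]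
      exact ENNReal.ofReal_le_ofReal (hζ m)
    refine ne_top_of_le_ne_top ?_ (ENNReal.tsum_le_tsum e)
    rw [← ENNReal.ofReal_tsum_of_nonneg (fun n => by positivity) summable_geometric_two]
    exact ENNReal.ofReal_ne_top
  filter_upwards [ae_lt_top (Measurable.tsum hmeas) this] with x hx
  exact (summable_of_enorm (H := HH ℂ) (fun m => row (ζ m) x) hx.ne).tendsto_atTop_zero

lemma sg_add {H : Type*} [NormedAddCommGroup H] [InnerProductSpace ℂ H] (x y : H) :
    sg (x + y) = sg x + sg y := by ext n; simp [sg, Pi.single_add]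
lemma sg_smul {H : Type*} [NormedAddCommGroup H] [InnerProductSpace ℂ H] (c : ℂ) (x : H) :
    sg (c • x) = c • sg x := by ext n; simp [sg]

lemma pS_small {κ : Set (X₁ × X₂)} (f : Lp ℂ 2 μ₁) (g : Lp ℂ 2 μ₂)
    (h : pS κ (kerS κ (sg f) (sg g)) = 0) : Van (sg f) (sg g) κ := by
  have hm : ∀ m : ℕ, ∃ (ξ : HH (Lp ℂ 2 μ₁)) (η : HH (Lp ℂ 2 μ₂)), ‖ξ‖ ^ 2 ≤ (1/2 : ℝ) ^ m ∧
      ‖η‖ ^ 2 ≤ (1/2 : ℝ) ^ m ∧ ∀ᶠ p in mae μ₁ μ₂, p ∈ κ → ker (sg f) (sg g) p = ker ξ η p := by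
    intro m
    obtain ⟨C, h1, h2⟩ := pS_lt (kerS κ (sg f) (sg g)) (D := (1/2 : ℝ) ^ m) (by rw [h]; positivity)
    obtain ⟨ξ, η, a, b, c⟩ := h2.bal
    exact ⟨ξ, η, a.trans h1.le, b.trans h1.le, c⟩
  choose ξ η h1 h2 h3 using hm
  filter_upwards [eventually_countable_forall.2 h3, mae_intro (row_small ξ h1) (row_small η h2)] with p a b hp
  have hb : ∀ m, ‖ker (sg f) (sg g) p‖ ≤ ‖row (ξ m) p.1‖ ^ 2 + ‖row (η m) p.2‖ ^ 2 := by
    intro m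
    rw [a m hp, ker]
    refine (norm_inner_le_norm _ _).trans ?_
    nlinarith [sq_nonneg (‖row (ξ m) p.1‖ - ‖row (η m) p.2‖), norm_nonneg (row (ξ m) p.1), norm_nonneg (row (η m) p.2)]
  have := ge_of_tendsto' (b.1.add b.2) hb
  simpa using this

lemma ker_single (n : ℕ) (a : Lp ℂ 2 μ₁) (η : HH (Lp ℂ 2 μ₂)) : ∀ᶠ p in mae μ₁ μ₂,
    ker (lp.single 2 n a) η p = ker (sg a) (sg (η n)) p := by
  have h0 : ∀ᵐ x ∂μ₁, row (lp.single 2 n a : HH (Lp ℂ 2 μ₁)) x = lp.single 2 n (a x) := by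
    filter_upwards [row_ae (lp.single 2 n a : HH (Lp ℂ 2 μ₁)), Lp.coeFn_zero ℂ 2 μ₁] with x h1 h2
    ext m
    rw [h1]
    by_cases hn : m = n
    · subst hn; simp
    · rw [lp.coeFn_single, lp.coeFn_single, Pi.single_eq_of_ne hn, Pi.single_eq_of_ne hn, h2]; rfl
  filter_upwards [ker_sg a (η n), mae_intro h0 (row_ae η)] with p h1 h2
  rw [h1, ker, h2.1, lp.inner_single_right, h2.2]
  simp

theorem lemC (κ : Set (X₁ × X₂)) (f : Lp ℂ 2 μ₁) (g : Lp ℂ 2 μ₂) (h : ¬ Van (sg f) (sg g) κ) :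
    ∃ T ∈ An μ₁ μ₂ κ, ⟪g, T f⟫ ≠ 0 := by
  have hp : pSem κ (kerS κ (sg f) (sg g)) ≠ 0 := fun h0 => h (pS_small f g h0)
  obtain ⟨Φ, h1, h2⟩ := seminorm_dual (pSem κ) _ hp
  have hcongr : ∀ k k' : SS μ₁ μ₂ κ, (∀ᶠ p in mae μ₁ μ₂, p ∈ κ → k.1 p = k'.1 p) → Φ k = Φ k' := by
    intro k k' hk
    rw [← sub_eq_zero, ← map_sub, ← norm_le_zero_iff]
    refine (h2 _).trans (pS_le _ ⟨0, 0, by simp, ?_⟩)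
    filter_upwards [hk, ker_zero_l (μ₁ := μ₁) (0 : HH (Lp ℂ 2 μ₂))] with p a b c
    rw [b]; simp [a c]
  let Ψ (ξ : HH (Lp ℂ 2 μ₁)) (η : HH (Lp ℂ 2 μ₂)) : ℂ := Φ (kerS κ ξ η)
  have hΨb : ∀ ξ η, ‖Ψ ξ η‖ ≤ ‖ξ‖ * ‖η‖ := fun ξ η =>
    (h2 _).trans (pS_le _ ⟨ξ, η, le_rfl, Filter.Eventually.of_forall fun _ _ => rfl⟩)
  have hadd1 : ∀ ξ ξ' η, Ψ (ξ + ξ') η = Ψ ξ η + Ψ ξ' η := by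
    intro ξ ξ' η
    simp only [Ψ]; rw [← map_add]
    apply hcongr
    filter_upwards [ker_add_l ξ ξ' η] with p a _ using a
  have hadd2 : ∀ ξ η η', Ψ ξ (η + η') = Ψ ξ η + Ψ ξ η' := by
    intro ξ η η'
    simp only [Ψ]; rw [← map_add]
    apply hcongr
    filter_upwards [ker_add_r ξ η η'] with p a _ using a
  have hsm1 : ∀ (c : ℂ) ξ η, Ψ (c • ξ) η = c * Ψ ξ η := by
    intro c ξ η
    simp only [Ψ]; rw [← smul_eq_mul, ← map_smul]
    apply hcongr
    filter_upwards [ker_smul c ξ η] with p a _ using a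
  have hsm2 : ∀ (c : ℂ) ξ η, Ψ ξ (c • η) = (starRingEnd ℂ) c * Ψ ξ η := by
    intro c ξ η
    simp only [Ψ]; rw [← smul_eq_mul, ← map_smul]
    apply hcongr
    filter_upwards [ker_smul_r c ξ η] with p a _ using a
  let B0 : Lp ℂ 2 μ₁ →ₛₗ[starRingEnd ℂ] Lp ℂ 2 μ₂ →ₗ[ℂ] ℂ :=
    LinearMap.mk₂'ₛₗ (starRingEnd ℂ) (RingHom.id ℂ) (fun f g => (starRingEnd ℂ) (Ψ (sg f) (sg g)))
      (by intro a b c; simp [sg_add, hadd1]) (by intro c a b; simp [sg_smul, hsm1])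
      (by intro a b c; simp [sg_add, hadd2]) (by intro c a b; simp [sg_smul, hsm2])
  let B : Lp ℂ 2 μ₁ →SL[starRingEnd ℂ] Lp ℂ 2 μ₂ →L[ℂ] ℂ :=
    LinearMap.mkContinuous₂ B0 1 (by
      intro a b
      simp only [B0, LinearMap.mk₂'ₛₗ_apply, RCLike.norm_conj, one_mul]
      refine (hΨb _ _).trans ?_
      rw [sg_norm, sg_norm])
  let T : Lp ℂ 2 μ₁ →L[ℂ] Lp ℂ 2 μ₂ :=
    (((InnerProductSpace.toDual ℂ (Lp ℂ 2 μ₂)).symm.toContinuousLinearEquiv :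
      _ ≃SL[starRingEnd ℂ] _) : _ →SL[starRingEnd ℂ] Lp ℂ 2 μ₂).comp B
  have hT : ∀ a b, ⟪b, T a⟫ = Ψ (sg a) (sg b) := by
    intro a b
    rw [← inner_conj_symm]
    have : ⟪T a, b⟫ = B a b := InnerProductSpace.toDual_symm_apply
    rw [this]
    simp [B, B0]
  have hTΨ : ∀ ξ η, pr T ξ η = Ψ ξ η := by
    intro ξ η
    let L : HH (Lp ℂ 2 μ₁) →L[ℂ] ℂ := LinearMap.mkContinuous
      { toFun := fun ξ => Ψ ξ η, map_add' := fun a b => hadd1 a b η,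
        map_smul' := fun c a => hsm1 c a η } ‖η‖ (fun a => by rw [mul_comm]; exact hΨb a η)
    have hs := (lp.hasSum_single (p := 2) (by norm_num) ξ).mapL L
    refine (pr_hasSum T ξ η).unique ?_
    refine hs.congr_fun fun n => ?_
    rw [hT]
    show Ψ (sg (ξ n)) (sg (η n)) = Ψ (lp.single 2 n (ξ n)) η
    apply hcongr
    filter_upwards [ker_single n (ξ n) η] with p a _ using a.symm
  refine ⟨T, fun ξ η hv => ?_, ?_⟩
  · rw [hTΨ, ← norm_le_zero_iff]
    refine (h2 _).trans (pS_le _ ⟨0, 0, by simp, ?_⟩)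
    filter_upwards [hv, ker_zero_l (μ₁ := μ₁) (0 : HH (Lp ℂ 2 μ₂))] with p a b c
    rw [b]; exact a c
  · rw [hT]; simp only [Ψ]; rw [h1]; exact_mod_cast hp
end


section
variable {X : Type*} [MeasurableSpace X] {μ : Measure X}

lemma row_norm_le (ζ : HH (Lp ℂ 2 μ)) (f : Lp ℂ 2 μ) {C : ℝ} (hC : 0 ≤ C)
    (h : ∀ᵐ x ∂μ, ‖row ζ x‖ ≤ C * ‖f x‖) : ‖ζ‖ ≤ C * ‖f‖ := by
  have h1 : ‖ζ‖ₑ ^ 2 ≤ ENNReal.ofReal (C * ‖f‖) ^ 2 := by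
    rw [ENNReal.ofReal_mul hC, mul_pow, ofReal_norm_eq_enorm, ← Lp_enorm_sq, ← row_lint,
      ← lintegral_const_mul' _ _ (by finiteness)]
    apply lintegral_mono_ae
    filter_upwards [h] with x hx
    rw [← ofReal_norm_eq_enorm, ← ofReal_norm_eq_enorm, ← mul_pow, ← ENNReal.ofReal_mul hC]
    gcongr
  have h2 : ‖ζ‖ₑ ≤ ENNReal.ofReal (C * ‖f‖) := by
    by_contra hh
    exact absurd h1 (not_le.2 (ENNReal.pow_lt_pow_left (by norm_num) (not_le.1 hh)))
  rw [← ofReal_norm_eq_enorm] at h2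
  exact (ENNReal.ofReal_le_ofReal_iff (by positivity)).1 h2

lemma cst_aux (a : HH ℂ) (f : Lp ℂ 2 μ) : Summable fun n => ‖a n • f‖ ^ 2 := by
  simp_rw [norm_smul, mul_pow]
  exact (HH_summable a).mul_right _

def cst (a : HH ℂ) (f : Lp ℂ 2 μ) : HH (Lp ℂ 2 μ) := mkH (fun n => a n • f) (cst_aux a f)

lemma cst_apply (a : HH ℂ) (f : Lp ℂ 2 μ) (n : ℕ) : cst a f n = a n • f := rfl

lemma row_cst (a : HH ℂ) (f : Lp ℂ 2 μ) : ∀ᵐ x ∂μ, row (cst a f) x = f x • a := by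
  filter_upwards [row_ae (cst a f), ae_all_iff.2 fun n => Lp.coeFn_smul (a n) f] with x h1 h2
  ext n
  rw [h1, cst_apply, h2]
  simp [mul_comm]

lemma cst_norm (a : HH ℂ) (f : Lp ℂ 2 μ) : ‖cst a f‖ ≤ ‖a‖ * ‖f‖ := by
  apply row_norm_le _ _ (norm_nonneg _)
  filter_upwards [row_cst a f] with x hx
  rw [hx, norm_smul, mul_comm]

lemma row_sub (ξ ξ' : HH (Lp ℂ 2 μ)) : ∀ᵐ x ∂μ, row (ξ - ξ') x = row ξ x - row ξ' x := by
  filter_upwards [row_add ξ ((-1 : ℂ) • ξ'), row_smul (-1) ξ'] with x h1 h2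
  rw [sub_eq_add_neg, sub_eq_add_neg, ← neg_one_smul ℂ ξ', h1, h2]; simp

lemma row_pj {A : Set X} (hA : MeasurableSet A) (ξ : HH (Lp ℂ 2 μ)) :
    ∀ᵐ x ∂μ, row (amp (pj μ A) ξ) x = A.indicator (row ξ) x := by
  filter_upwards [row_mo (BM_ind hA) ξ] with x hx
  rw [pj, hx]; by_cases h : x ∈ A <;> simp [h]

lemma cst_approx {α : Set X} (hα : MeasurableSet α) (ξ : HH (Lp ℂ 2 μ)) (a : HH ℂ) {r : ℝ} (hr : 0 ≤ r)
    (h : ∀ x ∈ α, ‖row ξ x - a‖ ≤ r) {φ : X → ℂ} (hφ : BM φ) (f : Lp ℂ 2 μ) (hf : φ =ᵐ[μ] f) :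
    ‖amp (pj μ α) (amp (mo μ φ) ξ) - cst a (pj μ α f)‖ ≤ r * ‖f‖ := by
  apply row_norm_le _ _ hr
  filter_upwards [row_sub (amp (pj μ α) (amp (mo μ φ) ξ)) (cst a (pj μ α f)),
    row_pj hα (amp (mo μ φ) ξ), row_mo hφ ξ, row_cst a (pj μ α f), pj_ae hα f, hf] with x h1 h2 h3 h4 h5 h6
  rw [h1, h2, h4, h5]
  by_cases hx : x ∈ α
  · simp only [hx, indicator_of_mem]
    rw [h3, h6, ← smul_sub, norm_smul, mul_comm]
    gcongr; exact h x hx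
  · simp [hx]; positivity

end

section
variable {X₁ X₂ : Type*} [MeasurableSpace X₁] [MeasurableSpace X₂]
  {μ₁ : Measure X₁} {μ₂ : Measure X₂}

lemma pr_cst (T : Lp ℂ 2 μ₁ →L[ℂ] Lp ℂ 2 μ₂) (a b : HH ℂ) (f : Lp ℂ 2 μ₁) (g : Lp ℂ 2 μ₂) :
    pr T (cst a f) (cst b g) = ⟪b, a⟫ * ⟪g, T f⟫ := by
  refine (pr_hasSum T _ _).unique ?_
  have := (lp.hasSum_inner (𝕜 := ℂ) b a).mul_right ⟪g, T f⟫
  refine this.congr_fun fun n => ?_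
  simp only [cst_apply, map_smul, inner_smul_left, inner_smul_right]
  simp; ring

lemma simple_bm {X : Type*} [MeasurableSpace X] {μ : Measure X} (s : Lp.simpleFunc ℂ 2 μ) :
    ∃ φ, BM φ ∧ φ =ᵐ[μ] (s : Lp ℂ 2 μ) := by
  refine ⟨Lp.simpleFunc.toSimpleFunc s, ⟨(Lp.simpleFunc.toSimpleFunc s).stronglyMeasurable, ?_⟩,
    Lp.simpleFunc.toSimpleFunc_eq_toFun s⟩
  exact (Lp.simpleFunc.toSimpleFunc s).exists_forall_norm_le

lemma kill {U : Set (Lp ℂ 2 μ₁ →L[ℂ] Lp ℂ 2 μ₂)} (hU : IsMultBimodule μ₁ μ₂ U)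
    {ξ : HH (Lp ℂ 2 μ₁)} {η : HH (Lp ℂ 2 μ₂)} (h0 : ∀ S ∈ U, pr S ξ η = 0)
    {α : Set X₁} {β : Set X₂} (hα : MeasurableSet α) (hβ : MeasurableSet β) (a b : HH ℂ) {r : ℝ}
    (hr : 0 ≤ r) (h1 : ∀ x ∈ α, ‖row ξ x - a‖ ≤ r) (h2 : ∀ x ∈ β, ‖row η x - b‖ ≤ r)
    (hc : r * (‖a‖ + ‖b‖ + r) < ‖⟪b, a⟫‖) : KU μ₁ μ₂ U α β := by
  intro S hS
  rw [KL_iff hα hβ]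
  set S' := pj μ₂ β ∘L S ∘L pj μ₁ α with hS'
  have hS'U : S' ∈ U := hU.2 S hS _ _ (pj_isMultOp hα) (pj_isMultOp hβ)
  set c := ‖⟪b, a⟫‖ with hcc
  have hcpos : 0 < c := lt_of_le_of_lt (by positivity) hc
  set ε := r * (‖a‖ + ‖b‖ + r) with hε
  have hε0 : 0 ≤ ε := by positivity
  have idem1 : ∀ f, pj μ₁ α (pj μ₁ α f) = pj μ₁ α f := fun f => pj_eq hα (pj_supIn hα f)
  have idem2 : ∀ f, pj μ₂ β (pj μ₂ β f) = pj μ₂ β f := fun f => pj_eq hβ (pj_supIn hβ f)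
  have key : ∀ (f : Lp ℂ 2 μ₁) (g : Lp ℂ 2 μ₂), c * ‖⟪g, S' f⟫‖ ≤ ε * ‖S'‖ * ‖f‖ * ‖g‖ := by
    intro f g
    refine (Lp.simpleFunc.denseRange (E := ℂ) (p := 2) (μ := μ₁) (by norm_num)).induction_on f ?_ ?_
    · exact isClosed_le (by fun_prop) (by fun_prop)
    intro s
    refine (Lp.simpleFunc.denseRange (E := ℂ) (p := 2) (μ := μ₂) (by norm_num)).induction_on g ?_ ?_
    · exact isClosed_le (by fun_prop) (by fun_prop)
    intro t
    obtain ⟨φ, hφ, hφs⟩ := simple_bm s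
    obtain ⟨ψ, hψ, hψt⟩ := simple_bm t
    generalize (s : Lp ℂ 2 μ₁) = f at *
    generalize (t : Lp ℂ 2 μ₂) = g at *
    have e1 := cst_approx hα ξ a hr h1 hφ f hφs
    have e2 := cst_approx hβ η b hr h2 hψ g hψt
    set ξ' := amp (pj μ₁ α) (amp (mo μ₁ φ) ξ)
    set η' := amp (pj μ₂ β) (amp (mo μ₂ ψ) η)
    set u := cst a (pj μ₁ α f) with hu
    set v := cst b (pj μ₂ β g) with hv
    have z : pr S' ξ' η' = 0 := by
      rw [← pr_pj hβ]
      have hψ' := hψ.conj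
      have := pr_mo (φ := φ) hψ' (pj μ₂ β ∘L S' ∘L pj μ₁ α) ξ η
      simp only [Complex.conj_conj] at this
      rw [← this]
      apply h0
      exact hU.2 _ (hU.2 _ hS'U _ _ (pj_isMultOp hα) (pj_isMultOp hβ)) _ _ (mo_isMultOp hφ) (mo_isMultOp hψ')
    have z2 : pr S' u v = ⟪b, a⟫ * ⟪g, S' f⟫ := by
      rw [hu, hv, pr_cst, hS']
      congr 1
      simp only [ContinuousLinearMap.comp_apply]
      rw [idem1, ← pj_inner hβ, idem2]
    have z3 : pr S' u v = pr S' ξ' (v - η') - pr S' (ξ' - u) v := by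
      rw [pr_sub_right, pr_sub_mid, z]; ring
    have hf0 := norm_nonneg f
    have hg0 := norm_nonneg g
    have n1 : ‖u‖ ≤ ‖a‖ * ‖f‖ := (cst_norm _ _).trans (by gcongr; exact pj_norm hα f)
    have n2 : ‖v‖ ≤ ‖b‖ * ‖g‖ := (cst_norm _ _).trans (by gcongr; exact pj_norm hβ g)
    have n3 : ‖ξ'‖ ≤ (‖a‖ + r) * ‖f‖ := by
      have : ‖ξ'‖ ≤ ‖ξ' - u‖ + ‖u‖ := by simpa using norm_add_le (ξ' - u) u
      linarith
    calc c * ‖⟪g, S' f⟫‖ = ‖pr S' u v‖ := by rw [z2, norm_mul]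
      _ ≤ ‖pr S' ξ' (v - η')‖ + ‖pr S' (ξ' - u) v‖ := by rw [z3]; exact norm_sub_le _ _
      _ ≤ ‖S'‖ * ‖ξ'‖ * ‖v - η'‖ + ‖S'‖ * ‖ξ' - u‖ * ‖v‖ := add_le_add (pr_le _ _ _) (pr_le _ _ _)
      _ ≤ ‖S'‖ * ((‖a‖ + r) * ‖f‖) * (r * ‖g‖) + ‖S'‖ * (r * ‖f‖) * (‖b‖ * ‖g‖) := by
        rw [norm_sub_rev v η']
        gcongr
      _ = ε * ‖S'‖ * ‖f‖ * ‖g‖ := by rw [hε]; ring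
  have hn : ‖S'‖ ≤ (ε / c) * ‖S'‖ := by
    apply ContinuousLinearMap.opNorm_le_bound _ (by positivity)
    intro f
    by_cases hz : ‖S' f‖ = 0
    · rw [hz]; positivity
    have h3 := key f (S' f)
    rw [inner_self_eq_norm_sq_to_K] at h3
    simp only [norm_pow, RCLike.norm_ofReal, abs_norm] at h3
    have hp : 0 < ‖S' f‖ := lt_of_le_of_ne (norm_nonneg _) (Ne.symm hz)
    have h4 : c * ‖S' f‖ ≤ ε * ‖S'‖ * ‖f‖ := by
      by_contra hh
      push Not at hh
      nlinarith
    rw [div_mul_eq_mul_div, div_mul_eq_mul_div, le_div_iff₀ hcpos]; linarith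
  by_contra hne
  have hp : 0 < ‖S'‖ := norm_pos_iff.2 hne
  have : ε / c < 1 := (div_lt_one hcpos).2 hc
  nlinarith

theorem lemA {U : Set (Lp ℂ 2 μ₁ →L[ℂ] Lp ℂ 2 μ₂)} (hU : IsMultBimodule μ₁ μ₂ U)
    {ξ : HH (Lp ℂ 2 μ₁)} {η : HH (Lp ℂ 2 μ₂)} (h0 : ∀ S ∈ U, pr S ξ η = 0) :
    ∃ (α : ℕ × ℕ × ℕ → Set X₁) (β : ℕ × ℕ × ℕ → Set X₂), (∀ i, MeasurableSet (α i)) ∧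
      (∀ i, MeasurableSet (β i)) ∧ (∀ i, KU μ₁ μ₂ U (α i) (β i)) ∧
      ∀ p, ker ξ η p ≠ 0 → ∃ i, p.1 ∈ α i ∧ p.2 ∈ β i := by
  classical
  let a := TopologicalSpace.denseSeq (HH ℂ)
  let R (k : ℕ) : ℝ := 1 / ((k : ℝ) + 1)
  let G (i : ℕ × ℕ × ℕ) : Prop := R i.2.2 * (‖a i.1‖ + ‖a i.2.1‖ + R i.2.2) < ‖⟪a i.2.1, a i.1⟫‖
  refine ⟨fun i => if G i then row ξ ⁻¹' Metric.ball (a i.1) (R i.2.2) else ∅,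
    fun i => if G i then row η ⁻¹' Metric.ball (a i.2.1) (R i.2.2) else ∅, ?_, ?_, ?_, ?_⟩
  · intro i; dsimp only; split_ifs
    · letI : MeasurableSpace (HH ℂ) := borel _
      haveI : BorelSpace (HH ℂ) := ⟨rfl⟩
      exact (row_smeas ξ).measurable Metric.isOpen_ball.measurableSet
    · exact MeasurableSet.empty
  · intro i; dsimp only; split_ifs
    · letI : MeasurableSpace (HH ℂ) := borel _
      haveI : BorelSpace (HH ℂ) := ⟨rfl⟩
      exact (row_smeas η).measurable Metric.isOpen_ball.measurableSet
    · exact MeasurableSet.empty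
  · intro i
    by_cases hG : G i
    · simp only [hG, if_true]
      refine kill hU h0 ?_ ?_ (a i.1) (a i.2.1) (r := R i.2.2) (by positivity) ?_ ?_ hG
      · letI : MeasurableSpace (HH ℂ) := borel _
        haveI : BorelSpace (HH ℂ) := ⟨rfl⟩
        exact (row_smeas ξ).measurable Metric.isOpen_ball.measurableSet
      · letI : MeasurableSpace (HH ℂ) := borel _
        haveI : BorelSpace (HH ℂ) := ⟨rfl⟩
        exact (row_smeas η).measurable Metric.isOpen_ball.measurableSet
      · intro x hx; rw [← dist_eq_norm]; exact (Metric.mem_ball.1 hx).le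
      · intro x hx; rw [← dist_eq_norm]; exact (Metric.mem_ball.1 hx).le
    · simp only [hG, if_false]
      intro S _ f g hf hg
      have : f = 0 := by
        apply Lp.ext
        filter_upwards [hf, Lp.coeFn_zero ℂ 2 μ₁] with x h1 h2
        rw [h1 (by simp), h2]; rfl
      simp [this]
  · intro p hp
    set x := row ξ p.1 with hx
    set y := row η p.2 with hy
    have hc : 0 < ‖⟪y, x⟫‖ := norm_pos_iff.2 hp
    have ht : Filter.Tendsto (fun k => R k * (2 * ‖x‖ + 2 * ‖y‖ + 4 * R k)) Filter.atTop (nhds (0 * (2 * ‖x‖ + 2 * ‖y‖ + 4 * 0))) := by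
      have : Filter.Tendsto R Filter.atTop (nhds 0) := tendsto_one_div_add_atTop_nhds_zero_nat
      exact this.mul ((this.const_mul 4).const_add _)
    rw [zero_mul] at ht
    obtain ⟨k, hk⟩ := (ht.eventually (gt_mem_nhds hc)).exists
    have hR : 0 < R k := by positivity
    obtain ⟨i, hi⟩ := (TopologicalSpace.denseRange_denseSeq (HH ℂ)).exists_dist_lt x hR
    obtain ⟨j, hj⟩ := (TopologicalSpace.denseRange_denseSeq (HH ℂ)).exists_dist_lt y hR
    have hG : G (i, j, k) := by
      show R k * (‖a i‖ + ‖a j‖ + R k) < ‖⟪a j, a i⟫‖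
      rw [dist_eq_norm] at hi hj
      change ‖x - a i‖ < _ at hi
      change ‖y - a j‖ < _ at hj
      have n1 : ‖a i‖ ≤ ‖x‖ + R k := by
        have := norm_sub_norm_le (a i) x; rw [norm_sub_rev] at this; linarith
      have n2 : ‖a j‖ ≤ ‖y‖ + R k := by
        have := norm_sub_norm_le (a j) y; rw [norm_sub_rev] at this; linarith
      have e : ⟪y, x⟫ = ⟪a j, a i⟫ + ⟪y - a j, x⟫ + ⟪a j, x - a i⟫ := by
        rw [inner_sub_left, inner_sub_right]; ring
      have e1 : ‖⟪y, x⟫‖ ≤ ‖⟪a j, a i⟫‖ + ‖y - a j‖ * ‖x‖ + ‖a j‖ * ‖x - a i‖ := by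
        rw [e]
        refine (norm_add₃_le ).trans ?_
        gcongr <;> exact norm_inner_le_norm _ _
      have e2 : ‖y - a j‖ * ‖x‖ ≤ R k * ‖x‖ := by gcongr
      have e3 : ‖a j‖ * ‖x - a i‖ ≤ (‖y‖ + R k) * R k := by gcongr
      nlinarith
    refine ⟨(i, j, k), ?_, ?_⟩
    · simp only [hG, if_true]; exact hi
    · simp only [hG, if_true]; exact hj
end


lemma exists_posL2 {X : Type*} [MeasurableSpace X] (μ : Measure X) [SigmaFinite μ] :
    ∃ f : Lp ℂ 2 μ, ∀ᵐ x ∂μ, f x ≠ 0 := by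
  obtain ⟨g, h1, h2, h3⟩ := exists_pos_lintegral_lt_of_sigmaFinite μ (ε := 1) one_ne_zero
  let φ : X → ℂ := fun x => ((NNReal.sqrt (g x) : ℝ) : ℂ)
  have hm : Measurable φ := Complex.measurable_ofReal.comp
    (measurable_coe_nnreal_real.comp (NNReal.continuous_sqrt.measurable.comp h2))
  have hφ : MemLp φ 2 μ := by
    refine ⟨hm.aestronglyMeasurable, ?_⟩
    have : eLpNorm φ 2 μ ^ 2 < ⊤ := by
      rw [eLp_sq]
      refine lt_of_le_of_lt (lintegral_mono fun x => ?_) (h3.trans ENNReal.one_lt_top)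
      have : ‖φ x‖ₑ = (NNReal.sqrt (g x) : ENNReal) := by
        simp only [φ]
        rw [← ofReal_norm_eq_enorm, Complex.norm_real, Real.norm_of_nonneg (NNReal.coe_nonneg _)]
        exact ENNReal.ofReal_coe_nnreal
      rw [this, ← ENNReal.coe_pow, NNReal.sq_sqrt]
    by_contra hh
    rw [not_lt, top_le_iff] at hh
    simp [hh] at this
  refine ⟨hφ.toLp, ?_⟩
  filter_upwards [hφ.coeFn_toLp] with x hx
  rw [hx]
  simp [φ, (h1 x).ne']

section
variable {X₁ X₂ : Type*} [MeasurableSpace X₁] [MeasurableSpace X₂]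
  {μ₁ : Measure X₁} {μ₂ : Measure X₂} [SigmaFinite μ₁] [SigmaFinite μ₂]

theorem corC {κ : Set (X₁ × X₂)} {α : Set X₁} {β : Set X₂} (hα : MeasurableSet α)
    (hβ : MeasurableSet β) (h : KU μ₁ μ₂ (An μ₁ μ₂ κ) α β) :
    ∀ᶠ p in mae μ₁ μ₂, p.1 ∈ α → p.2 ∈ β → p ∉ κ := by
  obtain ⟨f, hf⟩ := exists_posL2 μ₁
  obtain ⟨g, hg⟩ := exists_posL2 μ₂
  have hv : Van (sg (pj μ₁ α f)) (sg (pj μ₂ β g)) κ := by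
    by_contra hv
    obtain ⟨T, hT, hne⟩ := lemC κ _ _ hv
    exact hne (h T hT _ _ (pj_supIn hα f) (pj_supIn hβ g))
  filter_upwards [hv, ker_sg (pj μ₁ α f) (pj μ₂ β g), mae_intro hf hg,
    mae_intro (pj_ae hα f) (pj_ae hβ g)] with p h1 h2 h3 h4 ha hb hk
  have := h1 hk
  rw [h2, h4.1, h4.2] at this
  simp [ha, hb, h3.1, h3.2] at this

theorem corC' {κ : Set (X₁ × X₂)} {α : Set X₁} {β : Set X₂} (hα : MeasurableSet α)
    (hβ : MeasurableSet β) (h : KU μ₁ μ₂ (Mmax μ₁ μ₂ κ) α β) :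
    ∀ᶠ p in mae μ₁ μ₂, p.1 ∈ α → p.2 ∈ β → p ∉ κ :=
  corC hα hβ fun S hS => h S (An_sub_Mmax κ hS)

lemma RefHull_mono {H K : Type*} [NormedAddCommGroup H] [InnerProductSpace ℂ H]
    [NormedAddCommGroup K] [InnerProductSpace ℂ K] {U V : Set (H →L[ℂ] K)} (h : U ⊆ V) :
    RefHull U ⊆ RefHull V := fun _ hT x => closure_mono (image_mono h) (hT x)

theorem synth_An {κ : Set (X₁ × X₂)} (h : OperatorSynthetic μ₁ μ₂ κ) :
    Mmax μ₁ μ₂ κ ⊆ An μ₁ μ₂ κ := by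
  rw [← h.2]
  apply sInter_subset_of_mem
  refine ⟨An_bimod κ, h.1, Subset.antisymm ?_ ?_⟩
  · exact (RefHull_mono (An_sub_Mmax κ)).trans RefHull_Mmax.subset
  · intro T hT
    refine lemD (An_bimod κ) fun α β hα hβ hK => ?_
    exact mem_Mmax.1 hT α β hα hβ (corC hα hβ hK)

theorem van_of_support {κ : Set (X₁ × X₂)} {U : Set (Lp ℂ 2 μ₁ →L[ℂ] Lp ℂ 2 μ₂)}
    (hU : IsMultBimodule μ₁ μ₂ U) (hs : RefHull U = Mmax μ₁ μ₂ κ)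
    {ξ : HH (Lp ℂ 2 μ₁)} {η : HH (Lp ℂ 2 μ₂)} (h0 : ∀ S ∈ U, pr S ξ η = 0) : Van ξ η κ := by
  obtain ⟨α, β, hα, hβ, hK, hc⟩ := lemA hU h0
  have : ∀ i, ∀ᶠ p in mae μ₁ μ₂, p.1 ∈ α i → p.2 ∈ β i → p ∉ κ := fun i =>
    corC' (hα i) (hβ i) fun S hS => RefHull_KL (hK i) (hs ▸ hS)
  filter_upwards [eventually_countable_forall.2 this] with p hp hpk
  by_contra hne
  obtain ⟨i, h1, h2⟩ := hc p hne
  exact hp i h1 h2 hpk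

/-- Reduction of synthesis to the vanishing statement. -/
theorem synth_of_An {κ : Set (X₁ × X₂)} (hκ : OmegaClosed μ₁ μ₂ κ)
    (h : Mmax μ₁ μ₂ κ ⊆ An μ₁ μ₂ κ) : OperatorSynthetic μ₁ μ₂ κ := by
  refine ⟨hκ, Subset.antisymm ?_ ?_⟩
  · exact sInter_subset_of_mem ⟨Mmax_bimod κ, hκ, RefHull_Mmax⟩
  · intro T hT
    rw [Mmin, mem_sInter]
    rintro U ⟨hU, -, hs⟩
    by_contra hTU
    obtain ⟨ξ, η, h1, h2⟩ := wk_sep hU.1 hTU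
    exact h2 (h hT ξ η (van_of_support hU hs h1))
end


section nest
variable {H : Type*} [NormedAddCommGroup H] [InnerProductSpace ℂ H] [CompleteSpace H]

lemma exists_orth (q : Submodule ℂ H) (hq : IsClosed (q : Set H)) {x : H} (hx : x ∉ q) :
    ∃ z ∈ qᗮ, ⟪z, x⟫ ≠ (0:ℂ) := by
  haveI : CompleteSpace q := hq.completeSpace_coe
  by_contra! h
  apply hx
  rw [← Submodule.orthogonal_orthogonal q, Submodule.mem_orthogonal]
  exact h

lemma nest_aux {N : Set (Submodule ℂ H)} {M : Submodule ℂ H}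
    (hM : ∀ B ∈ nestAlg N, ∀ x ∈ M, B x ∈ M) {x y : H} (hx : x ∈ M) (q : Submodule ℂ H)
    (hq : IsClosed (q : Set H)) (hxq : x ∉ q) (h : ∀ p ∈ N, y ∈ p ∨ p ≤ q) : y ∈ M := by
  obtain ⟨z, hz, hzx⟩ := exists_orth q hq hxq
  let R : H →L[ℂ] H := (innerSL ℂ z).smulRight y
  have hR : ∀ v, R v = ⟪z, v⟫ • y := fun v => rfl
  have hRN : R ∈ nestAlg N := by
    intro p hp v hv
    rw [hR]
    rcases h p hp with h1 | h1
    · exact p.smul_mem _ h1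
    · rw [Submodule.mem_orthogonal'] at hz
      rw [hz v (h1 hv), zero_smul]; exact p.zero_mem
  have := hM R hRN x hx
  rw [hR] at this
  exact (M.smul_mem_iff hzx).1 this

lemma nest_total {N : Set (Submodule ℂ H)} (hN : IsNest N) {M L : Submodule ℂ H}
    (hLc : IsClosed (L : Set H))
    (hM : ∀ B ∈ nestAlg N, ∀ x ∈ M, B x ∈ M) (hL : ∀ B ∈ nestAlg N, ∀ x ∈ L, B x ∈ L) :
    M ≤ L ∨ L ≤ M := by
  by_contra! h
  obtain ⟨x, hxM, hxL⟩ := SetLike.not_le_iff_exists.1 h.1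
  obtain ⟨y, hyL, hyM⟩ := SetLike.not_le_iff_exists.1 h.2
  let q := (sSup {p ∈ N | y ∉ p}).topologicalClosure
  have hqL : q ≤ L := by
    apply Submodule.topologicalClosure_minimal _ _ hLc
    apply sSup_le
    rintro p ⟨hp, hyp⟩ y' hy'
    refine nest_aux hL hyL p (hN.1 p hp) hyp fun p' hp' => ?_
    rcases hN.2.1.total hp hp' with h1 | h1
    · exact Or.inl (h1 hy')
    · exact Or.inr h1
  refine hyM (nest_aux hM hxM q (Submodule.isClosed_topologicalClosure _) (fun hh => hxL (hqL hh)) ?_)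
  intro p hp
  by_cases hyp : y ∈ p
  · exact Or.inl hyp
  · exact Or.inr ((le_sSup (show p ∈ {p ∈ N | y ∉ p} from ⟨hp, hyp⟩)).trans (Submodule.le_topologicalClosure _))
end nest

section
variable {X₁ X₂ : Type*} [MeasurableSpace X₁] [MeasurableSpace X₂]
  {μ₁ : Measure X₁} {μ₂ : Measure X₂}

lemma KU_total {V : Set (Lp ℂ 2 μ₁ →L[ℂ] Lp ℂ 2 μ₂)} (hV : IsNestBimodule V) (α α' : Set X₁) :
    (∀ β, KU μ₁ μ₂ V α β → KU μ₁ μ₂ V α' β) ∨ (∀ β, KU μ₁ μ₂ V α' β → KU μ₁ μ₂ V α β) := by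
  obtain ⟨-, N₁, N₂, -, hN₂, hb⟩ := hV
  let G (α : Set X₁) : Set (Lp ℂ 2 μ₂) := {v | ∃ S ∈ V, ∃ f, SupIn μ₁ α f ∧ v = S f}
  let W (α : Set X₁) : Submodule ℂ (Lp ℂ 2 μ₂) := (Submodule.span ℂ (G α)).topologicalClosure
  have hWc : ∀ α, IsClosed (W α : Set (Lp ℂ 2 μ₂)) := fun α => Submodule.isClosed_topologicalClosure _
  have hinv : ∀ α, ∀ B ∈ nestAlg N₂, ∀ x ∈ W α, B x ∈ W α := by
    intro α B hB
    have : W α ≤ (W α).comap (B : Lp ℂ 2 μ₂ →ₗ[ℂ] Lp ℂ 2 μ₂) := by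
      apply Submodule.topologicalClosure_minimal
      · rw [Submodule.span_le]
        rintro v ⟨S, hS, f, hf, rfl⟩
        apply Submodule.le_topologicalClosure
        apply Submodule.subset_span
        exact ⟨B ∘L S ∘L ContinuousLinearMap.id ℂ _, hb S hS _ (fun p _ x hx => hx) B hB, f, hf, rfl⟩
      · exact (hWc α).preimage B.continuous
    exact this
  have hmono : ∀ α α', W α' ≤ W α → ∀ β, KU μ₁ μ₂ V α β → KU μ₁ μ₂ V α' β := by
    intro α α' hle β hK S hS f g hf hg
    have h1 : S f ∈ W α := hle (Submodule.le_topologicalClosure _ (Submodule.subset_span ⟨S, hS, f, hf, rfl⟩))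
    have h2 : W α ≤ (Submodule.span ℂ {g})ᗮ := by
      apply Submodule.topologicalClosure_minimal _ _ (Submodule.isClosed_orthogonal _)
      rw [Submodule.span_le]
      rintro v ⟨S, hS, f, hf, rfl⟩
      exact Submodule.mem_orthogonal_singleton_iff_inner_right.2 (hK S hS f g hf hg)
    exact Submodule.mem_orthogonal_singleton_iff_inner_right.1 (h2 h1)
  rcases nest_total hN₂ (hWc α') (hinv α) (hinv α') with h | h
  · exact Or.inr (hmono _ _ h)
  · exact Or.inl (hmono _ _ h)

lemma zero_on {X : Type*} [MeasurableSpace X] {μ : Measure X} {A : Set X} (hA : MeasurableSet A)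
    {w : Lp ℂ 2 μ} (h : ∀ f, SupIn μ A f → ⟪f, w⟫ = (0:ℂ)) : SupIn μ Aᶜ w := by
  have h1 : pj μ A w = 0 := by
    have := h _ (pj_supIn hA w)
    rw [← pj_eq hA (pj_supIn hA w), ← pj_inner hA, inner_self_eq_zero] at this
    exact this
  filter_upwards [pj_ae hA w, Lp.coeFn_zero ℂ 2 μ] with x h2 h3 h4
  rw [h1, h3] at h2
  simpa [not_not.1 h4] using h2.symm

lemma inner_zero_on {X : Type*} [MeasurableSpace X] {μ : Measure X} {A : Set X}
    {f w : Lp ℂ 2 μ} (hf : SupIn μ A f) (hw : SupIn μ Aᶜ w) : ⟪f, w⟫ = (0:ℂ) := by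
  rw [L2_inner]
  apply integral_eq_zero_of_ae
  filter_upwards [hf, hw] with x h1 h2
  by_cases h : x ∈ A
  · simp [h2 (by simpa using h)]
  · simp [h1 h]

lemma supIn_iInter {X : Type*} [MeasurableSpace X] {μ : Measure X} {ι : Type*} [Countable ι]
    {A : ι → Set X} {w : Lp ℂ 2 μ} (h : ∀ i, SupIn μ (A i)ᶜ w) : SupIn μ (⋃ i, A i)ᶜ w := by
  filter_upwards [ae_all_iff.2 h] with x hx h'
  obtain ⟨i, hi⟩ := mem_iUnion.1 (not_not.1 h')
  exact hx i (by simpa using hi)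

lemma KL_iUnion_right {ι : Type*} [Countable ι] {T : Lp ℂ 2 μ₁ →L[ℂ] Lp ℂ 2 μ₂} {α : Set X₁}
    {β : ι → Set X₂} (hβ : ∀ i, MeasurableSet (β i)) (h : ∀ i, KL μ₁ μ₂ T α (β i)) :
    KL μ₁ μ₂ T α (⋃ i, β i) := by
  intro f g hf hg
  exact inner_zero_on hg (supIn_iInter fun i => zero_on (hβ i) fun g' hg' => h i f g' hf hg')

lemma KL_iUnion_left {ι : Type*} [Countable ι] {T : Lp ℂ 2 μ₁ →L[ℂ] Lp ℂ 2 μ₂} {α : ι → Set X₁}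
    {β : Set X₂} (hα : ∀ i, MeasurableSet (α i)) (h : ∀ i, KL μ₁ μ₂ T (α i) β) :
    KL μ₁ μ₂ T (⋃ i, α i) β := by
  intro f g hf hg
  rw [← ContinuousLinearMap.adjoint_inner_left, ← inner_conj_symm]
  rw [inner_zero_on hf (supIn_iInter fun i => zero_on (hα i) fun f' hf' => ?_), map_zero]
  rw [← inner_conj_symm, ContinuousLinearMap.adjoint_inner_left, h i f' g hf' hg, map_zero]
end



lemma ind_sub {X : Type*} [MeasurableSpace X] {μ : Measure X} {A : ℕ → Set X} {A0 : Set X}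
    (hA : ∀ n, MeasurableSet (A n)) (hA0 : MeasurableSet A0) (hf : ∀ n, μ (A n) ≠ ⊤) (hf0 : μ A0 ≠ ⊤)
    (h : Filter.Tendsto (fun n => indicatorConstLp 2 (hA n) (hf n) (1:ℂ)) Filter.atTop
      (nhds (indicatorConstLp 2 hA0 hf0 (1:ℂ)))) :
    ∃ ns : ℕ → ℕ, StrictMono ns ∧ ∀ᵐ x ∂μ, x ∈ A0 → ∀ᶠ k in Filter.atTop, x ∈ A (ns k) := by
  obtain ⟨ns, h1, h2⟩ := (tendstoInMeasure_of_tendsto_Lp h).exists_seq_tendsto_ae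
  refine ⟨ns, h1, ?_⟩
  filter_upwards [h2, indicatorConstLp_coeFn (p := 2) (hs := hA0) (hμs := hf0) (c := (1:ℂ)),
    ae_all_iff.2 fun n => indicatorConstLp_coeFn (p := 2) (hs := hA n) (hμs := hf n) (c := (1:ℂ))] with x h3 h4 h5 h6
  rw [h4] at h3
  simp only [h5, h6, indicator_of_mem] at h3
  have := h3.eventually (eventually_ne_nhds (one_ne_zero (α := ℂ)))
  filter_upwards [this] with k hk
  by_contra hh
  simp [hh] at hk

section
variable {X₁ X₂ : Type*} [MeasurableSpace X₁] [MeasurableSpace X₂] [StandardBorelSpace X₁]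
  [StandardBorelSpace X₂] {μ₁ : Measure X₁} {μ₂ : Measure X₂} [SigmaFinite μ₁] [SigmaFinite μ₂]

/-- countable family of killed rectangles covering all killed rectangles -/
lemma dense_killed (V : Set (Lp ℂ 2 μ₁ →L[ℂ] Lp ℂ 2 μ₂)) :
    ∃ (α : ℕ → Set X₁) (β : ℕ → Set X₂), (∀ n, MeasurableSet (α n)) ∧ (∀ n, MeasurableSet (β n)) ∧
      (∀ n, KU μ₁ μ₂ V (α n) (β n)) ∧ ∀ γ δ, MeasurableSet γ → MeasurableSet δ → KU μ₁ μ₂ V γ δ →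
        ∀ᶠ p in mae μ₁ μ₂, p.1 ∈ γ → p.2 ∈ δ → ∃ n, p.1 ∈ α n ∧ p.2 ∈ β n := by
  haveI : Fact ((2:ENNReal) ≠ ⊤) := ⟨by norm_num⟩
  let D := {q : Set X₁ × Set X₂ // MeasurableSet q.1 ∧ MeasurableSet q.2 ∧ μ₁ q.1 ≠ ⊤ ∧ μ₂ q.2 ≠ ⊤ ∧
    KU μ₁ μ₂ V q.1 q.2}
  let Φ (q : D) : Lp ℂ 2 μ₁ × Lp ℂ 2 μ₂ :=
    (indicatorConstLp 2 q.2.1 q.2.2.2.1 (1:ℂ), indicatorConstLp 2 q.2.2.1 q.2.2.2.2.1 (1:ℂ))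
  haveI : Nonempty D := ⟨⟨(∅, ∅), MeasurableSet.empty, MeasurableSet.empty, by simp, by simp, by
    intro S _ f g hf hg
    have : f = 0 := by
      apply Lp.ext
      filter_upwards [hf, Lp.coeFn_zero ℂ 2 μ₁] with x h1 h2
      rw [h1 (by simp), h2]; rfl
    simp [this]⟩⟩
  haveI : Nonempty (range Φ) := (range_nonempty Φ).to_subtype
  let s : ℕ → range Φ := TopologicalSpace.denseSeq (range Φ)
  have hs : DenseRange s := TopologicalSpace.denseRange_denseSeq _
  choose d hd using fun n => (s n).2
  refine ⟨fun n => (d n).1.1, fun n => (d n).1.2, fun n => (d n).2.1, fun n => (d n).2.2.1,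
    fun n => (d n).2.2.2.2.2, ?_⟩
  have fin : ∀ γ δ, MeasurableSet γ → MeasurableSet δ → KU μ₁ μ₂ V γ δ → μ₁ γ ≠ ⊤ → μ₂ δ ≠ ⊤ →
        ∀ᶠ p in mae μ₁ μ₂, p.1 ∈ γ → p.2 ∈ δ → ∃ n, p.1 ∈ (d n).1.1 ∧ p.2 ∈ (d n).1.2 := by
    intro γ δ hγ hδ hK hf1 hf2
    let q : D := ⟨(γ, δ), hγ, hδ, hf1, hf2, hK⟩
    obtain ⟨t, ht1, ht2⟩ := mem_closure_iff_seq_limit.1 (hs ⟨Φ q, q, rfl⟩)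
    choose n hn using ht1
    have ht3 : Filter.Tendsto (fun k => Φ (d (n k))) Filter.atTop (nhds (Φ q)) := by
      have := (continuous_subtype_val.tendsto _).comp ht2
      refine this.congr fun k => ?_
      rw [hd (n k)]; simp [hn]
    have ta := ((continuous_fst.tendsto _).comp ht3)
    have tb := ((continuous_snd.tendsto _).comp ht3)
    obtain ⟨k1, hk1, c1⟩ := ind_sub (A := fun k => (d (n k)).1.1) (fun k => (d (n k)).2.1) hγ
      (fun k => (d (n k)).2.2.2.1) hf1 ta
    obtain ⟨k2, hk2, c2⟩ := ind_sub (A := fun k => (d (n (k1 k))).1.2) (fun k => (d (n (k1 k))).2.2.1) hδ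
      (fun k => (d (n (k1 k))).2.2.2.2.1) hf2 (tb.comp hk1.tendsto_atTop)
    filter_upwards [mae_intro c1 c2] with p hp h1 h2
    obtain ⟨k, hk⟩ := ((hk2.tendsto_atTop.eventually (hp.1 h1)).and (hp.2 h2)).exists
    exact ⟨_, hk⟩
  intro γ δ hγ hδ hK
  have := fun m : ℕ × ℕ => fin (γ ∩ spanningSets μ₁ m.1) (δ ∩ spanningSets μ₂ m.2)
    (hγ.inter (measurableSet_spanningSets _ _)) (hδ.inter (measurableSet_spanningSets _ _))
    (fun S hS => (hK S hS).mono inter_subset_left inter_subset_left)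
    (ne_top_of_le_ne_top (measure_spanningSets_lt_top μ₁ m.1).ne (measure_mono inter_subset_right))
    (ne_top_of_le_ne_top (measure_spanningSets_lt_top μ₂ m.2).ne (measure_mono inter_subset_right))
  filter_upwards [eventually_countable_forall.2 this] with p hp h1 h2
  exact hp (spanningSetsIndex μ₁ p.1, spanningSetsIndex μ₂ p.2)
    ⟨h1, mem_spanningSetsIndex _ _⟩ ⟨h2, mem_spanningSetsIndex _ _⟩

theorem chain_of_nest {V : Set (Lp ℂ 2 μ₁ →L[ℂ] Lp ℂ 2 μ₂)} (hV : IsNestBimodule V) :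
    ∃ (α : ℕ → Set X₁) (β : ℕ → Set X₂), (∀ n, MeasurableSet (α n)) ∧ (∀ n, MeasurableSet (β n)) ∧
      (∀ n, KU μ₁ μ₂ V (α n) (β n)) ∧
      (∀ n i, (α i ⊆ α n ∧ β n ⊆ β i) ∨ (α n ⊆ α i ∧ β i ⊆ β n)) ∧
      ∀ γ δ, MeasurableSet γ → MeasurableSet δ → KU μ₁ μ₂ V γ δ →
        ∀ᶠ p in mae μ₁ μ₂, p.1 ∈ γ → p.2 ∈ δ → ∃ n, p.1 ∈ α n ∧ p.2 ∈ β n := by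
  obtain ⟨α, β, hα, hβ, hK, hcov⟩ := dense_killed (μ₁ := μ₁) (μ₂ := μ₂) V
  let b (n : ℕ) : Set X₂ := ⋃ m : {m // KU μ₁ μ₂ V (α n) (β m)}, β m
  let a (n : ℕ) : Set X₁ := ⋃ m : {m // KU μ₁ μ₂ V (α m) (b n)}, α m
  have hb : ∀ n, KU μ₁ μ₂ V (α n) (b n) := fun n S hS =>
    KL_iUnion_right (fun m => hβ m) fun m => m.2 S hS
  have ha : ∀ n, KU μ₁ μ₂ V (a n) (b n) := fun n S hS =>
    KL_iUnion_left (fun m => hα m) fun m => m.2 S hS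
  have hcmp : ∀ n i, (∀ δ, KU μ₁ μ₂ V (α n) δ → KU μ₁ μ₂ V (α i) δ) → a i ⊆ a n ∧ b n ⊆ b i := by
    intro n i h
    have hbb : b n ⊆ b i := by
      apply iUnion_subset
      rintro ⟨m, hm⟩
      exact subset_iUnion (fun m : {m // KU μ₁ μ₂ V (α i) (β m)} => β m) ⟨m, h _ hm⟩
    refine ⟨?_, hbb⟩
    apply iUnion_subset
    rintro ⟨m, hm⟩
    exact subset_iUnion (fun m : {m // KU μ₁ μ₂ V (α m) (b n)} => α m)
      ⟨m, fun S hS => (hm S hS).mono subset_rfl hbb⟩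
  refine ⟨a, b, fun n => MeasurableSet.iUnion fun m => hα m, fun n => MeasurableSet.iUnion fun m => hβ m,
    ha, ?_, ?_⟩
  · intro n i
    rcases KU_total hV (α n) (α i) with h | h
    · exact Or.inl (hcmp n i h)
    · exact Or.inr (hcmp i n h)
  · intro γ δ hγ hδ h
    filter_upwards [hcov γ δ hγ hδ h] with p hp h1 h2
    obtain ⟨n, h3, h4⟩ := hp h1 h2
    exact ⟨n, mem_iUnion.2 ⟨⟨n, hb n⟩, h3⟩, mem_iUnion.2 ⟨⟨n, hK n⟩, h4⟩⟩
end


section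
variable {X₁ X₂ : Type*} [MeasurableSpace X₁] [MeasurableSpace X₂]
  {μ₁ : Measure X₁} {μ₂ : Measure X₂}

lemma margEquiv_iff {E F : Set (X₁ × X₂)} :
    MargEquiv μ₁ μ₂ E F ↔ ∀ᶠ p in mae μ₁ μ₂, p ∈ E ↔ p ∈ F := by
  rw [MargEquiv, margNull_iff]
  refine Filter.eventually_congr (Filter.Eventually.of_forall fun p => ?_)
  simp only [mem_union, mem_diff]; tauto

lemma omegaClosed_iff {κ : Set (X₁ × X₂)} : OmegaClosed μ₁ μ₂ κ ↔
    ∃ (α : ℕ → Set X₁) (β : ℕ → Set X₂), (∀ n, MeasurableSet (α n)) ∧ (∀ n, MeasurableSet (β n)) ∧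
    ∀ᶠ p in mae μ₁ μ₂, p ∈ κ ↔ ∀ n, ¬ (p.1 ∈ α n ∧ p.2 ∈ β n) := by
  unfold OmegaClosed OmegaOpen
  simp only [margEquiv_iff]
  refine exists_congr fun α => exists_congr fun β => and_congr_right fun _ => and_congr_right fun _ => ?_
  refine Filter.eventually_congr (Filter.Eventually.of_forall fun p => ?_)
  rw [mem_compl_iff, not_iff_comm, mem_iUnion, not_exists]
  exact ⟨fun h => ⟨fun h' => h.2 h', fun h' => h.1 h'⟩, fun h => ⟨fun h' => h.2 h', fun h' => h.1 h'⟩⟩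

structure Chain (α : ℕ → Set X₁) (β : ℕ → Set X₂) : Prop where
  ma : ∀ n, MeasurableSet (α n)
  mb : ∀ n, MeasurableSet (β n)
  cmp : ∀ n i, (α i ⊆ α n ∧ β n ⊆ β i) ∨ (α n ⊆ α i ∧ β i ⊆ β n)

variable [StandardBorelSpace X₁] [StandardBorelSpace X₂] [SigmaFinite μ₁] [SigmaFinite μ₂]

theorem finiteWidth_chain {κ : Set (X₁ × X₂)} (h : FiniteWidthSet μ₁ μ₂ κ) :
    ∃ (k : ℕ) (α : Fin k → ℕ → Set X₁) (β : Fin k → ℕ → Set X₂), (∀ j, Chain (α j) (β j)) ∧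
      ∀ᶠ p in mae μ₁ μ₂, p ∈ κ ↔ ∀ j q, ¬ (p.1 ∈ α j q ∧ p.2 ∈ β j q) := by
  obtain ⟨V, ⟨k, Vs, hVs, rfl⟩, hκ, hs⟩ := h
  choose α β ma mb hK cmp cov using fun j => chain_of_nest (μ₁ := μ₁) (μ₂ := μ₂) (hVs j).2
  refine ⟨k, α, β, fun j => ⟨ma j, mb j, cmp j⟩, ?_⟩
  have h1 : ∀ j q, ∀ᶠ p in mae μ₁ μ₂, p.1 ∈ α j q → p.2 ∈ β j q → p ∉ κ := by
    intro j q
    refine corC' (ma j q) (mb j q) fun S hS => RefHull_KL (U := ⋂ j, Vs j) ?_ (hs ▸ hS)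
    exact fun S hS => hK j q S (mem_iInter.1 hS j)
  obtain ⟨γ, δ, hγ, hδ, hc⟩ := omegaClosed_iff.1 hκ
  let κ' : Set (X₁ × X₂) := {p | ∀ j q, ¬ (p.1 ∈ α j q ∧ p.2 ∈ β j q)}
  have h2 : ∀ m, ∀ᶠ p in mae μ₁ μ₂, p.1 ∈ γ m → p.2 ∈ δ m → p ∉ κ' := by
    intro m
    apply corC (hγ m) (hδ m)
    intro T hT
    have hTV : T ∈ ⋂ j, Vs j := by
      rw [mem_iInter]
      intro j
      by_contra hTj
      obtain ⟨ξ, η, ha, hb⟩ := wk_sep (hVs j).1.1 hTj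
      obtain ⟨a, b, hma, hmb, hk, hcov⟩ := lemA (hVs j).1 ha
      refine hb (hT ξ η ?_)
      filter_upwards [eventually_countable_forall.2 fun i => cov j (a i) (b i) (hma i) (hmb i) (hk i)]
        with p hp hpk
      by_contra hne
      obtain ⟨i, h3, h4⟩ := hcov p hne
      obtain ⟨q, hq⟩ := hp i h3 h4
      exact hpk j q hq
    have hTm : T ∈ Mmax μ₁ μ₂ κ := hs ▸ sub_RefHull hTV
    refine mem_Mmax.1 hTm _ _ (hγ m) (hδ m) ?_
    filter_upwards [hc] with p hp h3 h4 h5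
    exact hp.1 h5 m ⟨h3, h4⟩
  filter_upwards [hc, eventually_countable_forall.2 h2,
    eventually_countable_forall.2 fun j => eventually_countable_forall.2 (h1 j)] with p h3 h4 h5
  constructor
  · intro hp j q hh
    exact h5 j q hh.1 hh.2 hp
  · intro hp
    rw [h3]
    intro n hn
    exact h4 n hn.1 hn.2 hp
end


section slice

instance L2_sc {Y : Type*} [MeasurableSpace Y] [StandardBorelSpace Y] (ν : Measure Y) [SigmaFinite ν] :
    SecondCountableTopology (Lp ℂ 2 ν) := by
  haveI : Fact ((2 : ENNReal) ≠ ⊤) := ⟨by simp⟩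
  infer_instance

lemma meas_of_dist {X E : Type*} [MeasurableSpace X] [MetricSpace E] [CompleteSpace E]
    [SecondCountableTopology E] [Nonempty E] (F : X → E)
    (h : ∀ c, Measurable fun x => dist (F x) c) : StronglyMeasurable F := by
  borelize E
  haveI : PolishSpace E := inferInstance
  let d := TopologicalSpace.denseSeq E
  have hd : DenseRange d := TopologicalSpace.denseRange_denseSeq E
  let e : E → (ℕ → ℝ) := fun y n => dist y (d n)
  have hec : Continuous e := continuous_pi fun n => continuous_id.dist continuous_const
  have hei : Function.Injective e := by
    intro y z hyz
    have : (fun c => dist y c) = fun c => dist z c :=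
      hd.equalizer (continuous_const.dist continuous_id) (continuous_const.dist continuous_id)
        (funext fun n => congrFun hyz n)
    have h2 := congrFun this y
    simp only [dist_self] at h2
    exact (dist_eq_zero.1 h2.symm).symm
  have hm : MeasurableEmbedding e := hec.measurableEmbedding hei
  have : Measurable F := by
    rw [← hm.measurable_comp_iff]
    exact measurable_pi_iff.2 fun n => h (d n)
  exact this.stronglyMeasurable

variable {X Y : Type*} [MeasurableSpace X] [MeasurableSpace Y]
  {μ : Measure X} {ν : Measure Y}

variable [StandardBorelSpace Y] [SigmaFinite μ] [SigmaFinite ν]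

lemma slice1 (ξ : Lp ℂ 2 (μ.prod ν)) : ∃ F : X → Lp ℂ 2 ν, StronglyMeasurable F ∧
    ∀ᵐ x ∂μ, ∀ᵐ y ∂ν, F x y = ξ (x, y) := by
  classical
  have hξ : StronglyMeasurable (ξ : X × Y → ℂ) := Lp.stronglyMeasurable ξ
  have hsl : ∀ x, StronglyMeasurable fun y => ξ (x, y) := fun x => hξ.comp_measurable measurable_prodMk_left
  have hm0 : Measurable fun x => ∫⁻ y, ‖ξ (x, y)‖ₑ ^ 2 ∂ν :=
    (hξ.enorm.pow_const 2).lintegral_prod_right'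
  have hfin : ∀ᵐ x ∂μ, ∫⁻ y, ‖ξ (x, y)‖ₑ ^ 2 ∂ν < ⊤ := by
    apply ae_lt_top hm0
    rw [← lintegral_prod _ ((hξ.enorm.pow_const 2).aemeasurable), Lp_enorm_sq]
    exact ENNReal.pow_ne_top enorm_ne_top
  have hL : ∀ x, ∫⁻ y, ‖ξ (x, y)‖ₑ ^ 2 ∂ν < ⊤ → MemLp (fun y => ξ (x, y)) 2 ν := by
    intro x hx
    refine ⟨(hsl x).aestronglyMeasurable, ?_⟩
    rw [← eLp_sq] at hx
    by_contra hc
    rw [not_lt, top_le_iff] at hc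
    rw [hc] at hx; simp at hx
  let F : X → Lp ℂ 2 ν := fun x => if h : ∫⁻ y, ‖ξ (x, y)‖ₑ ^ 2 ∂ν < ⊤ then (hL x h).toLp _ else 0
  have hF1 : ∀ x, ∫⁻ y, ‖ξ (x, y)‖ₑ ^ 2 ∂ν < ⊤ → ∀ᵐ y ∂ν, F x y = ξ (x, y) := by
    intro x hx
    have : F x = (hL x hx).toLp _ := by simp only [F, hx, dif_pos]
    rw [this]; exact (hL x hx).coeFn_toLp
  refine ⟨F, ?_, ?_⟩
  · apply meas_of_dist
    intro c
    have hms : MeasurableSet {x | ∫⁻ y, ‖ξ (x, y)‖ₑ ^ 2 ∂ν < ⊤} := measurableSet_lt hm0 measurable_const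
    have key : ∀ x, dist (F x) c = if ∫⁻ y, ‖ξ (x, y)‖ₑ ^ 2 ∂ν < ⊤ then
        Real.sqrt (∫⁻ y, ‖ξ (x, y) - c y‖ₑ ^ 2 ∂ν).toReal else dist 0 c := by
      intro x
      split_ifs with h
      · have h1 : ∫⁻ y, ‖ξ (x, y) - c y‖ₑ ^ 2 ∂ν = ‖F x - c‖ₑ ^ 2 := by
          rw [← Lp_enorm_sq]
          apply lintegral_congr_ae
          filter_upwards [hF1 x h, Lp.coeFn_sub (F x) c] with y hy hy2
          rw [hy2, Pi.sub_apply, hy]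
        rw [h1, ENNReal.toReal_pow, toReal_enorm, Real.sqrt_sq (norm_nonneg _), dist_eq_norm]
      · simp only [F, h, dif_neg, not_false_iff]
    simp_rw [key]
    refine Measurable.ite hms ?_ measurable_const
    refine Measurable.sqrt (Measurable.ennreal_toReal ?_)
    refine Measurable.lintegral_prod_right' (f := fun p : X × Y => ‖ξ p - c p.2‖ₑ ^ 2) ?_
    exact ((hξ.sub ((Lp.stronglyMeasurable c).comp_measurable measurable_snd)).enorm.pow_const 2)
  · filter_upwards [hfin] with x hx using hF1 x hx

lemma slice (ξ : HH (Lp ℂ 2 (μ.prod ν))) : ∃ F : X → HH (Lp ℂ 2 ν), StronglyMeasurable F ∧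
    (∀ᵐ x ∂μ, ∀ᵐ y ∂ν, row (F x) y = row ξ (x, y)) ∧ ∫⁻ x, ‖F x‖ₑ ^ 2 ∂μ = ‖ξ‖ₑ ^ 2 := by
  classical
  choose F hF hF2 using fun n => slice1 (ξ n)
  have hr : ∀ᵐ x ∂μ, ∀ᵐ y ∂ν, ∀ n, row ξ (x, y) n = ξ n (x, y) :=
    Measure.ae_ae_of_ae_prod (row_ae ξ)
  have hm : Measurable fun x => ∑' n, ‖F n x‖ₑ ^ 2 := Measurable.tsum fun n => (hF n).enorm.pow_const 2
  have hrm : StronglyMeasurable (row ξ) := row_smeas ξ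
  have heq : ∀ᵐ x ∂μ, ∑' n, ‖F n x‖ₑ ^ 2 = ∫⁻ y, ‖row ξ (x, y)‖ₑ ^ 2 ∂ν := by
    filter_upwards [hr, ae_all_iff.2 hF2] with x hx hx2
    calc ∑' n, ‖F n x‖ₑ ^ 2 = ∑' n, ∫⁻ y, ‖F n x y‖ₑ ^ 2 ∂ν := tsum_congr fun n => (Lp_enorm_sq _).symm
      _ = ∫⁻ y, ∑' n, ‖F n x y‖ₑ ^ 2 ∂ν := (lintegral_tsum fun n =>
          ((Lp.stronglyMeasurable (F n x)).enorm.pow_const 2).aemeasurable).symm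
      _ = _ := by
          apply lintegral_congr_ae
          filter_upwards [hx, ae_all_iff.2 hx2] with y hy hy2
          rw [HH_enorm_sq]
          exact tsum_congr fun n => by rw [hy, hy2]
  have htot : ∫⁻ x, ∑' n, ‖F n x‖ₑ ^ 2 ∂μ = ‖ξ‖ₑ ^ 2 := by
    rw [lintegral_congr_ae heq, ← lintegral_prod _ ((hrm.enorm.pow_const 2).aemeasurable), row_lint]
  have hfin : ∀ᵐ x ∂μ, ∑' n, ‖F n x‖ₑ ^ 2 < ⊤ :=
    ae_lt_top hm (by rw [htot]; exact ENNReal.pow_ne_top enorm_ne_top)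
  let G : X → HH (Lp ℂ 2 ν) := fun x => if h : ∑' n, ‖F n x‖ₑ ^ 2 < ⊤ then
    mkH (fun n => F n x) (summable_of_enorm _ h.ne) else 0
  have hG : ∀ x, ∑' n, ‖F n x‖ₑ ^ 2 < ⊤ → ∀ n, G x n = F n x := by
    intro x hx n
    simp only [G, hx, dif_pos, mkH_apply]
  refine ⟨G, ?_, ?_, ?_⟩
  · apply HH_smeas
    intro n
    have : (fun x => G x n) = {x | ∑' n, ‖F n x‖ₑ ^ 2 < ⊤}.indicator (F n) := by
      ext1 x
      by_cases h : ∑' n, ‖F n x‖ₑ ^ 2 < ⊤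
      · rw [hG x h, indicator_of_mem]; exact h
      · rw [indicator_of_notMem (by exact h)]
        simp only [G, h, dif_neg, not_false_iff]; rfl
    rw [this]
    exact (hF n).indicator (measurableSet_lt hm measurable_const)
  · filter_upwards [hfin, hr, ae_all_iff.2 hF2] with x h1 hx hx2
    filter_upwards [hx, ae_all_iff.2 hx2, row_ae (G x)] with y hy hy2 hy3
    refine lp.ext (funext fun n => ?_)
    rw [hy3, hG x h1, hy2, hy]
  · rw [← htot]
    apply lintegral_congr_ae
    filter_upwards [hfin] with x hx
    rw [HH_enorm_sq]
    exact tsum_congr fun n => by rw [hG x hx]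

end slice


lemma cpt_exists {X Z : Type*} [MeasurableSpace X] [StandardBorelSpace X] {μ : Measure X} [SigmaFinite μ]
    [TopologicalSpace Z] [SecondCountableTopology Z] [MeasurableSpace Z] [BorelSpace Z]
    (Φ : X → Z) (hΦ : Measurable Φ) (h : X → ENNReal) (hh : ∫⁻ x, h x ∂μ ≠ ⊤)
    {P : X → Prop} (hP : ∀ᵐ x ∂μ, P x) {ε : ENNReal} (hε : ε ≠ 0) :
    ∃ K, MeasurableSet K ∧ μ K < ⊤ ∧ (∀ x ∈ K, P x) ∧ IsCompact (Φ '' K) ∧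
      ∫⁻ x in Kᶜ, h x ∂μ ≤ ε := by
  obtain ⟨t, ht⟩ := ‹StandardBorelSpace X›.polish
  obtain ⟨hb, hpol⟩ := ht
  obtain ⟨t', ht', hc, hpol'⟩ := hΦ.exists_continuous
  have hb' : @BorelSpace X t' _ := by
    refine @BorelSpace.mk X t' _ ?_
    rw [hb.measurable_eq]
    exact (borel_eq_borel_of_le hpol' hpol ht').symm
  clear hb hpol ht'
  letI := t'
  let m := μ.withDensity h
  haveI : IsFiniteMeasure m := isFiniteMeasure_withDensity hh
  let N := toMeasurable μ {x | ¬ P x}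
  have hN : μ N = 0 := by rw [measure_toMeasurable]; exact hP
  have hmN : m N = 0 := withDensity_absolutelyContinuous μ h hN
  have hε2 : ε / 2 ≠ 0 := by simp [hε]
  obtain ⟨k, hk⟩ : ∃ k, m (spanningSets μ k)ᶜ < ε / 2 := by
    have h1 := tendsto_measure_iInter_atTop (μ := m) (s := fun k => (spanningSets μ k)ᶜ)
      (fun k => (measurableSet_spanningSets μ k).compl.nullMeasurableSet)
      (fun i j hij => compl_subset_compl.2 (monotone_spanningSets μ hij)) ⟨0, measure_ne_top _ _⟩
    rw [← compl_iUnion, iUnion_spanningSets, compl_univ, measure_empty] at h1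
    exact (h1.eventually_lt_const (pos_iff_ne_zero.2 hε2)).exists
  let S := spanningSets μ k \ N
  have hS : MeasurableSet S := (measurableSet_spanningSets μ k).diff (measurableSet_toMeasurable _ _)
  obtain ⟨K, hKS, hK, hKm⟩ := hS.exists_isCompact_lt_add (μ := m) (measure_ne_top _ _) hε2
  refine ⟨K, hK.measurableSet, ?_, ?_, hK.image hc, ?_⟩
  · exact (measure_mono (hKS.trans diff_subset)).trans_lt (measure_spanningSets_lt_top μ k)
  · intro x hx
    by_contra hx2
    exact (hKS hx).2 (subset_toMeasurable _ _ hx2)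
  · rw [← withDensity_apply _ hK.measurableSet.compl]
    have h1 : Kᶜ ⊆ (S \ K) ∪ ((spanningSets μ k)ᶜ ∪ N) := by
      intro x hx
      simp only [S, mem_union, mem_diff, mem_compl_iff] at *
      tauto
    have h2 : m (S \ K) ≤ ε / 2 := by
      rw [measure_sdiff hKS hK.measurableSet.nullMeasurableSet (measure_ne_top _ _)]
      exact tsub_le_iff_left.2 hKm.le
    calc m Kᶜ ≤ m (S \ K) + (m (spanningSets μ k)ᶜ + m N) :=
          (measure_mono h1).trans ((measure_union_le _ _).trans (add_le_add le_rfl (measure_union_le _ _)))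
      _ ≤ ε / 2 + (ε / 2 + 0) := by gcongr; exact hmN.le
      _ = ε := by rw [add_zero, ENNReal.add_halves]

section tens
variable {X Y : Type*} [MeasurableSpace X] [MeasurableSpace Y]
  {μ : Measure X} {ν : Measure Y} [SigmaFinite μ] [SigmaFinite ν]

lemma tens_lint (g : Lp ℂ 2 μ) (f : Lp ℂ 2 ν) :
    ∫⁻ p, ‖g p.1 * f p.2‖ₑ ^ 2 ∂(μ.prod ν) = (‖g‖ₑ * ‖f‖ₑ) ^ 2 := by
  simp_rw [enorm_mul, mul_pow]
  rw [lintegral_prod_mul ((Lp.stronglyMeasurable g).enorm.pow_const 2).aemeasurable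
    ((Lp.stronglyMeasurable f).enorm.pow_const 2).aemeasurable, Lp_enorm_sq, Lp_enorm_sq]

lemma tens_memLp (g : Lp ℂ 2 μ) (f : Lp ℂ 2 ν) :
    MemLp (fun p : X × Y => g p.1 * f p.2) 2 (μ.prod ν) := by
  refine ⟨?_, ?_⟩
  · exact (((Lp.stronglyMeasurable g).comp_measurable measurable_fst).mul
      ((Lp.stronglyMeasurable f).comp_measurable measurable_snd)).aestronglyMeasurable
  · have := tens_lint g f
    rw [← eLp_sq] at this
    by_contra hc
    rw [not_lt, top_le_iff] at hc
    rw [hc] at this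
    exact ENNReal.pow_ne_top (ENNReal.mul_ne_top enorm_ne_top enorm_ne_top) (this.symm.trans (by simp))

lemma ae_fst {P : X → Prop} (h : ∀ᵐ x ∂μ, P x) : ∀ᵐ p ∂(μ.prod ν), P p.1 :=
  Measure.quasiMeasurePreserving_fst.ae h
lemma ae_snd {P : Y → Prop} (h : ∀ᵐ x ∂ν, P x) : ∀ᵐ p ∂(μ.prod ν), P p.2 :=
  Measure.quasiMeasurePreserving_snd.ae h

def tens (ν : Measure Y) [SigmaFinite ν] (g : Lp ℂ 2 μ) : Lp ℂ 2 ν →L[ℂ] Lp ℂ 2 (μ.prod ν) :=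
  LinearMap.mkContinuous
    { toFun := fun f => (tens_memLp g f).toLp _
      map_add' := by
        intro f f'
        apply Lp.ext
        filter_upwards [(tens_memLp g f).coeFn_toLp, (tens_memLp g f').coeFn_toLp,
          (tens_memLp g (f + f')).coeFn_toLp, Lp.coeFn_add ((tens_memLp g f).toLp _) ((tens_memLp g f').toLp _),
          ae_snd (μ := μ) (Lp.coeFn_add f f')] with p h1 h2 h3 h4 h5
        rw [h3, h4, Pi.add_apply, h1, h2, h5, Pi.add_apply, mul_add]
      map_smul' := by
        intro c f
        apply Lp.ext
        filter_upwards [(tens_memLp g f).coeFn_toLp,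
          (tens_memLp g (c • f)).coeFn_toLp, Lp.coeFn_smul c ((tens_memLp g f).toLp _),
          ae_snd (μ := μ) (Lp.coeFn_smul c f)] with p h1 h3 h4 h5
        rw [h3, RingHom.id_apply, h4, Pi.smul_apply, h1, h5, Pi.smul_apply, smul_eq_mul, smul_eq_mul]; ring }
    ‖g‖ (by
      intro f
      simp only [LinearMap.coe_mk, AddHom.coe_mk]
      have h1 : ‖(tens_memLp g f).toLp _‖ₑ ^ 2 = (‖g‖ₑ * ‖f‖ₑ) ^ 2 := by
        rw [← Lp_enorm_sq, ← tens_lint]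
        apply lintegral_congr_ae
        filter_upwards [(tens_memLp g f).coeFn_toLp] with p h1
        rw [h1]
      have h2 := congrArg ENNReal.toReal h1
      simp only [ENNReal.toReal_pow, ENNReal.toReal_mul, toReal_enorm] at h2
      exact le_of_eq ((pow_left_inj₀ (norm_nonneg _) (by positivity) two_ne_zero).1 h2))

lemma tens_ae (g : Lp ℂ 2 μ) (f : Lp ℂ 2 ν) :
    ∀ᵐ p ∂(μ.prod ν), tens ν g f p = g p.1 * f p.2 := (tens_memLp g f).coeFn_toLp

lemma tens_norm (g : Lp ℂ 2 μ) : ‖tens ν g‖ ≤ ‖g‖ := LinearMap.mkContinuous_norm_le _ (norm_nonneg _) _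

/-- slice relation -/
def Sl (ξ : HH (Lp ℂ 2 (μ.prod ν))) (F : X → HH (Lp ℂ 2 ν)) : Prop :=
  ∀ᵐ x ∂μ, ∀ᵐ y ∂ν, row (F x) y = row ξ (x, y)

lemma Sl_sub {ξ ξ' : HH (Lp ℂ 2 (μ.prod ν))} {F F' : X → HH (Lp ℂ 2 ν)} (h : Sl ξ F) (h' : Sl ξ' F') :
    Sl (ξ - ξ') (fun x => F x - F' x) := by
  filter_upwards [h, h', Measure.ae_ae_of_ae_prod (row_sub ξ ξ')] with x h1 h2 h3
  filter_upwards [h1, h2, h3, row_sub (F x) (F' x)] with y h4 h5 h6 h7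
  rw [h7, h6, h4, h5]

lemma Sl_add {ξ ξ' : HH (Lp ℂ 2 (μ.prod ν))} {F F' : X → HH (Lp ℂ 2 ν)} (h : Sl ξ F) (h' : Sl ξ' F') :
    Sl (ξ + ξ') (fun x => F x + F' x) := by
  filter_upwards [h, h', Measure.ae_ae_of_ae_prod (row_add ξ ξ')] with x h1 h2 h3
  filter_upwards [h1, h2, h3, row_add (F x) (F' x)] with y h4 h5 h6 h7
  rw [h7, h6, h4, h5]

lemma row_zero {X : Type*} [MeasurableSpace X] {μ : Measure X} :
    ∀ᵐ x ∂μ, row (0 : HH (Lp ℂ 2 μ)) x = 0 := by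
  filter_upwards [row_smul 0 (0 : HH (Lp ℂ 2 μ))] with x h
  simpa using h

lemma Sl_zero : Sl (0 : HH (Lp ℂ 2 (μ.prod ν))) (fun _ => 0) := by
  filter_upwards [Measure.ae_ae_of_ae_prod (row_zero (μ := μ.prod ν))] with x h1
  filter_upwards [h1, row_zero (μ := ν)] with y h2 h3
  rw [h2, h3]

lemma Sl_sum {ι : Type*} (s : Finset ι) {ξ : ι → HH (Lp ℂ 2 (μ.prod ν))} {F : ι → X → HH (Lp ℂ 2 ν)}
    (h : ∀ i, Sl (ξ i) (F i)) : Sl (∑ i ∈ s, ξ i) (fun x => ∑ i ∈ s, F i x) := by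
  classical
  induction s using Finset.induction_on with
  | empty => simpa using Sl_zero
  | insert a s ha ih =>
    simp_rw [Finset.sum_insert ha]
    exact Sl_add (h a) ih

lemma Sl_tens (g : Lp ℂ 2 μ) (c : HH (Lp ℂ 2 ν)) : Sl (amp (tens ν g) c) (fun x => g x • c) := by
  have h0 : ∀ᵐ p ∂(μ.prod ν), ∀ n, tens ν g (c n) p = g p.1 * (c n) p.2 :=
    ae_all_iff.2 fun n => tens_ae g (c n)
  filter_upwards [Measure.ae_ae_of_ae_prod (row_ae (amp (tens ν g) c)), Measure.ae_ae_of_ae_prod h0] with x h1 h2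
  filter_upwards [h1, h2, row_smul (g x) c, row_ae c] with y h3 h4 h5 h6
  refine lp.ext (funext fun n => ?_)
  rw [h5, h3, amp_apply, h4, lp.coeFn_smul, Pi.smul_apply, h6, smul_eq_mul]

lemma Sl_pj {A : Set X} (hA : MeasurableSet A) {ξ : HH (Lp ℂ 2 (μ.prod ν))} {F : X → HH (Lp ℂ 2 ν)}
    (h : Sl ξ F) : Sl (amp (pj (μ.prod ν) (A ×ˢ univ)) ξ) (A.indicator F) := by
  filter_upwards [h, Measure.ae_ae_of_ae_prod (row_pj (hA.prod MeasurableSet.univ) ξ)] with x h1 h2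
  filter_upwards [h1, h2, row_zero (μ := ν)] with y h3 h4 h5
  rw [h4]
  by_cases hx : x ∈ A <;> simp [indicator, hx, h3, h5]

lemma Sl_norm {ξ : HH (Lp ℂ 2 (μ.prod ν))} {F : X → HH (Lp ℂ 2 ν)} (h : Sl ξ F) :
    ‖ξ‖ₑ ^ 2 = ∫⁻ x, ‖F x‖ₑ ^ 2 ∂μ := by
  rw [← row_lint, lintegral_prod _ ((row_smeas ξ).enorm.pow_const 2).aemeasurable]
  apply lintegral_congr_ae
  filter_upwards [h] with x hx
  rw [← row_lint]
  apply lintegral_congr_ae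
  filter_upwards [hx] with y hy
  rw [hy]
end tens

section
variable {X₁ X₂ Y₁ Y₂ : Type*} [MeasurableSpace X₁] [MeasurableSpace X₂]
  [MeasurableSpace Y₁] [MeasurableSpace Y₂]
  {μ₁ : Measure X₁} {μ₂ : Measure X₂} {ν₁ : Measure Y₁} {ν₂ : Measure Y₂}
  [SigmaFinite μ₁] [SigmaFinite μ₂] [SigmaFinite ν₁] [SigmaFinite ν₂]

lemma mae_snd {P : Y₁ × Y₂ → Prop} (h : ∀ᶠ p in mae ν₁ ν₂, P p) :
    ∀ᶠ q in mae (μ₁.prod ν₁) (μ₂.prod ν₂), P (q.1.2, q.2.2) :=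
  (Filter.Tendsto.prodMap (Measure.quasiMeasurePreserving_snd (μ := μ₁) (ν := ν₁)).tendsto_ae
    (Measure.quasiMeasurePreserving_snd (μ := μ₂) (ν := ν₂)).tendsto_ae).eventually h

lemma mae_fst {P : X₁ × X₂ → Prop} (h : ∀ᶠ p in mae μ₁ μ₂, P p) :
    ∀ᶠ q in mae (μ₁.prod ν₁) (μ₂.prod ν₂), P (q.1.1, q.2.1) :=
  (Filter.Tendsto.prodMap (Measure.quasiMeasurePreserving_fst (μ := μ₁) (ν := ν₁)).tendsto_ae
    (Measure.quasiMeasurePreserving_fst (μ := μ₂) (ν := ν₂)).tendsto_ae).eventually h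

/-- slice of an operator -/
def slc (T : Lp ℂ 2 (μ₁.prod ν₁) →L[ℂ] Lp ℂ 2 (μ₂.prod ν₂)) (g : Lp ℂ 2 μ₁) (h : Lp ℂ 2 μ₂) :
    Lp ℂ 2 ν₁ →L[ℂ] Lp ℂ 2 ν₂ := ContinuousLinearMap.adjoint (tens ν₂ h) ∘L T ∘L tens ν₁ g

lemma slc_pr (T : Lp ℂ 2 (μ₁.prod ν₁) →L[ℂ] Lp ℂ 2 (μ₂.prod ν₂)) (g : Lp ℂ 2 μ₁) (h : Lp ℂ 2 μ₂)
    (c : HH (Lp ℂ 2 ν₁)) (d : HH (Lp ℂ 2 ν₂)) :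
    pr (slc T g h) c d = pr T (amp (tens ν₁ g) c) (amp (tens ν₂ h) d) :=
  pr_comp T _ _ _ (fun x y => ContinuousLinearMap.adjoint_inner_right _ _ _) c d

lemma slc_norm (T : Lp ℂ 2 (μ₁.prod ν₁) →L[ℂ] Lp ℂ 2 (μ₂.prod ν₂)) (g : Lp ℂ 2 μ₁) (h : Lp ℂ 2 μ₂) :
    ‖slc T g h‖ ≤ ‖T‖ * (‖g‖ * ‖h‖) := by
  unfold slc
  calc _ ≤ ‖ContinuousLinearMap.adjoint (tens ν₂ h)‖ * ‖T ∘L tens ν₁ g‖ := ContinuousLinearMap.opNorm_comp_le _ _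
    _ ≤ ‖h‖ * (‖T‖ * ‖g‖) := by
      refine mul_le_mul ?_ ?_ (norm_nonneg _) (norm_nonneg _)
      · rw [LinearIsometryEquiv.norm_map]; exact tens_norm h
      · exact (ContinuousLinearMap.opNorm_comp_le _ _).trans
          (mul_le_mul_of_nonneg_left (tens_norm g) (norm_nonneg _))
    _ = _ := by ring

lemma slc_Mmax {T : Lp ℂ 2 (μ₁.prod ν₁) →L[ℂ] Lp ℂ 2 (μ₂.prod ν₂)} (g : Lp ℂ 2 μ₁) (h : Lp ℂ 2 μ₂)
    {E : Set ((X₁ × Y₁) × (X₂ × Y₂))} {Λ : Set (Y₁ × Y₂)} (hE : ∀ q ∈ E, (q.1.2, q.2.2) ∈ Λ)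
    (hT : T ∈ Mmax (μ₁.prod ν₁) (μ₂.prod ν₂) E) : slc T g h ∈ Mmax ν₁ ν₂ Λ := by
  rw [mem_Mmax] at hT ⊢
  intro α β hα hβ hd f k hf hk
  have := hT (univ ×ˢ α) (univ ×ˢ β) (MeasurableSet.univ.prod hα) (MeasurableSet.univ.prod hβ) ?_
    (tens ν₁ g f) (tens ν₂ h k) ?_ ?_
  · unfold slc
    rw [ContinuousLinearMap.comp_apply, ContinuousLinearMap.adjoint_inner_right]; exact this
  · filter_upwards [mae_snd (μ₁ := μ₁) (μ₂ := μ₂) hd] with q hq h1 h2 h3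
    exact hq h1.2 h2.2 (hE q h3)
  · filter_upwards [tens_ae g f, ae_snd (μ := μ₁) hf] with p h1 h2 h3
    rw [h1, h2 (fun h' => h3 ⟨trivial, h'⟩), mul_zero]
  · filter_upwards [tens_ae h k, ae_snd (μ := μ₂) hk] with p h1 h2 h3
    rw [h1, h2 (fun h' => h3 ⟨trivial, h'⟩), mul_zero]

lemma mae_fub {P : (X₁ × Y₁) × (X₂ × Y₂) → Prop} (h : ∀ᶠ q in mae (μ₁.prod ν₁) (μ₂.prod ν₂), P q) :
    ∃ (p₁ : X₁ → Prop) (p₂ : X₂ → Prop), (∀ᵐ x ∂μ₁, p₁ x) ∧ (∀ᵐ x ∂μ₂, p₂ x) ∧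
      ∀ x₁ x₂, p₁ x₁ → p₂ x₂ → ∀ᶠ y in mae ν₁ ν₂, P ((x₁, y.1), (x₂, y.2)) := by
  obtain ⟨q₁, h1, q₂, h2, h3⟩ := Filter.eventually_prod_iff.1 h
  refine ⟨fun x => ∀ᵐ y ∂ν₁, q₁ (x, y), fun x => ∀ᵐ y ∂ν₂, q₂ (x, y),
    Measure.ae_ae_of_ae_prod h1, Measure.ae_ae_of_ae_prod h2, ?_⟩
  intro x₁ x₂ h4 h5
  filter_upwards [mae_intro h4 h5] with y hy
  exact h3 hy.1 hy.2
end


section side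

def blk {X : Type*} (f : X → ℕ → Bool) {n : ℕ} (p : Fin n → Bool) : Set X := {x | ∀ m : Fin n, f x m = p m}

lemma blk_disj {X : Type*} (f : X → ℕ → Bool) {n : ℕ} : Pairwise (Function.onFun Disjoint (blk f (n := n))) := by
  intro p p' hp
  refine disjoint_left.2 fun x hx hx' => hp (funext fun m => (hx m).symm.trans (hx' m))

variable {X Y : Type*} [MeasurableSpace X] [MeasurableSpace Y]
  {μ : Measure X} {ν : Measure Y}

lemma blk_meas {f : X → ℕ → Bool} (hf : Measurable f) {n : ℕ} (p : Fin n → Bool) : MeasurableSet (blk f p) := by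
  have : blk f p = ⋂ m : Fin n, (fun x => f x m) ⁻¹' {p m} := by ext x; simp [blk]
  rw [this]
  exact MeasurableSet.iInter fun m => ((measurable_pi_apply _).comp hf) (measurableSet_singleton _)

lemma sum_blk {f : X → ℕ → Bool} (hf : Measurable f) (n : ℕ) (e : X → ENNReal) :
    ∑ p : Fin n → Bool, ∫⁻ x in blk f p, e x ∂μ ≤ ∫⁻ x, e x ∂μ := by
  have := sum_measure_le_measure_univ (μ := μ.withDensity e) (s := Finset.univ) (t := blk f (n := n))
    (fun p _ => (blk_meas hf p).nullMeasurableSet) (fun p _ p' _ h => (blk_disj f h).aedisjoint)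
  rw [withDensity_apply _ MeasurableSet.univ, Measure.restrict_univ] at this
  refine le_trans (le_of_eq (Finset.sum_congr rfl fun p _ => ?_)) this
  rw [withDensity_apply _ (blk_meas hf p)]

lemma sum_toReal {ι : Type*} [Fintype ι] {E : Type*} [NormedAddCommGroup E] (v : ι → E) {b : ENNReal} {c : ℝ}
    (hc : 0 ≤ c) (h : ∑ i, ‖v i‖ₑ ^ 2 ≤ b) (hb : b ≤ ENNReal.ofReal c) : ∑ i, ‖v i‖ ^ 2 ≤ c := by
  have h1 : ENNReal.ofReal (∑ i, ‖v i‖ ^ 2) ≤ ENNReal.ofReal c := by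
    rw [ENNReal.ofReal_sum_of_nonneg fun i _ => by positivity]
    refine le_trans (le_of_eq (Finset.sum_congr rfl fun i _ => ?_)) (h.trans hb)
    rw [ENNReal.ofReal_pow (norm_nonneg _), ofReal_norm_eq_enorm]
  exact (ENNReal.ofReal_le_ofReal_iff hc).1 h1

variable [SigmaFinite μ] [SigmaFinite ν]

lemma side_pj {f : X → ℕ → Bool} (hf : Measurable f) (n : ℕ) (ξ : HH (Lp ℂ 2 (μ.prod ν)))
    {F : X → HH (Lp ℂ 2 ν)} (hF : Sl ξ F) :
    ∑ p : Fin n → Bool, ‖amp (pj (μ.prod ν) (blk f p ×ˢ univ)) ξ‖ ^ 2 ≤ ‖ξ‖ ^ 2 := by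
  refine sum_toReal _ (by positivity) (b := ‖ξ‖ₑ ^ 2) ?_ (le_of_eq ?_)
  · rw [Sl_norm hF]
    refine le_trans (le_of_eq (Finset.sum_congr rfl fun p _ => ?_)) (sum_blk hf n _)
    rw [Sl_norm (Sl_pj (blk_meas hf p) hF), ← lintegral_indicator (blk_meas hf p)]
    refine lintegral_congr fun x => ?_
    by_cases hx : x ∈ blk f p <;> simp [hx]
  · rw [ENNReal.ofReal_pow (norm_nonneg _), ofReal_norm_eq_enorm]

variable [StandardBorelSpace X] [StandardBorelSpace Y]

lemma side {f : X → ℕ → Bool} (hf : Measurable f) (ξ : HH (Lp ℂ 2 (μ.prod ν)))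
    {F : X → HH (Lp ℂ 2 ν)} (hF : Sl ξ F) (hFm : StronglyMeasurable F) {P : X → Prop}
    (hP : ∀ᵐ x ∂μ, P x) {θ : ℝ} (hθ : 0 < θ) :
    ∃ (K : Set X) (N : ℕ) (m : ℝ), (∀ x ∈ K, P x) ∧ IsCompact ((fun x => (f x, F x)) '' K) ∧ 0 ≤ m ∧
      ∀ n, ∃ (g : (Fin n → Bool) → Fin N → Lp ℂ 2 μ) (c : (Fin n → Bool) → Fin N → HH (Lp ℂ 2 ν)),
        (∀ i, ∑ p, ‖g p i‖ ^ 2 ≤ m) ∧ (∀ p i, c p i = 0 ∨ ∃ x ∈ K, x ∈ blk f p ∧ c p i = F x) ∧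
        ∑ p, ‖amp (pj (μ.prod ν) (blk f p ×ˢ univ)) ξ - ∑ i, amp (tens ν (g p i)) (c p i)‖ ^ 2 ≤ θ ^ 2 := by
  classical
  borelize (HH (Lp ℂ 2 ν))
  have hΦ : Measurable fun x => (f x, F x) := hf.prodMk hFm.measurable
  have hfin : ∫⁻ x, ‖F x‖ₑ ^ 2 ∂μ ≠ ⊤ := by rw [← Sl_norm hF]; exact ENNReal.pow_ne_top enorm_ne_top
  obtain ⟨K, hK, hμK, hKP, hKc, htail⟩ := cpt_exists (μ := μ) _ hΦ (fun x => ‖F x‖ₑ ^ 2) hfin hP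
    (ε := ENNReal.ofReal (θ ^ 2 / 2)) (by rw [ne_eq, ENNReal.ofReal_eq_zero, not_le]; positivity)
  set M := (μ K).toReal with hM
  have hM0 : 0 ≤ M := ENNReal.toReal_nonneg
  let δ := θ / (4 * (M + 1))
  have hδ : 0 < δ := by positivity
  have hδ2 : (2 * δ) ^ 2 * M ≤ θ ^ 2 / 2 := by
    have : (2 * δ) ^ 2 * M = θ ^ 2 * (M / (4 * (M + 1) ^ 2)) := by simp only [δ]; field_simp; ring
    rw [this]
    have h2 : M / (4 * (M + 1) ^ 2) ≤ 1 / 2 := by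
      rw [div_le_div_iff₀ (by positivity) (by norm_num)]; nlinarith
    nlinarith [sq_nonneg θ]
  have hFc : IsCompact (F '' K) := by
    have := hKc.image continuous_snd
    rwa [image_image] at this
  obtain ⟨t, -, htf, htc⟩ := hFc.finite_cover_balls hδ
  obtain ⟨N, z, hz⟩ : ∃ (N : ℕ) (z : Fin N → HH (Lp ℂ 2 ν)), range z = t := by
    obtain ⟨N, e, he⟩ := htf.fin_embedding
    exact ⟨N, e, he⟩
  let A0 : Fin N → Set X := fun i => K ∩ F ⁻¹' (Metric.ball (z i) δ)
  have hA0 : ∀ i, MeasurableSet (A0 i) := fun i => hK.inter (hFm.measurable measurableSet_ball)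
  let A := disjointed A0
  have hA : ∀ i, MeasurableSet (A i) := fun i =>
    disjointedRec (p := fun s => MeasurableSet s) (fun t i h => h.diff (hA0 i)) (hA0 i)
  have hAd : Pairwise (Function.onFun Disjoint A) := disjoint_disjointed A0
  have hAs : ∀ i, A i ⊆ A0 i := fun i => disjointed_subset A0 i
  have hAK : ∀ x ∈ K, ∃ i, x ∈ A i := by
    intro x hx
    have h1 : F x ∈ ⋃ x ∈ t, Metric.ball x δ := htc (mem_image_of_mem _ hx)
    simp only [mem_iUnion] at h1
    obtain ⟨w, hw, hw2⟩ := h1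
    rw [← hz] at hw
    obtain ⟨i, rfl⟩ := hw
    have h2 : x ∈ ⋃ i, A i := by
      have : ⋃ i, A i = ⋃ i, A0 i := iUnion_disjointed
      rw [this]; exact mem_iUnion.2 ⟨i, hx, hw2⟩
    exact mem_iUnion.1 h2
  refine ⟨K, N, M, hKP, hKc, hM0, fun n => ?_⟩
  have hmb : ∀ (p : Fin n → Bool) i, MeasurableSet (blk f p ∩ A i) := fun p i => (blk_meas hf p).inter (hA i)
  have hsub : ∀ (p : Fin n → Bool) i, blk f p ∩ A i ⊆ K := fun p i x hx => (hAs i hx.2).1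
  have hfm : ∀ (p : Fin n → Bool) i, μ (blk f p ∩ A i) ≠ ⊤ := fun p i =>
    ((measure_mono (hsub p i)).trans_lt hμK).ne
  let g : (Fin n → Bool) → Fin N → Lp ℂ 2 μ := fun p i => indicatorConstLp 2 (hmb p i) (hfm p i) 1
  have hg : ∀ p i, ∀ᵐ x ∂μ, g p i x = (blk f p ∩ A i).indicator (fun _ => (1:ℂ)) x :=
    fun p i => indicatorConstLp_coeFn
  let c : (Fin n → Bool) → Fin N → HH (Lp ℂ 2 ν) := fun p i =>
    if h : (blk f p ∩ A i).Nonempty then F h.some else 0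
  have hc : ∀ p i x, x ∈ blk f p → x ∈ A i → ‖F x - c p i‖ ≤ 2 * δ := by
    intro p i x h1 h2
    have hne : (blk f p ∩ A i).Nonempty := ⟨x, h1, h2⟩
    simp only [c, hne, dif_pos]
    have h3 := (hAs i hne.some_mem.2).2
    have h4 := (hAs i h2).2
    rw [mem_preimage, Metric.mem_ball] at h3 h4
    rw [← dist_eq_norm]
    have := dist_triangle_right (F x) (F hne.some) (z i)
    linarith
  refine ⟨g, c, ?_, ?_, ?_⟩
  · intro i
    refine sum_toReal _ hM0 (b := μ K) ?_ (by rw [hM, ENNReal.ofReal_toReal hμK.ne])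
    have h1 : ∀ p, ‖g p i‖ₑ ^ 2 = ∫⁻ x in blk f p, (A i).indicator (fun _ => 1) x ∂μ := by
      intro p
      rw [← Lp_enorm_sq, ← lintegral_indicator (blk_meas hf p)]
      apply lintegral_congr_ae
      filter_upwards [hg p i] with x hx
      rw [hx]
      by_cases h1 : x ∈ blk f p <;> by_cases h2 : x ∈ A i <;> simp [indicator, h1, h2]
    simp_rw [h1]
    refine (sum_blk hf n _).trans ?_
    rw [lintegral_indicator_const (hA i), one_mul]
    exact measure_mono fun x hx => (hAs i hx).1
  · intro p i
    by_cases h : (blk f p ∩ A i).Nonempty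
    · right
      exact ⟨h.some, hsub p i h.some_mem, h.some_mem.1, by simp only [c, h, dif_pos]⟩
    · left; simp only [c, h, dif_neg, not_false_iff]
  · let e : X → ENNReal := fun x => K.indicator (fun _ => ENNReal.ofReal (2 * δ) ^ 2) x + Kᶜ.indicator (fun x => ‖F x‖ₑ ^ 2) x
    refine sum_toReal _ (by positivity) (b := ∫⁻ x, e x ∂μ) ?_ ?_
    · refine le_trans (Finset.sum_le_sum fun p _ => ?_) (sum_blk hf n e)
      rw [Sl_norm (Sl_sub (Sl_pj (blk_meas hf p) hF) (Sl_sum Finset.univ fun i => Sl_tens (g p i) (c p i))),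
        ← lintegral_indicator (blk_meas hf p)]
      apply lintegral_mono_ae
      filter_upwards [ae_all_iff.2 fun i => hg p i] with x hx
      simp_rw [hx]
      by_cases h1 : x ∈ blk f p
      · rw [indicator_of_mem h1, indicator_of_mem h1]
        by_cases h2 : x ∈ K
        · obtain ⟨i, hi⟩ := hAK x h2
          have h3 : ∑ j, (blk f p ∩ A j).indicator (fun _ => (1:ℂ)) x • c p j = c p i := by
            rw [Finset.sum_eq_single i]
            · rw [indicator_of_mem (show x ∈ blk f p ∩ A i from ⟨h1, hi⟩), one_smul]
            · intro j _ hj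
              rw [indicator_of_notMem, zero_smul]
              exact fun h => disjoint_left.1 (hAd hj) h.2 hi
            · simp
          rw [h3]
          refine le_trans ?_ le_self_add
          rw [indicator_of_mem h2, ← ofReal_norm_eq_enorm]
          gcongr
          exact hc p i x h1 hi
        · have h3 : ∑ j, (blk f p ∩ A j).indicator (fun _ => (1:ℂ)) x • c p j = 0 := by
            refine Finset.sum_eq_zero fun j _ => ?_
            rw [indicator_of_notMem, zero_smul]
            exact fun h => h2 (hsub p j h)
          rw [h3, sub_zero]
          refine le_trans (le_of_eq ?_) le_add_self
          rw [indicator_of_mem (show x ∈ Kᶜ from h2)]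
      · rw [indicator_of_notMem h1, indicator_of_notMem h1]
        have h3 : ∑ j, (blk f p ∩ A j).indicator (fun _ => (1:ℂ)) x • c p j = 0 := by
          refine Finset.sum_eq_zero fun j _ => ?_
          rw [indicator_of_notMem, zero_smul]
          exact fun h => h1 h.1
        rw [h3]; simp
    · simp only [e]
      rw [lintegral_add_left (measurable_const.indicator hK), lintegral_indicator_const hK,
        lintegral_indicator hK.compl]
      have h5 : ENNReal.ofReal (2 * δ) ^ 2 * μ K ≤ ENNReal.ofReal (θ ^ 2 / 2) := by
        rw [← ENNReal.ofReal_toReal hμK.ne, ← ENNReal.ofReal_pow (by positivity),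
          ← ENNReal.ofReal_mul (by positivity)]
        exact ENNReal.ofReal_le_ofReal hδ2
      calc _ ≤ ENNReal.ofReal (θ ^ 2 / 2) + ENNReal.ofReal (θ ^ 2 / 2) := add_le_add h5 htail
        _ = _ := by rw [← ENNReal.ofReal_add (by positivity) (by positivity), add_halves]
end side


lemma cpt_close {X₁ X₂ H K : Type*} [NormedAddCommGroup H] [InnerProductSpace ℂ H]
    [NormedAddCommGroup K] [InnerProductSpace ℂ K]
    {f : X₁ → ℕ → Bool} {g : X₂ → ℕ → Bool} {F : X₁ → HH H} {G : X₂ → HH K}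
    {K₁ : Set X₁} {K₂ : Set X₂} (h1 : IsCompact ((fun x => (f x, F x)) '' K₁))
    (h2 : IsCompact ((fun x => (g x, G x)) '' K₂)) (U : Set (H →L[ℂ] K))
    (h : ∀ x₁ ∈ K₁, ∀ x₂ ∈ K₂, f x₁ = g x₂ → ∀ M ∈ U, pr M (F x₁) (G x₂) = 0) {ε : ℝ} (hε : 0 < ε) :
    ∃ n : ℕ, ∀ x₁ ∈ K₁, ∀ x₂ ∈ K₂, (∀ m < n, f x₁ m = g x₂ m) → ∀ M ∈ U, ‖pr M (F x₁) (G x₂)‖ ≤ ε * ‖M‖ := by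
  by_contra hcon
  push Not at hcon
  choose a ha b hb hab M hM hlt using hcon
  obtain ⟨⟨z₁, z₂⟩, hz, φ, hφ, ht⟩ := (h1.prod h2).tendsto_subseq
    (x := fun n => ((f (a n), F (a n)), (g (b n), G (b n))))
    (fun n => ⟨mem_image_of_mem _ (ha n), mem_image_of_mem _ (hb n)⟩)
  obtain ⟨⟨x₁, hx₁, rfl⟩, ⟨x₂, hx₂, rfl⟩⟩ := hz
  have tF : Filter.Tendsto (fun n => F (a (φ n))) Filter.atTop (nhds (F x₁)) :=
    ((continuous_snd.comp continuous_fst).tendsto _).comp ht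
  have tG : Filter.Tendsto (fun n => G (b (φ n))) Filter.atTop (nhds (G x₂)) :=
    ((continuous_snd.comp continuous_snd).tendsto _).comp ht
  have tf : Filter.Tendsto (fun n => f (a (φ n))) Filter.atTop (nhds (f x₁)) :=
    ((continuous_fst.comp continuous_fst).tendsto _).comp ht
  have tg : Filter.Tendsto (fun n => g (b (φ n))) Filter.atTop (nhds (g x₂)) :=
    ((continuous_fst.comp continuous_snd).tendsto _).comp ht
  have heq : f x₁ = g x₂ := by
    funext m
    have t1 := (tendsto_pi_nhds.1 tf) m
    have t2 := (tendsto_pi_nhds.1 tg) m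
    refine tendsto_nhds_unique_of_eventuallyEq t1 t2 ?_
    filter_upwards [Filter.eventually_gt_atTop m] with n hn
    exact hab (φ n) m (hn.trans_le (hφ.id_le n))
  have h0 := h x₁ hx₁ x₂ hx₂ heq
  have tlim : Filter.Tendsto (fun n => ‖F (a (φ n)) - F x₁‖ * ‖G (b (φ n))‖ + ‖F x₁‖ * ‖G (b (φ n)) - G x₂‖)
      Filter.atTop (nhds (0 * ‖G x₂‖ + ‖F x₁‖ * 0)) := by
    refine Filter.Tendsto.add (Filter.Tendsto.mul ?_ tG.norm) (Filter.Tendsto.mul tendsto_const_nhds ?_)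
    · exact tendsto_iff_norm_sub_tendsto_zero.1 tF
    · exact tendsto_iff_norm_sub_tendsto_zero.1 tG
  rw [zero_mul, mul_zero, add_zero] at tlim
  obtain ⟨n, hn⟩ := (tlim.eventually_lt_const hε).exists
  have e1 : pr (M (φ n)) (F (a (φ n))) (G (b (φ n))) =
      pr (M (φ n)) (F (a (φ n)) - F x₁) (G (b (φ n))) + pr (M (φ n)) (F x₁) (G (b (φ n)) - G x₂) := by
    rw [pr_sub_mid, pr_sub_right, h0 _ (hM _)]; ring
  have e2 := hlt (φ n)
  rw [e1] at e2
  have e3 := pr_le (M (φ n)) (F (a (φ n)) - F x₁) (G (b (φ n)))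
  have e4 := pr_le (M (φ n)) (F x₁) (G (b (φ n)) - G x₂)
  have e5 := norm_add_le (pr (M (φ n)) (F (a (φ n)) - F x₁) (G (b (φ n)))) (pr (M (φ n)) (F x₁) (G (b (φ n)) - G x₂))
  have e6 := mul_le_mul_of_nonneg_right hn.le (norm_nonneg (M (φ n)))
  nlinarith

lemma pr_sum_mid {H K ι : Type*} [NormedAddCommGroup H] [InnerProductSpace ℂ H]
    [NormedAddCommGroup K] [InnerProductSpace ℂ K] (T : H →L[ℂ] K) (s : Finset ι) (a : ι → HH H) (b : HH K) :
    pr T (∑ i ∈ s, a i) b = ∑ i ∈ s, pr T (a i) b := by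
  unfold pr; rw [map_sum, inner_sum]

lemma pr_sum_right {H K ι : Type*} [NormedAddCommGroup H] [InnerProductSpace ℂ H]
    [NormedAddCommGroup K] [InnerProductSpace ℂ K] (T : H →L[ℂ] K) (s : Finset ι) (a : HH H) (b : ι → HH K) :
    pr T a (∑ i ∈ s, b i) = ∑ i ∈ s, pr T a (b i) := by
  unfold pr; rw [sum_inner]

lemma cs_le {ι : Type*} [Fintype ι] (u v : ι → ℝ) {a b : ℝ} (ha : 0 ≤ a) (hb : 0 ≤ b)
    (hu : ∑ i, u i ^ 2 ≤ a ^ 2) (hv : ∑ i, v i ^ 2 ≤ b ^ 2) : ∑ i, u i * v i ≤ a * b := by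
  refine (Real.sum_mul_le_sqrt_mul_sqrt _ _ _).trans ?_
  exact mul_le_mul (Real.sqrt_le_iff.2 ⟨ha, hu⟩) (Real.sqrt_le_iff.2 ⟨hb, hv⟩) (Real.sqrt_nonneg _) ha

lemma fam_est {H K ι : Type*} [Fintype ι] [NormedAddCommGroup H] [InnerProductSpace ℂ H]
    [NormedAddCommGroup K] [InnerProductSpace ℂ K] (T : H →L[ℂ] K) (a a' : ι → HH H) (b b' : ι → HH K)
    {A B θ : ℝ} (hA : 0 ≤ A) (hB : 0 ≤ B) (hθ : 0 ≤ θ)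
    (ha : ∑ i, ‖a i‖ ^ 2 ≤ A ^ 2) (hb : ∑ i, ‖b i‖ ^ 2 ≤ B ^ 2)
    (ha' : ∑ i, ‖a i - a' i‖ ^ 2 ≤ θ ^ 2) (hb' : ∑ i, ‖b i - b' i‖ ^ 2 ≤ θ ^ 2) :
    ‖∑ i, pr T (a i) (b i)‖ ≤ ∑ i, ‖pr T (a' i) (b' i)‖ + ‖T‖ * (θ * B + A * θ + θ * θ) := by
  have h1 : ∀ i, ‖pr T (a i) (b i)‖ ≤ ‖pr T (a' i) (b' i)‖ +
      ‖T‖ * (‖a i - a' i‖ * ‖b i‖ + ‖a i‖ * ‖b i - b' i‖ + ‖a i - a' i‖ * ‖b i - b' i‖) := by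
    intro i
    have e : pr T (a i) (b i) = pr T (a' i) (b' i) + (pr T (a i - a' i) (b i) + pr T (a i) (b i - b' i)
        - pr T (a i - a' i) (b i - b' i)) := by
      simp only [pr_sub_mid, pr_sub_right]; ring
    rw [e]
    refine (norm_add_le _ _).trans (add_le_add le_rfl ((norm_sub_le _ _).trans
      ((add_le_add (norm_add_le _ _) le_rfl).trans ?_)))
    have e1 := pr_le T (a i - a' i) (b i)
    have e2 := pr_le T (a i) (b i - b' i)
    have e3 := pr_le T (a i - a' i) (b i - b' i)
    linarith
  refine (norm_sum_le _ _).trans ((Finset.sum_le_sum fun i _ => h1 i).trans ?_)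
  rw [Finset.sum_add_distrib, ← Finset.mul_sum, Finset.sum_add_distrib, Finset.sum_add_distrib]
  have c1 := cs_le _ _ hθ hB ha' hb
  have c2 := cs_le _ _ hA hθ ha hb'
  have c3 := cs_le _ _ hθ hθ ha' hb'
  gcongr

section
variable {X₁ X₂ Y₁ Y₂ : Type*} [MeasurableSpace X₁] [MeasurableSpace X₂]
  [MeasurableSpace Y₁] [MeasurableSpace Y₂]
  {μ₁ : Measure X₁} {μ₂ : Measure X₂} {ν₁ : Measure Y₁} {ν₂ : Measure Y₂}
  [SigmaFinite μ₁] [SigmaFinite μ₂] [SigmaFinite ν₁] [SigmaFinite ν₂]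
  [StandardBorelSpace X₁] [StandardBorelSpace X₂] [StandardBorelSpace Y₁] [StandardBorelSpace Y₂]

theorem core {T : Lp ℂ 2 (μ₁.prod ν₁) →L[ℂ] Lp ℂ 2 (μ₂.prod ν₂)}
    {E : Set ((X₁ × Y₁) × (X₂ × Y₂))} {Λ : Set (Y₁ × Y₂)} (hE : ∀ q ∈ E, (q.1.2, q.2.2) ∈ Λ)
    (hT : T ∈ Mmax (μ₁.prod ν₁) (μ₂.prod ν₂) E) (hS : Mmax ν₁ ν₂ Λ ⊆ An ν₁ ν₂ Λ)
    {f : X₁ → ℕ → Bool} {g : X₂ → ℕ → Bool} (hf : Measurable f) (hg : Measurable g)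
    (ξ : HH (Lp ℂ 2 (μ₁.prod ν₁))) (η : HH (Lp ℂ 2 (μ₂.prod ν₂)))
    (hv : ∀ᶠ q in mae (μ₁.prod ν₁) (μ₂.prod ν₂), f q.1.1 = g q.2.1 → (q.1.2, q.2.2) ∈ Λ → ker ξ η q = 0)
    (hd : ∀ n, pr T ξ η = ∑ p : Fin n → Bool,
      pr T (amp (pj (μ₁.prod ν₁) (blk f p ×ˢ univ)) ξ) (amp (pj (μ₂.prod ν₂) (blk g p ×ˢ univ)) η)) :
    pr T ξ η = 0 := by
  obtain ⟨F, hFm, hF, -⟩ := slice ξ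
  obtain ⟨G, hGm, hG, -⟩ := slice η
  obtain ⟨p₁, p₂, hp₁, hp₂, hfub⟩ := mae_fub hv
  have hex : ∀ x₁ x₂, (p₁ x₁ ∧ ∀ᵐ y ∂ν₁, row (F x₁) y = row ξ (x₁, y)) →
      (p₂ x₂ ∧ ∀ᵐ y ∂ν₂, row (G x₂) y = row η (x₂, y)) → f x₁ = g x₂ →
      ∀ M ∈ Mmax ν₁ ν₂ Λ, pr M (F x₁) (G x₂) = 0 := by
    intro x₁ x₂ h1 h2 hfg M hM
    refine hS hM _ _ ?_
    filter_upwards [hfub x₁ x₂ h1.1 h2.1, mae_intro h1.2 h2.2] with y hy hy2 hy3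
    have := hy hfg hy3
    unfold ker at this ⊢
    rw [hy2.1, hy2.2]; exact this
  have hθ : ∀ θ : ℝ, 0 < θ → ‖pr T ξ η‖ ≤ ‖T‖ * (θ * ‖η‖ + ‖ξ‖ * θ + θ * θ) := by
    intro θ hθ
    obtain ⟨K₁, N₁, m₁, hK₁, hc₁, hm₁, H₁⟩ := side hf ξ hF hFm (hp₁.and hF) hθ
    obtain ⟨K₂, N₂, m₂, hK₂, hc₂, hm₂, H₂⟩ := side hg η hG hGm (hp₂.and hG) hθ
    have hε : ∀ ε : ℝ, 0 < ε → ‖pr T ξ η‖ ≤ ε * (‖T‖ * (N₁ * N₂ * (√m₁ * √m₂)))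
        + ‖T‖ * (θ * ‖η‖ + ‖ξ‖ * θ + θ * θ) := by
      intro ε hε
      obtain ⟨n, hn⟩ := cpt_close hc₁ hc₂ (Mmax ν₁ ν₂ Λ)
        (fun x₁ h1 x₂ h2 => hex x₁ x₂ (hK₁ x₁ h1) (hK₂ x₂ h2)) hε
      obtain ⟨u, c, hu, hc, ha'⟩ := H₁ n
      obtain ⟨v, d, hv, hd', hb'⟩ := H₂ n
      rw [hd n]
      refine (fam_est T _ _ _ _ (norm_nonneg ξ) (norm_nonneg η) hθ.le (side_pj hf n ξ hF)
        (side_pj hg n η hG) ha' hb').trans (add_le_add ?_ le_rfl)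
      have hcd : ∀ p i j, ∀ M ∈ Mmax ν₁ ν₂ Λ, ‖pr M (c p i) (d p j)‖ ≤ ε * ‖M‖ := by
        intro p i j M hM
        rcases hc p i with h0 | ⟨x₁, hx₁, hb₁, h1⟩
        · rw [h0]; simp only [pr, map_zero, inner_zero_right, norm_zero]; positivity
        rcases hd' p j with h0 | ⟨x₂, hx₂, hb₂, h2⟩
        · rw [h0]; simp only [pr, inner_zero_left, norm_zero]; positivity
        rw [h1, h2]
        exact hn x₁ hx₁ x₂ hx₂ (fun m hm => (hb₁ ⟨m, hm⟩).trans (hb₂ ⟨m, hm⟩).symm) M hM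
      have hblock : ∀ p, ‖pr T (∑ i, amp (tens ν₁ (u p i)) (c p i)) (∑ j, amp (tens ν₂ (v p j)) (d p j))‖ ≤
          ∑ i, ∑ j, ε * ‖T‖ * (‖u p i‖ * ‖v p j‖) := by
        intro p
        rw [pr_sum_mid]
        refine (norm_sum_le _ _).trans (Finset.sum_le_sum fun i _ => ?_)
        rw [pr_sum_right]
        refine (norm_sum_le _ _).trans (Finset.sum_le_sum fun j _ => ?_)
        rw [← slc_pr]
        refine (hcd p i j _ (slc_Mmax _ _ hE hT)).trans ?_
        rw [mul_assoc]
        exact mul_le_mul_of_nonneg_left (slc_norm _ _ _) hε.le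
      refine (Finset.sum_le_sum fun p _ => hblock p).trans ?_
      rw [Finset.sum_comm]
      simp_rw [Finset.sum_comm (s := (Finset.univ : Finset (Fin n → Bool))), ← Finset.mul_sum]
      have : ∑ i : Fin N₁, ∑ j : Fin N₂, ∑ p, ‖u p i‖ * ‖v p j‖ ≤ N₁ * N₂ * (√m₁ * √m₂) := by
        calc _ ≤ ∑ i : Fin N₁, ∑ j : Fin N₂, √m₁ * √m₂ := by
              refine Finset.sum_le_sum fun i _ => Finset.sum_le_sum fun j _ => ?_
              exact cs_le _ _ (Real.sqrt_nonneg _) (Real.sqrt_nonneg _)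
                (by rw [Real.sq_sqrt hm₁]; exact hu i) (by rw [Real.sq_sqrt hm₂]; exact hv j)
          _ = _ := by simp; ring
      have h9 := mul_le_mul_of_nonneg_left this (mul_nonneg hε.le (norm_nonneg T))
      linarith
    have t : Filter.Tendsto (fun ε : ℝ => ε * (‖T‖ * (N₁ * N₂ * (√m₁ * √m₂)))
        + ‖T‖ * (θ * ‖η‖ + ‖ξ‖ * θ + θ * θ)) (nhdsWithin 0 (Ioi 0))
        (nhds (0 * (‖T‖ * (N₁ * N₂ * (√m₁ * √m₂))) + ‖T‖ * (θ * ‖η‖ + ‖ξ‖ * θ + θ * θ))) :=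
      (Continuous.tendsto (by fun_prop) _).mono_left nhdsWithin_le_nhds
    rw [zero_mul, zero_add] at t
    refine ge_of_tendsto t ?_
    filter_upwards [self_mem_nhdsWithin] with ε he using hε ε he
  have t : Filter.Tendsto (fun θ : ℝ => ‖T‖ * (θ * ‖η‖ + ‖ξ‖ * θ + θ * θ)) (nhdsWithin 0 (Ioi 0))
      (nhds (‖T‖ * (0 * ‖η‖ + ‖ξ‖ * 0 + 0 * 0))) :=
    (Continuous.tendsto (by fun_prop) _).mono_left nhdsWithin_le_nhds
  simp only [zero_mul, mul_zero, add_zero] at t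
  have : ‖pr T ξ η‖ ≤ 0 := by
    refine ge_of_tendsto t ?_
    filter_upwards [self_mem_nhdsWithin] with θ he using hθ θ he
  exact norm_le_zero_iff.1 this
end


section restr
variable {X₁ X₂ : Type*} [MeasurableSpace X₁] [MeasurableSpace X₂] {μ₁ : Measure X₁} {μ₂ : Measure X₂}

lemma pj_idem {X : Type*} [MeasurableSpace X] {μ : Measure X} {A : Set X} (hA : MeasurableSet A)
    (ξ : HH (Lp ℂ 2 μ)) : amp (pj μ A) (amp (pj μ A) ξ) = amp (pj μ A) ξ := by
  ext n : 2
  simp only [amp_apply]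
  exact pj_eq hA (pj_supIn hA _)

lemma restr {T : Lp ℂ 2 μ₁ →L[ℂ] Lp ℂ 2 μ₂} {κ κ' : Set (X₁ × X₂)} (hT : T ∈ Mmax μ₁ μ₂ κ)
    {ξ : HH (Lp ℂ 2 μ₁)} {η : HH (Lp ℂ 2 μ₂)} (hv : Van ξ η κ) {P : Set X₁} {Q : Set X₂}
    (hP : MeasurableSet P) (hQ : MeasurableSet Q)
    (h : ∀ p : X₁ × X₂, p.1 ∈ P → p.2 ∈ Q → (p ∈ κ ↔ p ∈ κ')) (hS : Mmax μ₁ μ₂ κ' ⊆ An μ₁ μ₂ κ') :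
    pr T (amp (pj μ₁ P) ξ) (amp (pj μ₂ Q) η) = 0 := by
  rw [← pj_idem hP, ← pj_idem hQ, ← pr_pj hQ]
  refine hS ?_ _ _ ?_
  · rw [mem_Mmax] at hT ⊢
    intro α β hα hβ hr
    have h2 := hT (α ∩ P) (β ∩ Q) (hα.inter hP) (hβ.inter hQ) (by
      filter_upwards [hr] with p hp h1 h2 h3
      exact hp h1.1 h2.1 ((h p h1.2 h2.2).1 h3))
    intro f g hf hg
    have h3 := h2 (pj μ₁ P f) (pj μ₂ Q g)
      (by filter_upwards [pj_ae hP f, hf] with x h1 h4 h5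
          rw [h1]
          by_cases hx : x ∈ P
          · have : x ∉ α := fun h => h5 ⟨h, hx⟩
            simp [h4 this]
          · simp [hx])
      (by filter_upwards [pj_ae hQ g, hg] with x h1 h4 h5
          rw [h1]
          by_cases hx : x ∈ Q
          · have : x ∉ β := fun h => h5 ⟨h, hx⟩
            simp [h4 this]
          · simp [hx])
    rw [← h3]
    exact (pj_inner hQ g (T (pj μ₁ P f)))
  · filter_upwards [hv, ker_pj hP hQ ξ η] with p h1 h2 h3
    rw [h2]
    by_cases hp : p ∈ P ×ˢ Q
    · rw [indicator_of_mem hp]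
      exact h1 ((h p hp.1 hp.2).2 h3)
    · rw [indicator_of_notMem hp]

lemma Mmax_empty {T : Lp ℂ 2 μ₁ →L[ℂ] Lp ℂ 2 μ₂} (hT : T ∈ Mmax μ₁ μ₂ ∅) (ξ : HH (Lp ℂ 2 μ₁))
    (η : HH (Lp ℂ 2 μ₂)) : pr T ξ η = 0 := by
  rw [mem_Mmax] at hT
  have := hT univ univ MeasurableSet.univ MeasurableSet.univ (by simp)
  rw [pr_eq]
  have h : ∀ n, ⟪η n, T (ξ n)⟫ = 0 := fun n => this (ξ n) (η n) (by simp [SupIn]) (by simp [SupIn])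
  simp [h]

end restr

section blkdec
variable {X Y : Type*} [MeasurableSpace X] [MeasurableSpace Y] {μ : Measure X} {ν : Measure Y}

lemma blk_sum {f : X → ℕ → Bool} (hf : Measurable f) (n : ℕ) (ξ : HH (Lp ℂ 2 (μ.prod ν))) :
    ∑ p : Fin n → Bool, amp (pj (μ.prod ν) (blk f p ×ˢ univ)) ξ = ξ := by
  ext k : 2
  have e : (∑ p : Fin n → Bool, amp (pj (μ.prod ν) (blk f p ×ˢ univ)) ξ) k
      = ∑ p : Fin n → Bool, pj (μ.prod ν) (blk f p ×ˢ univ) (ξ k) := by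
    rw [lp.coeFn_sum, Finset.sum_apply]; rfl
  rw [e]
  apply Lp.ext
  have h1 : ∀ p : Fin n → Bool, ∀ᵐ x ∂(μ.prod ν), pj (μ.prod ν) (blk f p ×ˢ univ) (ξ k) x
      = (blk f p ×ˢ univ).indicator (ξ k) x := fun p => pj_ae ((blk_meas hf p).prod MeasurableSet.univ) (ξ k)
  filter_upwards [ae_all_iff.2 h1, Lp.coeFn_finsetSum Finset.univ
    (fun p : Fin n → Bool => pj (μ.prod ν) (blk f p ×ˢ univ) (ξ k))] with x hx hx2
  rw [hx2]
  simp only [Finset.sum_apply, hx]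
  rw [Finset.sum_eq_single (fun m : Fin n => f x.1 m)]
  · rw [indicator_of_mem]; exact ⟨fun m => rfl, trivial⟩
  · intro p _ hp
    rw [indicator_of_notMem]
    intro h
    exact hp (funext fun m => (h.1 m).symm)
  · simp
end blkdec

section thmP
variable {X₁ X₂ Y₁ Y₂ : Type*} [MeasurableSpace X₁] [MeasurableSpace X₂] [MeasurableSpace Y₁]
  [MeasurableSpace Y₂]
  {μ₁ : Measure X₁} {μ₂ : Measure X₂} {ν₁ : Measure Y₁} {ν₂ : Measure Y₂}

lemma blk_diag {T : Lp ℂ 2 (μ₁.prod ν₁) →L[ℂ] Lp ℂ 2 (μ₂.prod ν₂)}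
    {f : X₁ → ℕ → Bool} {g : X₂ → ℕ → Bool} (hf : Measurable f) (hg : Measurable g)
    (ξ : HH (Lp ℂ 2 (μ₁.prod ν₁))) (η : HH (Lp ℂ 2 (μ₂.prod ν₂))) (n : ℕ)
    (h : ∀ p p' : Fin n → Bool, p ≠ p' → pr T (amp (pj (μ₁.prod ν₁) (blk f p ×ˢ univ)) ξ)
      (amp (pj (μ₂.prod ν₂) (blk g p' ×ˢ univ)) η) = 0) :
    pr T ξ η = ∑ p : Fin n → Bool,
      pr T (amp (pj (μ₁.prod ν₁) (blk f p ×ˢ univ)) ξ) (amp (pj (μ₂.prod ν₂) (blk g p ×ˢ univ)) η) := by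
  conv_lhs => rw [← blk_sum hf n ξ, ← blk_sum hg n η, pr_sum_mid]
  refine Finset.sum_congr rfl fun p _ => ?_
  rw [pr_sum_right, Finset.sum_eq_single p]
  · intro p' _ hp; exact h p p' hp.symm
  · simp

def EE {C ι : Type*} (α : C → ℕ → Set X₁) (β : C → ℕ → Set X₂) (lam : ι → Set (Y₁ × Y₂))
    (s : Finset ι) (K : ι → Finset C) : Set ((X₁ × Y₁) × (X₂ × Y₂)) :=
  {q | ∃ i ∈ s, (∀ c ∈ K i, ∀ n, ¬ (q.1.1 ∈ α c n ∧ q.2.1 ∈ β c n)) ∧ (q.1.2, q.2.2) ∈ lam i}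

open Classical in
def cod {C X : Type*} [Encodable C] (A : Finset C) (α : C → ℕ → Set X) (x : X) (m : ℕ) : Bool :=
  match (Encodable.decode m : Option (C × ℕ)) with
  | some d => decide (d.1 ∈ A ∧ x ∈ α d.1 d.2)
  | none => false

lemma cod_meas {C X : Type*} [Encodable C] [MeasurableSpace X] (A : Finset C) {α : C → ℕ → Set X}
    (h : ∀ c n, MeasurableSet (α c n)) : Measurable (cod A α) := by
  classical
  refine measurable_pi_lambda _ fun m => ?_
  unfold cod
  cases (Encodable.decode m : Option (C × ℕ)) with
  | none => exact measurable_const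
  | some d =>
    refine measurable_to_bool ?_
    have : (fun x => decide (d.1 ∈ A ∧ x ∈ α d.1 d.2)) ⁻¹' {true} = {x | d.1 ∈ A ∧ x ∈ α d.1 d.2} := by
      ext x; simp
    simp only
    convert (MeasurableSet.const (d.1 ∈ A)).inter (h d.1 d.2) using 1
    ext x; simp

variable [SigmaFinite μ₁] [SigmaFinite μ₂] [SigmaFinite ν₁] [SigmaFinite ν₂]
  [StandardBorelSpace X₁] [StandardBorelSpace X₂] [StandardBorelSpace Y₁] [StandardBorelSpace Y₂]

theorem thmP {C ι : Type*} [Encodable C] [DecidableEq C] [DecidableEq ι] (α : C → ℕ → Set X₁)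
    (β : C → ℕ → Set X₂) (hc : ∀ c, Chain (α c) (β c)) (lam : ι → Set (Y₁ × Y₂))
    (hS : ∀ s : Finset ι, s.Nonempty → Mmax ν₁ ν₂ (⋃ i ∈ s, lam i) ⊆ An ν₁ ν₂ (⋃ i ∈ s, lam i)) :
    ∀ (N : ℕ) (s : Finset ι) (K : ι → Finset C), (s.biUnion K).card ≤ N →
      Mmax (μ₁.prod ν₁) (μ₂.prod ν₂) (EE α β lam s K) ⊆ An (μ₁.prod ν₁) (μ₂.prod ν₂) (EE α β lam s K) := by
  intro N
  induction N using Nat.strong_induction_on with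
  | _ N ih =>
  intro s K hN T hT ξ η hv
  rcases s.eq_empty_or_nonempty with rfl | hs
  · have : EE α β lam ∅ K = ∅ := by ext q; simp [EE]
    rw [this] at hT
    exact Mmax_empty hT ξ η
  set A := s.biUnion K with hA
  have ih' : ∀ (s' : Finset ι) (K' : ι → Finset C), s'.biUnion K' ⊂ A →
      Mmax (μ₁.prod ν₁) (μ₂.prod ν₂) (EE α β lam s' K') ⊆ An (μ₁.prod ν₁) (μ₂.prod ν₂) (EE α β lam s' K') := by
    intro s' K' h
    exact ih _ (lt_of_lt_of_le (Finset.card_lt_card h) hN) s' K' le_rfl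
  have hf : Measurable (cod A α) := cod_meas A fun c n => (hc c).ma n
  have hg : Measurable (cod A (fun c n => (β c n)ᶜ)) := cod_meas A fun c n => ((hc c).mb n).compl
  refine core (E := EE α β lam s K) (Λ := ⋃ i ∈ s, lam i) ?_ hT (hS s hs) hf hg ξ η ?_ ?_
  · rintro q ⟨i, hi, -, h⟩
    exact mem_iUnion₂.2 ⟨i, hi, h⟩
  · filter_upwards [hv] with q hq hfg hΛ
    obtain ⟨i, hi, h⟩ := mem_iUnion₂.1 hΛ
    refine hq ⟨i, hi, fun c hcK n hab => ?_, h⟩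
    have hcA : c ∈ A := Finset.mem_biUnion.2 ⟨i, hi, hcK⟩
    have := congrFun hfg (Encodable.encode (c, n))
    simp only [cod, Encodable.encodek] at this
    simp [hcA, hab.1, hab.2] at this
  · intro n
    refine blk_diag hf hg ξ η n fun p p' hp => ?_
    obtain ⟨m, hm⟩ := Function.ne_iff.1 hp
    have hP : MeasurableSet (blk (cod A α) p ×ˢ (univ : Set Y₁)) := (blk_meas hf p).prod MeasurableSet.univ
    have hQ : MeasurableSet (blk (cod A (fun c n => (β c n)ᶜ)) p' ×ˢ (univ : Set Y₂)) := (blk_meas hg p').prod MeasurableSet.univ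
    rcases hdec : (Encodable.decode (m : ℕ) : Option (C × ℕ)) with _ | ⟨c, k⟩
    · refine restr (κ' := ∅) hT hv hP hQ ?_ (fun T hT ξ η _ => Mmax_empty hT ξ η)
      rintro q ⟨h1, -⟩ ⟨h2, -⟩
      exfalso
      apply hm
      rw [← h1 m, ← h2 m]; simp [cod, hdec]
    by_cases hcA : c ∈ A
    swap
    · refine restr (κ' := ∅) hT hv hP hQ ?_ (fun T hT ξ η _ => Mmax_empty hT ξ η)
      rintro q ⟨h1, -⟩ ⟨h2, -⟩
      exfalso
      apply hm
      rw [← h1 m, ← h2 m]; simp [cod, hdec, hcA]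
    have m1 : ∀ x ∈ blk (cod A α) p, (p m = true ↔ x ∈ α c k) := by
      intro x hx; rw [← hx m]; simp [cod, hdec, hcA]
    have m2 : ∀ x ∈ blk (cod A (fun c n => (β c n)ᶜ)) p', (p' m = true ↔ x ∉ β c k) := by
      intro x hx; rw [← hx m]; simp [cod, hdec, hcA]
    rcases hpm : p m with _ | _
    · have hp'm : p' m = true := by
        rw [hpm] at hm; cases h : p' m <;> simp_all
      refine restr (κ' := EE α β lam s (fun i => (K i).erase c)) hT hv hP hQ ?_ (ih' _ _ ?_)
      · rintro ⟨⟨x₁, y₁⟩, ⟨x₂, y₂⟩⟩ ⟨h1, -⟩ ⟨h2, -⟩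
        have a1 : x₁ ∉ α c k := by rw [← m1 _ h1]; simp [hpm]
        have a2 : x₂ ∉ β c k := (m2 _ h2).1 hp'm
        simp only [EE, mem_setOf_eq]
        refine exists_congr fun i => and_congr_right fun hi => and_congr_left fun _ => ?_
        refine ⟨fun h c' hc' => h c' (Finset.mem_of_mem_erase hc'), fun h c' hc' n' hn' => ?_⟩
        by_cases e : c' = c
        · subst e
          rcases (hc c').cmp k n' with h | h
          · exact a1 (h.1 hn'.1)
          · exact a2 (h.2 hn'.2)
        · exact h c' (Finset.mem_erase.2 ⟨e, hc'⟩) n' hn'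
      · rw [Finset.ssubset_iff_of_subset]
        · exact ⟨c, hcA, by simp⟩
        · exact Finset.biUnion_mono fun i _ => Finset.erase_subset _ _
    · have hp'm : ¬ p' m = true := by
        rw [hpm] at hm; exact fun h => hm h.symm
      refine restr (κ' := EE α β lam (s.filter (fun i => c ∉ K i)) K) hT hv hP hQ ?_ (ih' _ _ ?_)
      · rintro ⟨⟨x₁, y₁⟩, ⟨x₂, y₂⟩⟩ ⟨h1, -⟩ ⟨h2, -⟩
        have a1 : x₁ ∈ α c k := (m1 _ h1).1 hpm
        have a2 : x₂ ∈ β c k := by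
          by_contra h; exact hp'm ((m2 _ h2).2 h)
        simp only [EE, mem_setOf_eq, Finset.mem_filter]
        refine exists_congr fun i => ⟨fun h => ⟨⟨h.1, fun hcK => h.2.1 c hcK k ⟨a1, a2⟩⟩, h.2⟩,
          fun h => ⟨h.1.1, h.2⟩⟩
      · rw [Finset.ssubset_iff_of_subset]
        · exact ⟨c, hcA, by simp⟩
        · exact Finset.biUnion_subset_biUnion_of_subset_left _ (Finset.filter_subset _ _)
end thmP


lemma omega_ctble {X₁ X₂ : Type*} [MeasurableSpace X₁] [MeasurableSpace X₂] {μ₁ : Measure X₁}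
    {μ₂ : Measure X₂} {κ : Set (X₁ × X₂)} {J : Type*} [Encodable J] (α : J → Set X₁) (β : J → Set X₂)
    (hα : ∀ j, MeasurableSet (α j)) (hβ : ∀ j, MeasurableSet (β j))
    (h : ∀ᶠ p in mae μ₁ μ₂, p ∈ κ ↔ ∀ j, ¬ (p.1 ∈ α j ∧ p.2 ∈ β j)) : OmegaClosed μ₁ μ₂ κ := by
  rw [omegaClosed_iff]
  refine ⟨fun n => ((Encodable.decode n : Option J)).elim ∅ α,
    fun n => ((Encodable.decode n : Option J)).elim ∅ β, fun n => ?_, fun n => ?_, ?_⟩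
  · beta_reduce
    cases (Encodable.decode n : Option J) with
    | none => exact MeasurableSet.empty
    | some j => exact hα j
  · beta_reduce
    cases (Encodable.decode n : Option J) with
    | none => exact MeasurableSet.empty
    | some j => exact hβ j
  · filter_upwards [h] with p hp
    rw [hp]
    constructor
    · intro h n
      cases (Encodable.decode n : Option J) with
      | none => simp
      | some j => exact h j
    · intro h j
      have := h (Encodable.encode j)
      simpa using this

lemma mem_flip {X₁ X₂ Y₁ Y₂ : Type*} {r : ℕ} (κs : Fin r → Set (X₁ × X₂)) (lams : Fin r → Set (Y₁ × Y₂))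
    (q : (X₁ × Y₁) × (X₂ × Y₂)) : q ∈ flipProd '' (⋃ i, (κs i) ×ˢ (lams i)) ↔
      ∃ i, (q.1.1, q.2.1) ∈ κs i ∧ (q.1.2, q.2.2) ∈ lams i := by
  constructor
  · rintro ⟨⟨⟨a, b⟩, ⟨c, d⟩⟩, h, rfl⟩
    obtain ⟨i, hi⟩ := mem_iUnion.1 h
    exact ⟨i, hi.1, hi.2⟩
  · rintro ⟨i, h1, h2⟩
    exact ⟨((q.1.1, q.2.1), (q.1.2, q.2.2)), mem_iUnion.2 ⟨i, h1, h2⟩, rfl⟩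

lemma flip_omega {X₁ X₂ Y₁ Y₂ : Type*}
    [MeasurableSpace X₁] [MeasurableSpace X₂] [MeasurableSpace Y₁] [MeasurableSpace Y₂]
    {μ₁ : Measure X₁} {μ₂ : Measure X₂} {ν₁ : Measure Y₁} {ν₂ : Measure Y₂}
    [SigmaFinite μ₁] [SigmaFinite μ₂] [SigmaFinite ν₁] [SigmaFinite ν₂]
    {r : ℕ} (κs : Fin r → Set (X₁ × X₂)) (lams : Fin r → Set (Y₁ × Y₂))
    (hκs : ∀ i, OmegaClosed μ₁ μ₂ (κs i)) (hlams : ∀ i, OmegaClosed ν₁ ν₂ (lams i)) :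
    OmegaClosed (μ₁.prod ν₁) (μ₂.prod ν₂) (flipProd '' (⋃ i, (κs i) ×ˢ (lams i))) := by
  simp only [omegaClosed_iff] at hκs hlams
  choose α β hα hβ h using hκs
  choose α' β' hα' hβ' h' using hlams
  let a : Fin r → ℕ ⊕ ℕ → Set (X₁ × Y₁) := fun i => Sum.elim (fun n => α i n ×ˢ univ) (fun n => univ ×ˢ α' i n)
  let b : Fin r → ℕ ⊕ ℕ → Set (X₂ × Y₂) := fun i => Sum.elim (fun n => β i n ×ˢ univ) (fun n => univ ×ˢ β' i n)
  have ha : ∀ i j, MeasurableSet (a i j) := by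
    rintro i (n | n)
    · exact (hα i n).prod MeasurableSet.univ
    · exact MeasurableSet.univ.prod (hα' i n)
  have hb : ∀ i j, MeasurableSet (b i j) := by
    rintro i (n | n)
    · exact (hβ i n).prod MeasurableSet.univ
    · exact MeasurableSet.univ.prod (hβ' i n)
  refine omega_ctble (J := Fin r → ℕ ⊕ ℕ) (fun j => ⋂ i, a i (j i)) (fun j => ⋂ i, b i (j i))
    (fun j => MeasurableSet.iInter fun i => ha i _) (fun j => MeasurableSet.iInter fun i => hb i _) ?_
  have e1 : ∀ᶠ q in mae (μ₁.prod ν₁) (μ₂.prod ν₂), ∀ i, (q.1.1, q.2.1) ∈ κs i ↔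
      ∀ n, ¬ (q.1.1 ∈ α i n ∧ q.2.1 ∈ β i n) := eventually_countable_forall.2 fun i => mae_fst (h i)
  have e2 : ∀ᶠ q in mae (μ₁.prod ν₁) (μ₂.prod ν₂), ∀ i, (q.1.2, q.2.2) ∈ lams i ↔
      ∀ n, ¬ (q.1.2 ∈ α' i n ∧ q.2.2 ∈ β' i n) := eventually_countable_forall.2 fun i => mae_snd (h' i)
  filter_upwards [e1, e2] with q h1 h2
  rw [mem_flip]
  have key : ∀ i, (¬ ((q.1.1, q.2.1) ∈ κs i ∧ (q.1.2, q.2.2) ∈ lams i)) ↔ ∃ j, q.1 ∈ a i j ∧ q.2 ∈ b i j := by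
    intro i
    rw [h1, h2, not_and_or]
    push Not
    simp [a, b, Sum.exists]
  rw [← not_iff_not]
  push Not
  simp only [← not_and, key, mem_iInter, ← forall_and]
  exact Classical.skolem

section fin
variable {X₁ X₂ Y₁ Y₂ : Type*} [MeasurableSpace X₁] [MeasurableSpace X₂] [MeasurableSpace Y₁]
  [MeasurableSpace Y₂]
  {μ₁ : Measure X₁} {μ₂ : Measure X₂} {ν₁ : Measure Y₁} {ν₂ : Measure Y₂}
  [SigmaFinite μ₁] [SigmaFinite μ₂] [SigmaFinite ν₁] [SigmaFinite ν₂]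
  [StandardBorelSpace X₁] [StandardBorelSpace X₂] [StandardBorelSpace Y₁] [StandardBorelSpace Y₂]

lemma flip_An {r : ℕ} (κs : Fin r → Set (X₁ × X₂)) (lams : Fin r → Set (Y₁ × Y₂))
    (hκs : ∀ i, FiniteWidthSet μ₁ μ₂ (κs i))
    (hS : ∀ s : Finset (Fin r), s.Nonempty → Mmax ν₁ ν₂ (⋃ i ∈ s, lams i) ⊆ An ν₁ ν₂ (⋃ i ∈ s, lams i)) :
    Mmax (μ₁.prod ν₁) (μ₂.prod ν₂) (flipProd '' (⋃ i, (κs i) ×ˢ (lams i))) ⊆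
      An (μ₁.prod ν₁) (μ₂.prod ν₂) (flipProd '' (⋃ i, (κs i) ×ˢ (lams i))) := by
  classical
  have hch := fun i => finiteWidth_chain (hκs i)
  choose k α β hc h using hch
  let a : (i : Fin r) × Fin (k i) → ℕ → Set X₁ := fun c => α c.1 c.2
  let b : (i : Fin r) × Fin (k i) → ℕ → Set X₂ := fun c => β c.1 c.2
  let K : Fin r → Finset ((i : Fin r) × Fin (k i)) := fun i => Finset.univ.filter (fun c => c.1 = i)
  have e1 : ∀ᶠ q in mae (μ₁.prod ν₁) (μ₂.prod ν₂), ∀ i, (q.1.1, q.2.1) ∈ κs i ↔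
      ∀ j n, ¬ (q.1.1 ∈ α i j n ∧ q.2.1 ∈ β i j n) := eventually_countable_forall.2 fun i => mae_fst (h i)
  have e2 : ∀ᶠ q in mae (μ₁.prod ν₁) (μ₂.prod ν₂), q ∈ flipProd '' (⋃ i, (κs i) ×ˢ (lams i)) ↔
      q ∈ EE a b lams Finset.univ K := by
    filter_upwards [e1] with q hq
    rw [mem_flip]
    simp only [EE, mem_setOf_eq, Finset.mem_univ, true_and]
    refine exists_congr fun i => and_congr_left fun _ => ?_
    rw [hq]
    constructor
    · rintro h ⟨i', j⟩ hj n
      obtain rfl : i' = i := by simpa [K] using hj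
      exact h j n
    · intro h j n
      exact h ⟨i, j⟩ (by simp [K]) n
  intro T hT ξ η hv
  have hT' := Mmax_mono (by filter_upwards [e2] with q hq using hq.1) hT
  refine thmP (μ₁ := μ₁) (μ₂ := μ₂) a b (fun c => hc c.1 c.2) lams hS _ Finset.univ K le_rfl hT' ξ η ?_
  filter_upwards [e2, hv] with q h1 h2 h3 using h2 (h1.2 h3)
end fin

/-- Theorem `th_fws`. -/
theorem statement16
    (X₁ X₂ Y₁ Y₂ : Type)
    [MeasurableSpace X₁] [StandardBorelSpace X₁]
    [MeasurableSpace X₂] [StandardBorelSpace X₂]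
    [MeasurableSpace Y₁] [StandardBorelSpace Y₁]
    [MeasurableSpace Y₂] [StandardBorelSpace Y₂]
    (μ₁ : Measure X₁) (μ₂ : Measure X₂) (ν₁ : Measure Y₁) (ν₂ : Measure Y₂)
    [SigmaFinite μ₁] [SigmaFinite μ₂] [SigmaFinite ν₁] [SigmaFinite ν₂]
    {r : ℕ} (κs : Fin r → Set (X₁ × X₂)) (lams : Fin r → Set (Y₁ × Y₂))
    (hκs : ∀ i, FiniteWidthSet μ₁ μ₂ (κs i))
    (hlams : ∀ i, OmegaClosed ν₁ ν₂ (lams i))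
    (hunions : ∀ s : Finset (Fin r), s.Nonempty →
      OperatorSynthetic ν₁ ν₂ (⋃ i ∈ s, lams i)) :
    OperatorSynthetic (μ₁.prod ν₁) (μ₂.prod ν₂)
      (flipProd '' (⋃ i, (κs i) ×ˢ (lams i))) := by
  have hω : ∀ i, OmegaClosed μ₁ μ₂ (κs i) := by
    intro i
    obtain ⟨V, -, h⟩ := hκs i
    exact h.1
  exact synth_of_An (flip_omega κs lams hω hlams)
    (flip_An κs lams hκs fun s hs => synth_An (hunions s hs))
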